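/- Let (A, 𝔪) be a commutative Noetherian local ring with residue field k = A/𝔪 which is an algebra over ℂ, of Krull dimension n. Let E be a chain complex of finitely generated free A-modules with E_i = 0 for i < 0, and suppose: (1) for every non-maximal prime ideal 𝔭 of A and every i, H_i(E ⊗_A κ(𝔭)) = 0, where κ(𝔭) is the residue field of A_𝔭; (2) H_i(E ⊗_A k) = 0 unless 0 ≤ i ≤ n; and (3) H_0(E) ≅ k. Then A is a regular local ring and E is quasi-isomorphic to the complex consisting of k concentrated in degree 0, i.e. H_i(E) = 0 for all i ≠ 0 and H_0(E) ≅ k. -/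

import Mathlib

section Specialization

/-- The evaluation of integral polynomials at a family of elements of a commutative ring. -/
noncomputable abbrev intEval {B R : Type*} [CommRing R] (b : B → R) : MvPolynomial B ℤ →+* R :=
  MvPolynomial.eval₂Hom (Int.castRingHom R) b

theorem map_intEval {B R S : Type*} [CommRing R] [CommRing S] (φ : R →+* S) (b : B → R)
    (P : MvPolynomial B ℤ) : φ (intEval b P) = intEval (fun i => φ (b i)) P := by
  have : φ.comp (intEval b) = intEval (fun i => φ (b i)) :=
    MvPolynomial.ringHom_ext (fun r => by simp) fun i => by simp
  exact congrArg (fun h : MvPolynomial B ℤ →+* S => h P) this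

theorem intEval_eq_zero_of_fractions {Q R S B ι : Type*} [CommRing Q] [CommRing R] [IsDomain R]
    [CommRing S] [IsDomain S] (χ : Q →+* R) (hχ : Function.Injective χ) (χ' : Q →+* S)
    (b : B → Q) (γ : Q) (hg : χ γ ≠ 0) (hg' : χ' γ ≠ 0) (G : ι → Q) (z : ι → R) (z' : ι → S)
    (hz : ∀ j, χ γ * z j = χ (G j)) (hz' : ∀ j, χ' γ * z' j = χ' (G j))
    (P : MvPolynomial (B ⊕ ι) ℤ) (hP : intEval (Sum.elim (fun i => χ (b i)) z) P = 0) :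
    intEval (Sum.elim (fun i => χ' (b i)) z') P = 0 := by
  have hu : IsUnit ((algebraMap R (FractionRing R)).comp χ γ) :=
    IsUnit.mk0 _ (by simpa using hg)
  have hu' : IsUnit ((algebraMap S (FractionRing S)).comp χ' γ) :=
    IsUnit.mk0 _ (by simpa using hg')
  let χl : Localization.Away γ →+* FractionRing R := IsLocalization.Away.lift γ hu
  let χl' : Localization.Away γ →+* FractionRing S := IsLocalization.Away.lift γ hu'
  have hχl1 (q : Q) : χl (algebraMap Q _ q) = algebraMap R (FractionRing R) (χ q) :=
    IsLocalization.Away.lift_eq γ hu q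
  have hχl1' (q : Q) : χl' (algebraMap Q _ q) = algebraMap S (FractionRing S) (χ' q) :=
    IsLocalization.Away.lift_eq γ hu' q
  have hχl : Function.Injective χl := by
    rw [injective_iff_map_eq_zero]
    intro a ha
    obtain ⟨q, s, rfl⟩ := IsLocalization.exists_mk'_eq (Submonoid.powers γ) a
    have hq : algebraMap R (FractionRing R) (χ q) = 0 := by
      have := congrArg χl (IsLocalization.mk'_spec (Localization.Away γ) q s)
      rw [map_mul, ha, zero_mul, hχl1] at this
      exact this.symm
    have : q = 0 := ((IsFractionRing.injective R (FractionRing R)).comp hχ) (by simpa using hq)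
    rw [this, IsLocalization.mk'_zero]
  let y : B ⊕ ι → Localization.Away γ := Sum.elim (fun β => algebraMap Q _ (b β))
      (fun j => algebraMap Q _ (G j) * IsLocalization.Away.invSelf γ)
  have hinv : algebraMap Q (Localization.Away γ) γ * IsLocalization.Away.invSelf γ = 1 :=
    IsLocalization.Away.mul_invSelf γ
  have e1 : χl (intEval y P) =
      algebraMap R (FractionRing R) (intEval (Sum.elim (fun i => χ (b i)) z) P) := by
    rw [map_intEval, map_intEval]
    congr 2
    funext i
    rcases i with β | j
    · simp only [y, Sum.elim_inl, hχl1]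
    · have h2 := congrArg χl hinv
      rw [map_mul, map_one, hχl1] at h2
      simp only [y, Sum.elim_inr, map_mul, hχl1, ← hz]
      linear_combination (algebraMap R (FractionRing R) (z j)) * h2
  have e2 : χl' (intEval y P) =
      algebraMap S (FractionRing S) (intEval (Sum.elim (fun i => χ' (b i)) z') P) := by
    rw [map_intEval, map_intEval]
    congr 2
    funext i
    rcases i with β | j
    · simp only [y, Sum.elim_inl, hχl1']
    · have h2 := congrArg χl' hinv
      rw [map_mul, map_one, hχl1'] at h2
      simp only [y, Sum.elim_inr, map_mul, hχl1', ← hz']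
      linear_combination (algebraMap S (FractionRing S) (z' j)) * h2
  rw [hP, map_zero] at e1
  rw [hχl (e1.trans (map_zero χl).symm), map_zero] at e2
  exact (IsFractionRing.injective S (FractionRing S)) (by rw [← e2, map_zero])

open Polynomial in
/-- A family of fractions `G j / g` over `ℤ[b, θ]` specializes along every specialization of
`(b, θ)` which does not kill `g`. -/
theorem intEval_eq_zero_of_presentation {R S B ι : Type*} [CommRing R] [IsDomain R]
    [CommRing S] [IsDomain S] (b : B → R) (θ : R) (f : (MvPolynomial B ℤ)[X])
    (hf : ∀ H : (MvPolynomial B ℤ)[X], H.eval₂ (intEval b) θ = 0 → f ∣ H)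
    (g : MvPolynomial B ℤ) (hg : intEval b g ≠ 0)
    (z : ι → R) (G : ι → (MvPolynomial B ℤ)[X])
    (hG : ∀ j, intEval b g * z j = (G j).eval₂ (intEval b) θ)
    (b' : B → S) (θ' : S) (hf' : f.eval₂ (intEval b') θ' = 0)
    (hg' : intEval b' g ≠ 0) (z' : ι → S)
    (hG' : ∀ j, intEval b' g * z' j = (G j).eval₂ (intEval b') θ')
    (P : MvPolynomial (B ⊕ ι) ℤ) (hP : intEval (Sum.elim b z) P = 0) :
    intEval (Sum.elim b' z') P = 0 := by
  set ψ := eval₂RingHom (intEval b) θ with hψ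
  set ψ' := eval₂RingHom (intEval b') θ' with hψ'
  have hker : ∀ H, ψ H = 0 → ψ' H = 0 := by
    intro H hH
    obtain ⟨Q, rfl⟩ := hf H hH
    rw [map_mul, show ψ' f = 0 from hf', zero_mul]
  set J := RingHom.ker ψ
  let χ : (MvPolynomial B ℤ)[X] ⧸ J →+* R := Ideal.Quotient.lift J ψ (fun a ha => ha)
  let χ' : (MvPolynomial B ℤ)[X] ⧸ J →+* S := Ideal.Quotient.lift J ψ' (fun a ha => hker a ha)
  have hχ : Function.Injective χ := RingHom.kerLift_injective ψ
  have hχm (H) : χ (Ideal.Quotient.mk J H) = H.eval₂ (intEval b) θ := rfl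
  have hχm' (H) : χ' (Ideal.Quotient.mk J H) = H.eval₂ (intEval b') θ' := rfl
  have key := intEval_eq_zero_of_fractions χ hχ χ'
    (fun β => Ideal.Quotient.mk J (C (MvPolynomial.X β))) (Ideal.Quotient.mk J (C g))
    (by rwa [hχm, eval₂_C]) (by rwa [hχm', eval₂_C]) (fun j => Ideal.Quotient.mk J (G j)) z z'
    (fun j => by rw [hχm, eval₂_C, hχm, hG]) (fun j => by rw [hχm', eval₂_C, hχm', hG']) P
  simp only [hχm, hχm', eval₂_C, MvPolynomial.eval₂Hom_X'] at key
  exact key hP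

end Specialization

section PrimitiveElement

universe u
open Polynomial in
theorem exists_integral_primitive_element_of_fraction_fields {T R : Type*} [CommRing T] [IsDomain T]
    [CharZero T] [IsIntegrallyClosed T] [CommRing R] [IsDomain R] [Algebra T R] [FaithfulSMul T R]
    [Algebra.IsAlgebraic T R] [Algebra.FiniteType T R] (K L : Type*) [Field K] [Field L]
    [Algebra T K] [IsFractionRing T K] [Algebra R L] [IsFractionRing R L] [Algebra T L]
    [IsScalarTower T R L] [Algebra K L] [IsScalarTower T K L] {ι : Type*} [Finite ι] (z : ι → R) :
    ∃ θ : R, IsIntegral T θ ∧ aeval θ (derivative (minpoly T θ)) ≠ 0 ∧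
      ∃ g : T, g ≠ 0 ∧ ∃ G : ι → T[X], ∀ j, algebraMap T R g * z j = aeval θ (G j) := by
  have hTR : Function.Injective (algebraMap T R) := FaithfulSMul.algebraMap_injective T R
  have hTL : Function.Injective (algebraMap T L) := by
    rw [IsScalarTower.algebraMap_eq T R L]
    exact (IsFractionRing.injective R L).comp hTR
  have : Algebra.IsAlgebraic R L :=
    (IsFractionRing.comap_isAlgebraic_iff (K := L)).mpr inferInstance
  have : Algebra.IsAlgebraic T L := Algebra.IsAlgebraic.trans T R L
  have : Algebra.IsAlgebraic K L := IsFractionRing.comap_isAlgebraic_iff.mp this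
  have : Algebra.EssFiniteType R L := Algebra.EssFiniteType.of_isLocalization _ (nonZeroDivisors R)
  have : Algebra.EssFiniteType T L := Algebra.EssFiniteType.comp T R L
  have : Algebra.EssFiniteType K L := Algebra.EssFiniteType.of_comp T K L
  have : FiniteDimensional K L := Algebra.finite_of_essFiniteType_of_isAlgebraic
  have : CharZero K := charZero_of_injective_algebraMap (IsFractionRing.injective T K)
  obtain ⟨θ₀, hθ₀⟩ := Field.exists_primitive_element K L
  obtain ⟨a, b, hb, rfl⟩ := IsFractionRing.div_surjective (A := R) θ₀
  obtain ⟨r, hr, s, hs⟩ := (Algebra.IsAlgebraic.isAlgebraic (R := T) b).exists_nonzero_dvd hb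
  obtain ⟨y, hy, h_int⟩ :=
    (Algebra.IsAlgebraic.isAlgebraic (R := T) (a * s)).exists_integral_multiple
  set θ := y • (a * s) with hθ
  have hθL : algebraMap R L θ = algebraMap K L (algebraMap T K (y * r)) *
      (algebraMap R L a / algebraMap R L b) := by
    have hb0 : algebraMap R L b ≠ 0 := by
      simpa using nonZeroDivisors.ne_zero hb
    have h1 : algebraMap T L r = algebraMap R L b * algebraMap R L s := by
      rw [← map_mul, ← hs, IsScalarTower.algebraMap_apply T R L]
    rw [← IsScalarTower.algebraMap_apply T K L, map_mul, h1, hθ, Algebra.smul_def, map_mul,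
      ← IsScalarTower.algebraMap_apply T R L, map_mul]
    have h2 : algebraMap R L b * (algebraMap R L a / algebraMap R L b) = algebraMap R L a :=
      mul_div_cancel₀ _ hb0
    linear_combination -(algebraMap T L y * algebraMap R L s) * h2
  have htop : IntermediateField.adjoin K {algebraMap R L θ} = ⊤ := by
    rw [eq_top_iff, ← hθ₀, IntermediateField.adjoin_simple_le_iff]
    have hc : algebraMap K L (algebraMap T K (y * r)) ≠ 0 := by
      rw [← IsScalarTower.algebraMap_apply T K L]
      exact (map_ne_zero_iff _ hTL).2 (mul_ne_zero hy hr)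
    have : algebraMap R L a / algebraMap R L b =
        (algebraMap K L (algebraMap T K (y * r)))⁻¹ * algebraMap R L θ := by
      rw [hθL, inv_mul_cancel_left₀ hc]
    rw [this]
    exact mul_mem (inv_mem (IntermediateField.algebraMap_mem _ _))
      (IntermediateField.mem_adjoin_simple_self K _)
  refine ⟨θ, h_int, ?_, ?_⟩
  · have hsep := (Algebra.IsSeparable.isSeparable K (algebraMap R L θ))
    have h := hsep.aeval_derivative_ne_zero (minpoly.aeval K (algebraMap R L θ))
    rw [minpoly.isIntegrallyClosed_eq_field_fractions K L h_int, derivative_map,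
      aeval_map_algebraMap, aeval_algebraMap_apply] at h
    exact fun h0 => h (by rw [h0, map_zero])
  · have hz (j) : ∃ q : K[X], aeval (algebraMap R L θ) q = algebraMap R L (z j) := by
      have : algebraMap R L (z j) ∈ IntermediateField.adjoin K {algebraMap R L θ} := by
        rw [htop]; trivial
      rw [← IntermediateField.mem_toSubalgebra,
        IntermediateField.adjoin_simple_toSubalgebra_of_isAlgebraic
          (Algebra.IsAlgebraic.isAlgebraic _), Algebra.adjoin_singleton_eq_range_aeval] at this
      exact this
    choose q hq using hz
    have hq' (j) : ∃ g : T, g ≠ 0 ∧ ∃ G : T[X], algebraMap T R g * z j = aeval θ G := by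
      obtain ⟨b, hb, hG⟩ := IsLocalization.integerNormalization_spec (nonZeroDivisors T) (q j)
      refine ⟨b, nonZeroDivisors.ne_zero hb,
        IsLocalization.integerNormalization (nonZeroDivisors T) (q j), IsFractionRing.injective R L ?_⟩
      have h1 : aeval (algebraMap R L θ) (b • q j) = b • aeval (algebraMap R L θ) (q j) := by
        rw [← algebraMap_smul K b (q j), ← algebraMap_smul K b, map_smul]
      rw [← aeval_algebraMap_apply, ← aeval_map_algebraMap K, hG, h1, hq, map_mul,
        ← IsScalarTower.algebraMap_apply T R L, Algebra.smul_def]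
    choose g hg G hG using hq'
    classical
    have := Fintype.ofFinite ι
    refine ⟨∏ i, g i, Finset.prod_ne_zero_iff.2 fun i _ => hg i,
      fun j => C (∏ i ∈ Finset.univ.erase j, g i) * G j, fun j => ?_⟩
    rw [map_mul, aeval_C, ← hG, ← Finset.mul_prod_erase _ g (Finset.mem_univ j), map_mul]
    ring

open Polynomial in
/-- A primitive element for an algebraic extension of domains of finite type in characteristic
zero, chosen integral. -/
theorem exists_integral_primitive_element {T R : Type*} [CommRing T] [IsDomain T] [CharZero T]
    [IsIntegrallyClosed T] [CommRing R] [IsDomain R] [Algebra T R] [FaithfulSMul T R]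
    [Algebra.IsAlgebraic T R] [Algebra.FiniteType T R] {ι : Type*} [Finite ι] (z : ι → R) :
    ∃ θ : R, IsIntegral T θ ∧ aeval θ (derivative (minpoly T θ)) ≠ 0 ∧
      ∃ g : T, g ≠ 0 ∧ ∃ G : ι → T[X], ∀ j, algebraMap T R g * z j = aeval θ (G j) := by
  let := FractionRing.liftAlgebra T (FractionRing R)
  have := FractionRing.isScalarTower_liftAlgebra T (FractionRing R)
  exact exists_integral_primitive_element_of_fraction_fields (FractionRing T) (FractionRing R) z

open Polynomial in
theorem exists_presentation_of_adjoin_eq_top {R : Type u} {κ ι : Type*} [CommRing R] [IsDomain R] [CharZero R]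
    [Finite κ] [Finite ι] (x : κ → R) (hx : AlgebraicIndependent ℤ x) (z : ι → R)
    (htop : Algebra.adjoin ℤ (Set.range x ∪ Set.range z) = ⊤) :
    ∃ (B : Type u) (_ : Finite B) (b : B → R) (i : κ → B) (_ : ∀ k, b (i k) = x k) (θ : R)
      (f : (MvPolynomial B ℤ)[X]) (g : MvPolynomial B ℤ) (G : ι → (MvPolynomial B ℤ)[X]),
      f.eval₂ (intEval b) θ = 0 ∧ (derivative f).eval₂ (intEval b) θ ≠ 0 ∧
      (∀ H : (MvPolynomial B ℤ)[X], H.eval₂ (intEval b) θ = 0 → f ∣ H) ∧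
      intEval b g ≠ 0 ∧ ∀ j, intEval b g * z j = (G j).eval₂ (intEval b) θ := by
  have : Algebra.IsAlgebraic (Algebra.adjoin ℤ (Set.range x ∪ Set.range z)) R := by
    refine ⟨fun a => ?_⟩
    have ha : a ∈ Algebra.adjoin ℤ (Set.range x ∪ Set.range z) := by rw [htop]; trivial
    exact isAlgebraic_algebraMap (R := Algebra.adjoin ℤ (Set.range x ∪ Set.range z)) ⟨a, ha⟩
  obtain ⟨B, hxB, hB, hbas⟩ := exists_isTranscendenceBasis_between (R := ℤ) (Set.range x)
    (Set.range x ∪ Set.range z) Set.subset_union_left (AlgebraicIndependent.coe_range hx)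
  have hfin : B.Finite := ((Set.finite_range x).union (Set.finite_range z)).subset hB
  let : Algebra (MvPolynomial B ℤ) R := (intEval ((↑) : B → R)).toAlgebra
  have hmap : algebraMap (MvPolynomial B ℤ) R = intEval ((↑) : B → R) := rfl
  have hmap' (P) : intEval ((↑) : B → R) P = MvPolynomial.aeval ((↑) : B → R) P := by
    rw [MvPolynomial.aeval_def, MvPolynomial.coe_eval₂Hom]; rfl
  have hinj : Function.Injective (algebraMap (MvPolynomial B ℤ) R) := by
    intro P Q h
    rw [hmap, hmap', hmap'] at h
    exact hbas.1 h
  have : FaithfulSMul (MvPolynomial B ℤ) R := (faithfulSMul_iff_algebraMap_injective _ _).2 hinj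
  have : Algebra.IsAlgebraic (MvPolynomial B ℤ) R := by
    have := hbas.isAlgebraic
    refine ⟨fun a => ?_⟩
    have ha := this.isAlgebraic a
    refine IsAlgebraic.of_ringHom_of_comp_eq hbas.1.aevalEquiv (RingHom.id R)
      (a := a) ?_ hbas.1.aevalEquiv.surjective Function.injective_id ?_
    · simpa using ha
    · refine RingHom.ext fun P => ?_
      exact (hbas.1.algebraMap_aevalEquiv P).trans (hmap' P).symm
  have : IsScalarTower ℤ (MvPolynomial B ℤ) R := IsScalarTower.of_algebraMap_eq' (RingHom.ext_int _ _)
  have : Algebra.FiniteType ℤ R :=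
    ⟨⟨(((Set.finite_range x).union (Set.finite_range z))).toFinset, by simpa using htop⟩⟩
  have : Algebra.FiniteType (MvPolynomial B ℤ) R :=
    Algebra.FiniteType.of_restrictScalars_finiteType ℤ _ _
  obtain ⟨θ, hθ, hd, g, hg, G, hG⟩ := exists_integral_primitive_element (T := MvPolynomial B ℤ) z
  refine ⟨B, hfin, (↑), fun k => ⟨x k, hxB ⟨k, rfl⟩⟩, fun k => rfl, θ, minpoly _ θ, g, G, minpoly.aeval _ θ, hd, fun H hH =>
    minpoly.isIntegrallyClosed_dvd hθ hH, (map_ne_zero_iff _ hinj).2 hg, hG⟩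

open Polynomial in
theorem exists_presentation {R : Type u} {κ ι : Type*} [CommRing R] [IsDomain R] [CharZero R]
    [Finite κ] [Finite ι] (x : κ → R) (hx : AlgebraicIndependent ℤ x) (z : ι → R) :
    ∃ (B : Type u) (_ : Finite B) (b : B → R) (i : κ → B) (_ : ∀ k, b (i k) = x k) (θ : R)
      (f : (MvPolynomial B ℤ)[X]) (g : MvPolynomial B ℤ) (G : ι → (MvPolynomial B ℤ)[X]),
      f.eval₂ (intEval b) θ = 0 ∧ (derivative f).eval₂ (intEval b) θ ≠ 0 ∧
      (∀ H : (MvPolynomial B ℤ)[X], H.eval₂ (intEval b) θ = 0 → f ∣ H) ∧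
      intEval b g ≠ 0 ∧ ∀ j, intEval b g * z j = (G j).eval₂ (intEval b) θ := by
  let S := Algebra.adjoin ℤ (Set.range x ∪ Set.range z)
  let φ : S →+* R := S.subtype
  have hφ : Function.Injective φ := Subtype.val_injective
  let x' : κ → S := fun k => ⟨x k, Algebra.subset_adjoin (Or.inl ⟨k, rfl⟩)⟩
  let z' : ι → S := fun k => ⟨z k, Algebra.subset_adjoin (Or.inr ⟨k, rfl⟩)⟩
  have hx' : AlgebraicIndependent ℤ x' := AlgebraicIndependent.of_comp S.val hx
  have htop : Algebra.adjoin ℤ (Set.range x' ∪ Set.range z') = ⊤ := by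
    rw [← Algebra.adjoin_adjoin_coe_preimage (R := ℤ) (s := Set.range x ∪ Set.range z)]
    congr 1
    ext ⟨a, ha⟩
    simp [x', z', S]
  obtain ⟨B, hB, b, i, hi, θ, f, g, G, h1, h2, h3, h4, h5⟩ :=
    exists_presentation_of_adjoin_eq_top x' hx' z' htop
  have hcomp : φ.comp (intEval b) = intEval (fun β => φ (b β)) :=
    RingHom.ext fun P => map_intEval φ b P
  have heval (H : (MvPolynomial B ℤ)[X]) :
      φ (H.eval₂ (intEval b) θ) = H.eval₂ (intEval (fun β => φ (b β))) (φ θ) := by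
    rw [hom_eval₂, hcomp]
  refine ⟨B, hB, fun β => φ (b β), i, fun k => congrArg φ (hi k), φ θ, f, g, G, ?_, ?_, ?_, ?_, ?_⟩
  · rw [← heval, h1, map_zero]
  · rw [← heval]; exact (map_ne_zero_iff _ hφ).2 h2
  · intro H hH
    rw [← heval] at hH
    exact h3 H (hφ (hH.trans (map_zero φ).symm))
  · rw [← map_intEval]; exact (map_ne_zero_iff _ hφ).2 h4
  · intro j
    rw [← map_intEval, ← heval, ← h5, map_mul]; rfl

end PrimitiveElement

section Newton

theorem PowerSeries.exists_eq_add_X_mul_eval {S : Type*} [CommRing S]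
    (Ψ : Polynomial (PowerSeries S)) (v : PowerSeries S) :
    ∃ e : PowerSeries S, e = v + X * Ψ.eval e := by
  let F : PowerSeries S → PowerSeries S := fun e => v + X * Ψ.eval e
  have hF (m : ℕ) (a b : PowerSeries S) (h : X ^ m ∣ a - b) : X ^ (m + 1) ∣ F a - F b := by
    have : F a - F b = X * (Ψ.eval a - Ψ.eval b) := by simp only [F]; ring
    rw [this, pow_succ']
    exact mul_dvd_mul_left _ (h.trans (Polynomial.sub_dvd_eval_sub a b Ψ))
  let c : ℕ → PowerSeries S := fun m => F^[m] 0
  have hc (m : ℕ) : c (m + 1) = F (c m) := Function.iterate_succ_apply' F m 0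
  have hstep (m : ℕ) : X ^ m ∣ c (m + 1) - c m := by
    induction m with
    | zero => simp
    | succ m ih => rw [hc, hc m]; exact hF m _ _ (by rw [← hc]; exact ih)
  have hcau (m k : ℕ) : X ^ m ∣ c (m + k) - c m := by
    induction k with
    | zero => simp
    | succ k ih =>
      have := dvd_add ((pow_dvd_pow X (Nat.le_add_right m k)).trans (hstep (m + k))) ih
      rwa [sub_add_sub_cancel] at this
  let e : PowerSeries S := PowerSeries.mk fun m => coeff m (c (m + 1))
  have he (m : ℕ) : X ^ m ∣ e - c m := by
    rw [X_pow_dvd_iff]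
    intro i hi
    obtain ⟨k, rfl⟩ := Nat.exists_eq_add_of_lt hi
    have := (X_pow_dvd_iff.1 (hcau (i + 1) k)) i (Nat.lt_succ_self i)
    rw [map_sub, sub_eq_zero] at this
    rw [map_sub, sub_eq_zero, coeff_mk, ← this]
    congr 2
    ring
  refine ⟨e, ?_⟩
  ext m
  have h1 : X ^ (m + 1) ∣ F e - e := by
    have h2 := (pow_dvd_pow X (Nat.le_succ (m + 1))).trans (hF _ _ _ (he (m + 1)))
    have h3 := (pow_dvd_pow X (Nat.le_succ (m + 1))).trans (he (m + 1 + 1))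
    have := dvd_sub h2 h3
    rw [hc (m + 1)] at this
    simpa using this
  have := (X_pow_dvd_iff.1 h1) m (Nat.lt_succ_self m)
  rw [map_sub, sub_eq_zero] at this
  exact this.symm

/-- Newton's lemma along the ideal generated by the variable of a power series ring. -/
theorem PowerSeries.exists_root_of_eval_eq {S : Type*} [CommRing S]
    (f : Polynomial (PowerSeries S)) (ρ g v : PowerSeries S)
    (h : f.eval ρ = X * g * f.derivative.eval ρ ^ 2 * v) :
    ∃ e, f.eval (ρ + X * g * f.derivative.eval ρ * e) = 0 := by
  let y := X * g * f.derivative.eval ρ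
  obtain ⟨k, hk⟩ := Polynomial.binomExpansion (f.map (Polynomial.C (R := PowerSeries S))) (Polynomial.C ρ)
    (Polynomial.C y * Polynomial.X)
  obtain ⟨e, he⟩ := exists_eq_add_X_mul_eval (S := S)
    (-(Polynomial.C g * Polynomial.X ^ 2 * k)) (-v)
  refine ⟨e, ?_⟩
  have hk' := congrArg (Polynomial.eval e) hk
  have hmap (q : Polynomial (PowerSeries S)) (r : Polynomial (PowerSeries S)) :
      ((q.map Polynomial.C).eval r).eval e = q.eval (r.eval e) := by
    rw [Polynomial.eval_map, ← Polynomial.comp, Polynomial.eval_comp]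
  simp only [Polynomial.derivative_map, Polynomial.eval_add, Polynomial.eval_mul,
    Polynomial.eval_pow, hmap, Polynomial.eval_C, Polynomial.eval_X, h] at hk'
  rw [show ρ + X * g * f.derivative.eval ρ * e = ρ + y * e from rfl, hk']
  simp only [Polynomial.eval_neg, Polynomial.eval_mul, Polynomial.eval_pow, Polynomial.eval_C,
    Polynomial.eval_X] at he
  simp only [y]
  linear_combination (X * g * f.derivative.eval ρ ^ 2) * he

/-- A distinguished polynomial dividing a polynomial in the power series ring divides it as a
polynomial. -/
theorem Polynomial.IsDistinguishedAt.dvd_of_coe_dvd {R : Type*} [CommRing R] [IsLocalRing R]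
    [IsHausdorff (IsLocalRing.maximalIdeal R) R] {a : Polynomial R}
    (ha : a.IsDistinguishedAt (IsLocalRing.maximalIdeal R)) {P : Polynomial R}
    (h : (a : PowerSeries R) ∣ (P : PowerSeries R)) : a ∣ P := by
  rw [← Polynomial.modByMonic_eq_zero_iff_dvd ha.monic]
  obtain ⟨s, hs⟩ := h
  have hdiv : (P : PowerSeries R) = a * (P /ₘ a : Polynomial R) + (P %ₘ a : Polynomial R) := by
    rw [← Polynomial.coe_mul, ← Polynomial.coe_add, add_comm, Polynomial.modByMonic_add_div]
  have hdeg := Polynomial.degree_modByMonic_lt P ha.monic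
  have hfac : PowerSeries.IsWeierstrassFactorization (a : PowerSeries R) a 1 :=
    ⟨ha, isUnit_one, by simp⟩
  have hne := hfac.map_ne_zero
  have hord := hfac.natDegree_eq_toNat_order_map
  have h1 : PowerSeries.IsWeierstrassDivision (P : PowerSeries R) a (P /ₘ a : Polynomial R)
      (P %ₘ a) := by
    refine ⟨?_, hdiv⟩
    rw [Polynomial.degree_eq_natDegree ha.monic.ne_zero] at hdeg
    exact hdeg.trans_le (by rw [hord]; rfl)
  have h2 : PowerSeries.IsWeierstrassDivision (P : PowerSeries R) a s 0 :=
    ⟨by simp, by simpa using hs⟩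
  exact (h1.elim hne h2).2

theorem Polynomial.IsDistinguishedAt.exists_coe_congruent {R : Type*} [CommRing R] [IsLocalRing R]
    [IsAdicComplete (IsLocalRing.maximalIdeal R) R] {a : Polynomial R}
    (ha : a.IsDistinguishedAt (IsLocalRing.maximalIdeal R)) (b : PowerSeries R) :
    ∃ r : Polynomial R, (a : PowerSeries R) ∣ b - r ∧
      ∀ P : Polynomial R, b = (P : PowerSeries R) → r = P := by
  by_cases hb : ∃ P : Polynomial R, b = (P : PowerSeries R)
  · obtain ⟨P, rfl⟩ := hb
    exact ⟨P, by simp, fun Q hQ => Polynomial.coe_injective _ hQ⟩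
  · have hfac : PowerSeries.IsWeierstrassFactorization (a : PowerSeries R) a 1 :=
      ⟨ha, isUnit_one, by simp⟩
    obtain ⟨q, r, h⟩ := PowerSeries.exists_isWeierstrassDivision b hfac.map_ne_zero
    exact ⟨r, ⟨q, by rw [h.eq_mul_add]; ring⟩, fun P hP => absurd ⟨P, hP⟩ hb⟩

theorem Polynomial.isDistinguishedAt_X {R : Type*} [CommRing R] [Nontrivial R] (I : Ideal R) :
    (Polynomial.X : Polynomial R).IsDistinguishedAt I := by
  refine ⟨⟨fun {m} hm => ?_⟩, Polynomial.monic_X⟩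
  rw [Polynomial.natDegree_X, Nat.lt_one_iff] at hm
  simp [hm]

end Newton

section Approximation

open Polynomial

theorem map_eval₂_intEval {B R S : Type*} [CommRing R] [CommRing S] (φ : R →+* S) (b : B → R)
    (θ : R) (H : (MvPolynomial B ℤ)[X]) :
    φ (H.eval₂ (intEval b) θ) = H.eval₂ (intEval fun β => φ (b β)) (φ θ) := by
  rw [hom_eval₂]
  congr 1
  exact RingHom.ext fun P => map_intEval φ b P

theorem dvd_intEval_sub {B R : Type*} [CommRing R] {a : R} {b b' : B → R}
    (h : ∀ β, a ∣ b β - b' β) (P : MvPolynomial B ℤ) : a ∣ intEval b P - intEval b' P := by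
  rw [← Ideal.mem_span_singleton, ← Ideal.Quotient.eq, map_intEval, map_intEval]
  congr 2
  funext β
  rw [Ideal.Quotient.eq, Ideal.mem_span_singleton]
  exact h β

theorem dvd_eval₂_intEval_sub {B R : Type*} [CommRing R] {a : R} {b b' : B → R} {θ θ' : R}
    (h : ∀ β, a ∣ b β - b' β) (hθ : a ∣ θ - θ') (H : (MvPolynomial B ℤ)[X]) :
    a ∣ H.eval₂ (intEval b) θ - H.eval₂ (intEval b') θ' := by
  rw [← Ideal.mem_span_singleton, ← Ideal.Quotient.eq, map_eval₂_intEval, map_eval₂_intEval]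
  have h1 : Ideal.Quotient.mk (Ideal.span {a}) θ = Ideal.Quotient.mk (Ideal.span {a}) θ' := by
    rwa [Ideal.Quotient.eq, Ideal.mem_span_singleton]
  have h2 : (fun β => Ideal.Quotient.mk (Ideal.span {a}) (b β)) =
      fun β => Ideal.Quotient.mk (Ideal.span {a}) (b' β) := by
    funext β
    rw [Ideal.Quotient.eq, Ideal.mem_span_singleton]
    exact h β
  rw [h1, h2]

/-- Polynomials `r`, `ρ` over `R` which solve the equation `f = 0` approximately, to the precision
required by Newton's lemma in the power series ring. -/
structure IsApproximateSolution {B ι R : Type*} [CommRing R] (f : (MvPolynomial B ℤ)[X])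
    (g : MvPolynomial B ℤ) (G : ι → (MvPolynomial B ℤ)[X]) (d : ℕ) (r : B → R[X])
    (ρ a w v : R[X]) (y : ι → R[X]) (c : R[X]) : Prop where
  coeff_eq_one : a.coeff d = 1
  mul_eq : intEval r g * (derivative f).eval₂ (intEval r) ρ ^ 2 = a * w
  coeff_mul_eq_one : w.coeff 0 * c.coeff 0 = 1
  eval_eq : f.eval₂ (intEval r) ρ = a * X * v
  eval_mul_eq : ∀ j, (G j).eval₂ (intEval r) ρ * (derivative f).eval₂ (intEval r) ρ ^ 2 = a * y j

theorem IsApproximateSolution.transfer {B ι P R S : Type*} [CommRing P] [CommRing R] [CommRing S]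
    (e : P →+* R) (e' : P →+* S) (he : ∀ u, e u = 0 → e' u = 0) {f : (MvPolynomial B ℤ)[X]}
    {g : MvPolynomial B ℤ} {G : ι → (MvPolynomial B ℤ)[X]} {d : ℕ} {r : B → P[X]}
    {ρ a w v : P[X]} {y : ι → P[X]} {c : P[X]}
    (h : IsApproximateSolution f g G d (fun β => (r β).map e) (ρ.map e) (a.map e) (w.map e)
      (v.map e) (fun j => (y j).map e) (c.map e)) :
    IsApproximateSolution f g G d (fun β => (r β).map e') (ρ.map e') (a.map e') (w.map e')
      (v.map e') (fun j => (y j).map e') (c.map e') := by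
  have key (u u' : P) (hu : e u = e u') : e' u = e' u' := by
    rw [← sub_eq_zero, ← map_sub] at hu ⊢
    exact he _ hu
  have key' (u u' : P[X]) (hu : mapRingHom e u = mapRingHom e u') :
      mapRingHom e' u = mapRingHom e' u' := by
    ext i
    have := congrArg (fun q => coeff q i) hu
    simp only [coe_mapRingHom, coeff_map] at this ⊢
    exact key _ _ this
  have hf (φ : P →+* R) (H : (MvPolynomial B ℤ)[X]) := map_eval₂_intEval (mapRingHom φ) r ρ H
  have hf' (φ : P →+* S) (H : (MvPolynomial B ℤ)[X]) := map_eval₂_intEval (mapRingHom φ) r ρ H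
  have hg (φ : P →+* R) (H : MvPolynomial B ℤ) := map_intEval (mapRingHom φ) r H
  have hg' (φ : P →+* S) (H : MvPolynomial B ℤ) := map_intEval (mapRingHom φ) r H
  simp only [← coe_mapRingHom] at h ⊢
  refine ⟨?_, ?_, ?_, ?_, fun j => ?_⟩
  · have := h.coeff_eq_one
    simp only [coe_mapRingHom, coeff_map] at this ⊢
    rw [← map_one e] at this
    rw [key _ _ this, map_one]
  · have := h.mul_eq
    rw [← hf, ← hg, ← map_pow, ← map_mul, ← map_mul] at this
    rw [← hf', ← hg', ← map_pow, ← map_mul, ← map_mul]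
    exact key' _ _ this
  · have := h.coeff_mul_eq_one
    simp only [coe_mapRingHom, coeff_map] at this ⊢
    rw [← map_one e, ← map_mul] at this
    rw [← map_mul, key _ _ this, map_one]
  · have := h.eval_eq
    have hX (φ : P →+* R) : (X : R[X]) = mapRingHom φ X := by simp
    have hX' (φ : P →+* S) : (X : S[X]) = mapRingHom φ X := by simp
    rw [← hf, hX e, ← map_mul, ← map_mul] at this
    rw [← hf', hX' e', ← map_mul, ← map_mul]
    exact key' _ _ this
  · have := h.eval_mul_eq j
    rw [← hf, ← hf, ← map_pow, ← map_mul, ← map_mul] at this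
    rw [← hf', ← hf', ← map_pow, ← map_mul, ← map_mul]
    exact key' _ _ this

theorem exists_isApproximateSolution {B ι R : Type*} [CommRing R] [IsDomain R] [IsLocalRing R]
    [IsAdicComplete (IsLocalRing.maximalIdeal R) R] (b : B → PowerSeries R) (θ : PowerSeries R)
    (f : (MvPolynomial B ℤ)[X]) (g : MvPolynomial B ℤ) (G : ι → (MvPolynomial B ℤ)[X])
    (z : ι → PowerSeries R) (hf : f.eval₂ (intEval b) θ = 0)
    (hz : ∀ j, intEval b g * z j = (G j).eval₂ (intEval b) θ)
    (hD : (intEval b g * (derivative f).eval₂ (intEval b) θ ^ 2).map (IsLocalRing.residue R) ≠ 0) :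
    ∃ (d : ℕ) (r : B → R[X]) (ρ a w v : R[X]) (y : ι → R[X]) (c : R[X]),
      IsApproximateSolution f g G d r ρ a w v y c ∧
      ∀ β (P : R[X]), b β = (P : PowerSeries R) → r β = P := by
  obtain ⟨a, u, hau⟩ := PowerSeries.exists_isWeierstrassFactorization hD
  have ha := hau.isDistinguishedAt
  have haX := ha.mul (isDistinguishedAt_X (IsLocalRing.maximalIdeal R))
  choose r hr hrP using fun β => haX.exists_coe_congruent (b β)
  obtain ⟨ρ, hρ, -⟩ := haX.exists_coe_congruent θ
  let co : R[X] →+* PowerSeries R := coeToPowerSeries.ringHom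
  have hco (P : R[X]) : (P : PowerSeries R) = co P := rfl
  simp only [hco] at hr hρ
  have hH (H : (MvPolynomial B ℤ)[X]) := dvd_eval₂_intEval_sub hr hρ H
  have hg := dvd_intEval_sub hr g
  simp only [← map_eval₂_intEval, ← map_intEval] at hH hg
  have hdvd {P : R[X]} (h : co a ∣ co P) : a ∣ P := ha.dvd_of_coe_dvd h
  have hdvdX {P : R[X]} (h : co (a * X) ∣ co P) : a * X ∣ P := haX.dvd_of_coe_dvd h
  have haaX : co a ∣ co (a * X) := map_dvd co (dvd_mul_right _ _)
  have hdisc : co (a * X) ∣ intEval b g * (derivative f).eval₂ (intEval b) θ ^ 2 -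
      co (intEval r g * (derivative f).eval₂ (intEval r) ρ ^ 2) := by
    rw [← Ideal.mem_span_singleton, ← Ideal.Quotient.eq] at hg ⊢
    have := hH (derivative f)
    rw [← Ideal.mem_span_singleton, ← Ideal.Quotient.eq] at this
    simp only [map_mul, map_pow] at hg this ⊢
    rw [hg, this]
  have h1 : a ∣ intEval r g * (derivative f).eval₂ (intEval r) ρ ^ 2 := by
    refine hdvd ?_
    have := haaX.trans hdisc
    rwa [hau.eq_mul, ← hco, dvd_sub_right (dvd_mul_right _ _)] at this
  obtain ⟨w, hw⟩ := h1
  have h2 : a * X ∣ f.eval₂ (intEval r) ρ := by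
    refine hdvdX ?_
    have := hH f
    rwa [hf, zero_sub, dvd_neg] at this
  obtain ⟨v, hv⟩ := h2
  have h3 (j) : a ∣ (G j).eval₂ (intEval r) ρ * (derivative f).eval₂ (intEval r) ρ ^ 2 := by
    refine hdvd ?_
    have h4 := haaX.trans (hH (G j))
    have h5 := haaX.trans (hH (derivative f))
    have h6 : co a ∣ (G j).eval₂ (intEval b) θ * (derivative f).eval₂ (intEval b) θ ^ 2 := by
      rw [← hz, mul_right_comm, hau.eq_mul, mul_assoc]
      exact dvd_mul_right _ _
    rw [← Ideal.mem_span_singleton, ← Ideal.Quotient.eq] at h4 h5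
    rw [← Ideal.mem_span_singleton, ← Ideal.Quotient.eq_zero_iff_mem] at h6 ⊢
    simp only [map_mul, map_pow] at h4 h5 h6 ⊢
    rw [← h4, ← h5, h6]
  choose y hy using h3
  obtain ⟨s, hs⟩ := hdisc
  have hwu : u - co w = PowerSeries.X * s := by
    have hne : co a ≠ 0 := by
      rw [← hco, Ne, Polynomial.coe_eq_zero_iff]
      exact ha.monic.ne_zero
    refine mul_left_cancel₀ hne ?_
    have : co (a * X) = co a * PowerSeries.X := by
      rw [map_mul]; congr 1; simp [co]
    rw [hau.eq_mul, hw, map_mul, this, hco] at hs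
    linear_combination hs
  have hu : IsUnit (w.coeff 0) := by
    have := congrArg PowerSeries.constantCoeff hwu
    simp only [map_sub, map_mul, PowerSeries.constantCoeff_X, zero_mul, sub_eq_zero] at this
    have h7 : PowerSeries.constantCoeff (co w) = w.coeff 0 := by
      simp [co, ← PowerSeries.coeff_zero_eq_constantCoeff_apply]
    rw [← h7, ← this]
    exact PowerSeries.isUnit_iff_constantCoeff.1 hau.isUnit
  obtain ⟨c, hc⟩ := hu.exists_right_inv
  exact ⟨a.natDegree, r, ρ, a, w, v, y, C c, ⟨ha.monic, hw, by simpa using hc, hv, hy⟩, hrP⟩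

theorem IsApproximateSolution.exists_solution {B ι R : Type*} [CommRing R] [IsDomain R]
    {f : (MvPolynomial B ℤ)[X]} {g : MvPolynomial B ℤ} {G : ι → (MvPolynomial B ℤ)[X]} {d : ℕ}
    {r : B → R[X]} {ρ a w v : R[X]} {y : ι → R[X]} {c : R[X]}
    (h : IsApproximateSolution f g G d r ρ a w v y c) :
    intEval (fun β => (r β : PowerSeries R)) g ≠ 0 ∧
    ∃ θ : PowerSeries R, f.eval₂ (intEval fun β => (r β : PowerSeries R)) θ = 0 ∧
      ∀ j, ∃ z : PowerSeries R, intEval (fun β => (r β : PowerSeries R)) g * z =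
        (G j).eval₂ (intEval fun β => (r β : PowerSeries R)) θ := by
  let co : R[X] →+* PowerSeries R := coeToPowerSeries.ringHom
  have hco (P : R[X]) : (P : PowerSeries R) = co P := rfl
  have hcoX : co X = PowerSeries.X := by simp [co]
  simp only [hco]
  have hw : IsUnit (co w) := by
    rw [PowerSeries.isUnit_iff_constantCoeff]
    have h7 : PowerSeries.constantCoeff (co w) = w.coeff 0 := by
      simp [co, ← PowerSeries.coeff_zero_eq_constantCoeff_apply]
    rw [h7]
    exact IsUnit.of_mul_eq_one _ h.coeff_mul_eq_one
  obtain ⟨w', hw'⟩ := hw.exists_right_inv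
  have ha : co a ≠ 0 := by
    rw [← hco, Ne, Polynomial.coe_eq_zero_iff]
    rintro rfl
    simpa using h.coeff_eq_one
  have h1 := congrArg co h.mul_eq
  have h2 := congrArg co h.eval_eq
  have h3 j := congrArg co (h.eval_mul_eq j)
  simp only [map_mul, map_pow, map_eval₂_intEval, map_intEval, hcoX] at h1 h2 h3
  set b : B → PowerSeries R := fun β => co (r β)
  set γ := intEval b g
  set δ := (derivative f).eval₂ (intEval b) (co ρ) with hδ
  have hne : γ * δ ^ 2 ≠ 0 := by
    rw [h1]
    exact mul_ne_zero ha hw.ne_zero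
  have hδ0 : δ ^ 2 ≠ 0 := right_ne_zero_of_mul hne
  refine ⟨left_ne_zero_of_mul hne, ?_⟩
  obtain ⟨e, he⟩ := PowerSeries.exists_root_of_eval_eq (f.map (intEval b)) (co ρ) γ (w' * co v) (by
    rw [eval_map, derivative_map, eval_map, ← hδ, h2]
    linear_combination (-(PowerSeries.X * w' * co v)) * h1 - (co a * PowerSeries.X * co v) * hw')
  rw [eval_map, derivative_map, eval_map, ← hδ] at he
  refine ⟨_, he, fun j => ?_⟩
  have h4 : γ ∣ (G j).eval₂ (intEval b) (co ρ) := by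
    refine ⟨w' * co (y j), mul_right_cancel₀ hδ0 ?_⟩
    rw [h3]
    linear_combination (-(w' * co (y j))) * h1 - (co a * co (y j)) * hw'
  have h5 := dvd_eval₂_intEval_sub (a := γ) (b := b) (b' := b)
    (θ := co ρ + PowerSeries.X * γ * δ * e) (θ' := co ρ)
    (fun β => by simp) ⟨PowerSeries.X * δ * e, by ring⟩ (G j)
  obtain ⟨z, hz⟩ := (dvd_sub_left h4).1 h5
  exact ⟨z, hz.symm⟩

theorem exists_lift_of_finite {κ J R : Type} [CommRing R] [Finite J] (x : κ → R) (q : J → R[X]) :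
    ∃ (ι : Type) (_ : Finite ι) (z : ι → R), ∀ j,
      ∃ L : (MvPolynomial (κ ⊕ ι) ℤ)[X], L.map (intEval (Sum.elim x z)) = q j := by
  classical
  have := Fintype.ofFinite J
  refine ⟨(Finset.univ.biUnion fun j => (q j).coeffs : Finset R), inferInstance, (↑), fun j => ?_⟩
  have : q j ∈ lifts (intEval (Sum.elim x
      ((↑) : (Finset.univ.biUnion fun j => (q j).coeffs : Finset R) → R))) := by
    rw [lifts_iff_coeff_lifts]
    intro i
    by_cases h : (q j).coeff i = 0
    · exact ⟨0, by rw [h, map_zero]⟩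
    · refine ⟨MvPolynomial.X (Sum.inr ⟨(q j).coeff i, ?_⟩), by simp⟩
      exact Finset.mem_biUnion.2 ⟨j, Finset.mem_univ j, coeff_mem_coeffs h⟩
  rwa [mem_lifts] at this

end Approximation

section Shear

namespace MvPowerSeries

theorem mem_span_range_X {K : Type*} [CommRing K] {n : ℕ} {f : MvPowerSeries (Fin n) K}
    (hf : constantCoeff f = 0) : f ∈ Ideal.span (Set.range X) := by
  induction n with
  | zero =>
    have : f = 0 := by
      ext d
      rw [Subsingleton.elim d 0, coeff_zero_eq_constantCoeff_apply, hf, map_zero]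
    rw [this]; exact zero_mem _
  | succ n ih =>
    let E := finSuccEquiv K n
    have hle : Ideal.span (Set.range (X : Fin n → MvPowerSeries (Fin n) K)) ≤
        (Ideal.span (Set.range X)).comap (E.symm.toRingHom.comp PowerSeries.C) := by
      rw [Ideal.span_le]
      rintro _ ⟨i, rfl⟩
      refine Ideal.subset_span ⟨i.succ, ?_⟩
      apply E.injective
      simp [E, finSuccEquiv_X_succ]
    have h0 : constantCoeff (PowerSeries.constantCoeff (E f)) = 0 := by
      rw [← coeff_zero_eq_constantCoeff_apply, ← PowerSeries.coeff_zero_eq_constantCoeff_apply,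
        coeff_coeff_finSuccEquiv, Finsupp.cons_zero_zero, coeff_zero_eq_constantCoeff_apply, hf]
    have h1 := hle (ih h0)
    obtain ⟨s, hs⟩ : PowerSeries.X ∣ E f - PowerSeries.C (PowerSeries.constantCoeff (E f)) := by
      rw [PowerSeries.X_dvd_iff]; simp
    have h2 : f = X 0 * E.symm s + E.symm (PowerSeries.C (PowerSeries.constantCoeff (E f))) := by
      apply E.injective
      rw [map_add, map_mul, E.apply_symm_apply, E.apply_symm_apply, finSuccEquiv_X_zero, ← hs]
      ring
    rw [h2]
    exact add_mem (Ideal.mul_mem_right _ _ (Ideal.subset_span ⟨0, rfl⟩)) h1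

theorem maximalIdeal_eq_span_range_X (K : Type*) [Field K] (n : ℕ) :
    IsLocalRing.maximalIdeal (MvPowerSeries (Fin n) K) = Ideal.span (Set.range X) := by
  apply le_antisymm
  · intro f hf
    refine mem_span_range_X ?_
    by_contra h
    exact hf (isUnit_iff_constantCoeff.2 (isUnit_iff_ne_zero.2 h))
  · rw [Ideal.span_le]
    rintro _ ⟨i, rfl⟩ h
    rw [isUnit_iff_constantCoeff] at h
    simp at h

instance isAdicComplete_maximalIdeal (K : Type*) [Field K] (n : ℕ) :
    IsAdicComplete (IsLocalRing.maximalIdeal (MvPowerSeries (Fin n) K))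
      (MvPowerSeries (Fin n) K) := by
  rw [maximalIdeal_eq_span_range_X]; infer_instance

/-- The images of the variables under a shear of the coordinates along the variable `X 0`. -/
noncomputable def shearVar (K : Type*) [CommRing K] {n : ℕ} (c : K) (N : Fin n → ℕ) :
    Fin (n + 1) → MvPowerSeries (Fin (n + 1)) K :=
  Fin.cons (X 0) fun i => X i.succ + C c * X 0 ^ N i

theorem hasSubst_shearVar {K : Type*} [CommRing K] {n : ℕ} (c : K) {N : Fin n → ℕ}
    (hN : ∀ i, N i ≠ 0) : HasSubst (shearVar K c N) := by
  apply hasSubst_of_constantCoeff_zero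
  intro i
  refine Fin.cases ?_ (fun i => ?_) i
  · simp [shearVar]
  · simp [shearVar, hN i]

theorem subst_shearVar_neg {K : Type*} [CommRing K] {n : ℕ} (c : K) {N : Fin n → ℕ}
    (hN : ∀ i, N i ≠ 0) (i : Fin (n + 1)) :
    subst (shearVar K (-c) N) (shearVar K c N i) = X i := by
  have h := hasSubst_shearVar (-c) hN
  refine Fin.cases ?_ (fun i => ?_) i
  · simp only [shearVar, Fin.cons_zero] at h ⊢
    rw [subst_X h]; rfl
  · have h1 : subst (shearVar K (-c) N) (C c : MvPowerSeries (Fin (n + 1)) K) = C c := subst_C _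
    simp only [shearVar, Fin.cons_succ] at h h1 ⊢
    rw [subst_add h, subst_mul h, subst_pow h, subst_X h, subst_X h, h1]
    simp

theorem substAlgHom_shearVar_neg {K : Type*} [CommRing K] {n : ℕ} (c : K) {N : Fin n → ℕ}
    (hN : ∀ i, N i ≠ 0) (f : MvPowerSeries (Fin (n + 1)) K) :
    substAlgHom (hasSubst_shearVar (-c) hN) (substAlgHom (hasSubst_shearVar c hN) f) = f := by
  rw [substAlgHom_apply, substAlgHom_apply, subst_comp_subst_apply (hasSubst_shearVar c hN)
    (hasSubst_shearVar (-c) hN)]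
  simp only [subst_shearVar_neg c hN]
  rw [subst_self]; rfl

/-- Setting all variables but the first one to zero. -/
noncomputable def restrictZero (K : Type*) [CommRing K] (n : ℕ) :
    MvPowerSeries (Fin (n + 1)) K →+* PowerSeries K :=
  (PowerSeries.map constantCoeff).comp (finSuccEquiv K n).toRingEquiv.toRingHom

theorem coeff_restrictZero {K : Type*} [CommRing K] {n : ℕ} (k : ℕ)
    (f : MvPowerSeries (Fin (n + 1)) K) :
    PowerSeries.coeff k (restrictZero K n f) = coeff (Finsupp.cons k 0) f := by
  rw [← coeff_coeff_finSuccEquiv, coeff_zero_eq_constantCoeff_apply]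
  simp [restrictZero]

theorem restrictZero_shearVar {K : Type*} [CommRing K] {n : ℕ} (N : Fin n → ℕ) (i : Fin (n + 1)) :
    restrictZero K n (shearVar K 1 N i) =
      PowerSeries.X ^ (Fin.cons 1 N : Fin (n + 1) → ℕ) i := by
  refine Fin.cases ?_ (fun i => ?_) i
  · simp [shearVar, restrictZero, finSuccEquiv_X_zero]
  · simp [shearVar, restrictZero, finSuccEquiv_X_zero, finSuccEquiv_X_succ]

theorem exists_strict_min_weight {m : ℕ} (s : Set (Fin m → ℕ)) (hs : s.Nonempty) :
    ∃ α ∈ s, ∃ M₀ : ℕ, ∀ M ≥ M₀, ∀ β ∈ s, β ≠ α →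
      ∑ i, (M + 1) ^ i.val * α i < ∑ i, (M + 1) ^ i.val * β i := by
  induction m with
  | zero =>
    obtain ⟨α, hα⟩ := hs
    exact ⟨α, hα, 0, fun M _ β _ h => absurd (Subsingleton.elim β α) h⟩
  | succ m ih =>
    obtain ⟨α', ⟨γ, hγ, rfl⟩, M', hM'⟩ := ih (Fin.tail '' s) (hs.image _)
    have hex : ∃ k, (Fin.cons k (Fin.tail γ) : Fin (m + 1) → ℕ) ∈ s :=
      ⟨γ 0, by rwa [Fin.cons_self_tail]⟩
    classical
    refine ⟨Fin.cons (Nat.find hex) (Fin.tail γ), Nat.find_spec hex, max M' (Nat.find hex),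
      fun M hM β hβ hne => ?_⟩
    have hw (δ : Fin (m + 1) → ℕ) : ∑ i, (M + 1) ^ i.val * δ i =
        δ 0 + (M + 1) * ∑ i, (M + 1) ^ i.val * Fin.tail δ i := by
      rw [Fin.sum_univ_succ, Finset.mul_sum]
      simp only [Fin.val_zero, pow_zero, one_mul, Fin.val_succ, Fin.tail]
      congr 1
      exact Finset.sum_congr rfl fun i _ => by ring
    rw [hw, hw β, Fin.cons_zero, Fin.tail_cons]
    by_cases ht : Fin.tail β = Fin.tail γ
    · have hlt : Nat.find hex < β 0 := by
        refine lt_of_le_of_ne (Nat.find_min' hex ?_) fun h => hne ?_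
        · rwa [← ht, Fin.cons_self_tail]
        · rw [h, ← ht, Fin.cons_self_tail]
      rw [ht]
      omega
    · have h1 := hM' M (le_of_max_le_left hM) _ ⟨β, hβ, rfl⟩ ht
      have h2 := Nat.mul_le_mul_left (M + 1) (Nat.succ_le_of_lt h1)
      have h3 := le_of_max_le_right hM
      rw [Nat.mul_succ] at h2
      omega

theorem exists_restrictZero_shear_ne_zero {K : Type*} [CommRing K] {n : ℕ}
    {f : MvPowerSeries (Fin (n + 1)) K} (hf : f ≠ 0) :
    ∃ (N : Fin n → ℕ) (hN : ∀ i, N i ≠ 0),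
      restrictZero K n (substAlgHom (hasSubst_shearVar 1 hN) f) ≠ 0 := by
  obtain ⟨d₀, hd₀⟩ : ∃ d, coeff d f ≠ 0 := by
    by_contra! h
    exact hf (ext fun d => by rw [h, map_zero])
  obtain ⟨α, hα, M, hM⟩ := exists_strict_min_weight
    {d : Fin (n + 1) → ℕ | coeff (Finsupp.equivFunOnFinite.symm d) f ≠ 0}
    ⟨d₀, by simpa using hd₀⟩
  specialize hM M le_rfl
  refine ⟨fun i => (M + 1) ^ (i.succ : ℕ), fun i => by positivity, fun h0 => hα ?_⟩
  have hN (i : Fin (n + 1)) : (Fin.cons 1 fun i : Fin n => (M + 1) ^ (i.succ : ℕ) :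
      Fin (n + 1) → ℕ) i = (M + 1) ^ (i : ℕ) := by
    refine Fin.cases ?_ (fun i => ?_) i <;> simp
  have h1 := congrArg (PowerSeries.coeff (∑ i, (M + 1) ^ i.val * α i)) h0
  rw [coeff_restrictZero, substAlgHom_apply, coeff_subst, map_zero,
    finsum_eq_single _ (Finsupp.equivFunOnFinite.symm α)] at h1
  rotate_left
  · intro d hd
    by_cases hdf : coeff d f = 0
    · rw [hdf, zero_smul]
    · have h2 := hM d (by simpa using hdf) (fun h => hd (by ext i; simp [← h]))
      rw [← coeff_restrictZero, Finsupp.prod_fintype _ _ (by simp), map_prod]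
      simp only [map_pow, restrictZero_shearVar, hN, ← pow_mul, Finset.prod_pow_eq_pow_sum,
        PowerSeries.coeff_X_pow, if_neg h2.ne, smul_zero]
  · exact hasSubst_shearVar 1 (fun i => by positivity)
  rw [← coeff_restrictZero, Finsupp.prod_fintype _ _ (by simp), map_prod] at h1
  simpa only [map_pow, restrictZero_shearVar, hN, ← pow_mul, Finset.prod_pow_eq_pow_sum,
        PowerSeries.coeff_X_pow, Finsupp.coe_equivFunOnFinite_symm, if_true, smul_eq_mul,
        mul_one] using h1

end MvPowerSeries

end Shear

section Reductions

open Polynomial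

/-- Every finite family of power series in `n` variables over a field of characteristic zero has a
reduction to some positive characteristic which preserves all integral polynomial relations
between the family and the variables. -/
def HasReductions (n : ℕ) : Prop :=
  ∀ (K : Type) [Field K] [CharZero K] (ι : Type) [Finite ι] (z : ι → MvPowerSeries (Fin n) K),
    ∃ (p : ℕ) (_ : p.Prime) (F : Type) (_ : Field F) (_ : CharP F p)
      (w : ι → MvPowerSeries (Fin n) F), ∀ P : MvPolynomial (Fin n ⊕ ι) ℤ,
      intEval (Sum.elim MvPowerSeries.X z) P = 0 → intEval (Sum.elim MvPowerSeries.X w) P = 0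

theorem isJacobsonRing_int : IsJacobsonRing ℤ := by
  rw [isJacobsonRing_iff_prime_eq]
  intro P hP
  by_cases h0 : P = ⊥
  · subst h0
    refine le_antisymm (fun x hx => ?_) bot_le
    rw [Ideal.mem_jacobson_bot] at hx
    have h1 := Int.isUnit_iff.1 (hx 1)
    have h2 := Int.isUnit_iff.1 (hx 3)
    rw [Ideal.mem_bot]
    omega
  · have : P.IsMaximal := hP.isMaximal h0
    exact Ideal.jacobson_eq_self_of_isMaximal

theorem exists_charP_of_surjective {σ F : Type*} [Finite σ] [Field F] (φ : MvPolynomial σ ℤ →+* F)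
    (hφ : Function.Surjective φ) : ∃ p : ℕ, p.Prime ∧ CharP F p := by
  obtain ⟨p, hp⟩ := CharP.exists F
  refine ⟨p, ?_, hp⟩
  rcases CharP.char_is_prime_or_zero F p with h | rfl
  · exact h
  · have := isJacobsonRing_int
    have h_int := MvPolynomial.comp_C_integral_of_surjective_of_isJacobsonRing φ hφ
    have : CharZero F := CharP.charP_to_charZero F
    have hcomp : φ.comp MvPolynomial.C = Int.castRingHom F := RingHom.ext_int _ _
    rw [hcomp] at h_int
    let : Algebra ℤ F := (Int.castRingHom F).toAlgebra
    have : Algebra.IsIntegral ℤ F := ⟨h_int⟩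
    exact absurd (isField_of_isIntegral_of_isField (R := ℤ) (S := F) Int.cast_injective
      (Field.toIsField F)) Int.not_isField

theorem hasReductions_zero : HasReductions 0 := by
  intro K _ _ ι _ z
  let π := intEval fun i => MvPowerSeries.constantCoeff (z i)
  obtain ⟨𝔪, h𝔪, hle⟩ := Ideal.exists_le_maximal (RingHom.ker π) (RingHom.ker_ne_top π)
  let F := MvPolynomial ι ℤ ⧸ 𝔪
  let : Field F := Ideal.Quotient.field 𝔪
  obtain ⟨p, hp, hF⟩ := exists_charP_of_surjective (Ideal.Quotient.mk 𝔪)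
    Ideal.Quotient.mk_surjective
  refine ⟨p, hp, F, inferInstance, hF, fun i => MvPowerSeries.C (Ideal.Quotient.mk 𝔪
    (MvPolynomial.X i)), fun P hP => ?_⟩
  let ψ : Fin 0 ⊕ ι ≃ ι := Equiv.emptySum (Fin 0) ι
  have h1 : π (MvPolynomial.rename ψ P) = 0 := by
    have := congrArg MvPowerSeries.constantCoeff hP
    rw [map_intEval, map_zero] at this
    rw [← this]
    simp only [π, MvPolynomial.coe_eval₂Hom, MvPolynomial.eval₂_rename]
    congr 1
    funext i
    rcases i with i | i
    · exact i.elim0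
    · rfl
  have h2 : Ideal.Quotient.mk 𝔪 (MvPolynomial.rename ψ P) = 0 :=
    Ideal.Quotient.eq_zero_iff_mem.2 (hle h1)
  have h3 : (MvPowerSeries.C.comp (Ideal.Quotient.mk 𝔪)).comp
      (MvPolynomial.rename ψ : _ →ₐ[ℤ] _).toRingHom = intEval (Sum.elim MvPowerSeries.X fun i =>
        (MvPowerSeries.C (Ideal.Quotient.mk 𝔪 (MvPolynomial.X i)) : MvPowerSeries (Fin 0) F)) := by
    refine MvPolynomial.ringHom_ext (fun r => by simp) fun i => ?_
    rcases i with i | i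
    · exact i.elim0
    · simp [ψ]
  rw [← h3]
  simp only [RingHom.comp_apply]
  exact (congrArg _ h2).trans (map_zero _)

theorem HasReductions.exists_solution {n : ℕ} (hn : HasReductions n) {K : Type} [Field K]
    [CharZero K] {B ι κ : Type} [Finite B] [Finite ι]
    (b : B → PowerSeries (MvPowerSeries (Fin n) K)) (θ : PowerSeries (MvPowerSeries (Fin n) K))
    (f : (MvPolynomial B ℤ)[X]) (g : MvPolynomial B ℤ) (G : ι → (MvPolynomial B ℤ)[X])
    (z : ι → PowerSeries (MvPowerSeries (Fin n) K)) (hf : f.eval₂ (intEval b) θ = 0)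
    (hz : ∀ j, intEval b g * z j = (G j).eval₂ (intEval b) θ)
    (hD : (intEval b g * (derivative f).eval₂ (intEval b) θ ^ 2).map (IsLocalRing.residue _) ≠ 0)
    (i : κ → B) (Q : κ → MvPolynomial (Option (Fin n)) ℤ)
    (hQ : ∀ k, b (i k) = intEval (fun o => o.elim PowerSeries.X
      fun s => PowerSeries.C (MvPowerSeries.X s)) (Q k)) :
    ∃ (p : ℕ) (_ : p.Prime) (F : Type) (_ : Field F) (_ : CharP F p)
      (b' : B → PowerSeries (MvPowerSeries (Fin n) F))
      (θ' : PowerSeries (MvPowerSeries (Fin n) F))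
      (z' : ι → PowerSeries (MvPowerSeries (Fin n) F)),
      f.eval₂ (intEval b') θ' = 0 ∧ intEval b' g ≠ 0 ∧
      (∀ j, intEval b' g * z' j = (G j).eval₂ (intEval b') θ') ∧
      ∀ k, b' (i k) = intEval (fun o => o.elim PowerSeries.X
        fun s => PowerSeries.C (MvPowerSeries.X s)) (Q k) := by
  have hdom (L : Type) [Field L] : IsDomain (MvPowerSeries (Fin n) L) :=
    NoZeroDivisors.to_isDomain _
  have := hdom K
  obtain ⟨d, r, ρ, a, w, v, y, c, h, hrP⟩ := exists_isApproximateSolution b θ f g G z hf hz hD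
  obtain ⟨ι', _, z', hL⟩ := exists_lift_of_finite
    (MvPowerSeries.X : Fin n → MvPowerSeries (Fin n) K)
    (Sum.elim r (Sum.elim y ![ρ, a, w, v, c]))
  obtain ⟨p, hp, F, _, hF, w', hw'⟩ := hn K ι' z'
  choose r₀ hr₀ using fun β => hL (Sum.inl β)
  choose y₀ hy₀ using fun j => hL (Sum.inr (Sum.inl j))
  obtain ⟨ρ₀, hρ₀⟩ := hL (Sum.inr (Sum.inr 0))
  obtain ⟨a₀, ha₀⟩ := hL (Sum.inr (Sum.inr 1))
  obtain ⟨w₀, hw₀⟩ := hL (Sum.inr (Sum.inr 2))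
  obtain ⟨v₀, hv₀⟩ := hL (Sum.inr (Sum.inr 3))
  obtain ⟨c₀, hc₀⟩ := hL (Sum.inr (Sum.inr 4))
  dsimp at hr₀ hy₀ hρ₀ ha₀ hw₀ hv₀ hc₀
  obtain rfl : (fun β => (r₀ β).map _) = r := funext hr₀
  obtain rfl : (fun j => (y₀ j).map _) = y := funext hy₀
  subst hρ₀ ha₀ hw₀ hv₀ hc₀
  have := hdom F
  have h' := h.transfer _ (intEval (Sum.elim MvPowerSeries.X w')) hw'
  obtain ⟨hg, θ', hθ', hz'⟩ := h'.exists_solution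
  choose z'' hz'' using hz'
  refine ⟨p, hp, F, inferInstance, hF, _, θ', z'', hθ', hg, hz'', fun k => ?_⟩
  let Q₀ : (MvPolynomial (Fin n ⊕ ι') ℤ)[X] :=
    intEval (fun o : Option (Fin n) => o.elim X fun s => C (MvPolynomial.X (Sum.inl s))) (Q k)
  have hQ₀ {L : Type} [Field L] (t : ι' → MvPowerSeries (Fin n) L) :
      ((Q₀.map (intEval (Sum.elim MvPowerSeries.X t)) : (MvPowerSeries (Fin n) L)[X]) :
        PowerSeries (MvPowerSeries (Fin n) L)) = intEval (fun o => o.elim PowerSeries.X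
        fun s => PowerSeries.C (MvPowerSeries.X s)) (Q k) := by
    rw [← coe_mapRingHom, ← coeToPowerSeries.ringHom_apply, ← RingHom.comp_apply, map_intEval]
    congr 2
    funext o
    rcases o with _ | s <;> simp
  have h1 := hrP (i k) _ ((hQ k).trans (hQ₀ z').symm)
  have h2 : (r₀ (i k)).map (intEval (Sum.elim MvPowerSeries.X w')) =
      Q₀.map (intEval (Sum.elim MvPowerSeries.X w')) := by
    ext1 m
    have := congrArg (fun q => coeff q m) h1
    simp only [coeff_map] at this ⊢
    rw [← sub_eq_zero, ← map_sub] at this ⊢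
    exact hw' _ this
  rw [h2, hQ₀]

end Reductions

section Induction

open Polynomial

theorem algebraicIndependent_of_injective_intEval {R ι : Type*} [CommRing R] {x : ι → R}
    (hx : Function.Injective (intEval x)) : AlgebraicIndependent ℤ x := by
  have h (P : MvPolynomial ι ℤ) : MvPolynomial.aeval x P = intEval x P := by
    rw [MvPolynomial.aeval_def, MvPolynomial.coe_eval₂Hom]; rfl
  intro P Q hPQ
  exact hx (by rw [← h, ← h]; exact hPQ)

theorem MvPowerSeries.injective_intEval_X (K : Type*) [Field K] [CharZero K] (n : ℕ) :
    Function.Injective (intEval (MvPowerSeries.X : Fin n → MvPowerSeries (Fin n) K)) := by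
  have h (P : MvPolynomial (Fin n) ℤ) :
      intEval (MvPowerSeries.X : Fin n → MvPowerSeries (Fin n) K) P =
        (MvPolynomial.map (Int.castRingHom K) P : MvPolynomial (Fin n) K) := by
    induction P using MvPolynomial.induction_on with
    | C a =>
      rw [MvPolynomial.map_C, MvPolynomial.coe_C, MvPolynomial.coe_eval₂Hom, MvPolynomial.eval₂_C]
      simp
    | add p q hp hq => rw [map_add, hp, hq, map_add, MvPolynomial.coe_add]
    | mul_X p i hp => rw [map_mul, hp, map_mul, MvPolynomial.coe_mul]; simp
  intro P Q hPQ
  rw [h, h] at hPQ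
  exact MvPolynomial.map_injective _ (RingHom.injective_int _) (MvPolynomial.coe_injective _ _ hPQ)

/-- The polynomials describing the shear of the coordinates. -/
noncomputable def shearPolynomial {n : ℕ} (N : Fin n → ℕ) :
    Fin (n + 1) → MvPolynomial (Option (Fin n)) ℤ :=
  Fin.cons (MvPolynomial.X none) fun s => MvPolynomial.X (some s) + MvPolynomial.X none ^ N s

theorem finSuccEquiv_shearVar {K : Type*} [CommRing K] {n : ℕ} (N : Fin n → ℕ) (k : Fin (n + 1)) :
    MvPowerSeries.finSuccEquiv K n (MvPowerSeries.shearVar K 1 N k) =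
      intEval (fun o => o.elim PowerSeries.X fun s => PowerSeries.C (MvPowerSeries.X s))
        (shearPolynomial N k) := by
  refine Fin.cases ?_ (fun s => ?_) k
  · simp [shearPolynomial, MvPowerSeries.shearVar, MvPowerSeries.finSuccEquiv_X_zero]
  · simp [shearPolynomial, MvPowerSeries.shearVar, MvPowerSeries.finSuccEquiv_X_zero,
      MvPowerSeries.finSuccEquiv_X_succ]

theorem exists_shear {K : Type*} [Field K] {n : ℕ} {D : MvPowerSeries (Fin (n + 1)) K}
    (hD : D ≠ 0) : ∃ (N : Fin n → ℕ) (_ : ∀ i, N i ≠ 0)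
      (σ : MvPowerSeries (Fin (n + 1)) K →+* PowerSeries (MvPowerSeries (Fin n) K)),
      (σ D).map (IsLocalRing.residue _) ≠ 0 ∧ ∀ k, σ (MvPowerSeries.X k) =
        intEval (fun o => o.elim PowerSeries.X fun s => PowerSeries.C (MvPowerSeries.X s))
          (shearPolynomial N k) := by
  obtain ⟨N, hN, hD⟩ := MvPowerSeries.exists_restrictZero_shear_ne_zero hD
  refine ⟨N, hN, (MvPowerSeries.finSuccEquiv K n).toRingEquiv.toRingHom.comp
    (MvPowerSeries.substAlgHom (MvPowerSeries.hasSubst_shearVar (1 : K) hN)).toRingHom, ?_, ?_⟩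
  · intro h0
    refine hD (PowerSeries.ext fun m => ?_)
    have := congrArg (PowerSeries.coeff m) h0
    rw [PowerSeries.coeff_map, map_zero, IsLocalRing.residue_eq_zero_iff,
      MvPowerSeries.maximalIdeal_eq_span_range_X] at this
    have hle : Ideal.span (Set.range (MvPowerSeries.X : Fin n → MvPowerSeries (Fin n) K)) ≤
        RingHom.ker (MvPowerSeries.constantCoeff (σ := Fin n) (R := K)) := by
      rw [Ideal.span_le]
      rintro _ ⟨s, rfl⟩
      simp [RingHom.mem_ker]
    exact hle this
  · intro k
    rw [← finSuccEquiv_shearVar]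
    exact congrArg (MvPowerSeries.finSuccEquiv K n) (MvPowerSeries.substAlgHom_X _ _)

theorem exists_unshear (F : Type*) [Field F] {n : ℕ} {N : Fin n → ℕ} (hN : ∀ i, N i ≠ 0) :
    ∃ τ : PowerSeries (MvPowerSeries (Fin n) F) →+* MvPowerSeries (Fin (n + 1)) F,
      Function.Injective τ ∧ ∀ k, τ (intEval (fun o => o.elim PowerSeries.X fun s =>
        PowerSeries.C (MvPowerSeries.X s)) (shearPolynomial N k)) = MvPowerSeries.X k := by
  refine ⟨(MvPowerSeries.substAlgHom (MvPowerSeries.hasSubst_shearVar (-1 : F) hN)).toRingHom.comp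
    (MvPowerSeries.finSuccEquiv F n).symm.toRingEquiv.toRingHom, ?_, fun k => ?_⟩
  · refine Function.Injective.comp
      (g := MvPowerSeries.substAlgHom (MvPowerSeries.hasSubst_shearVar (-1 : F) hN)) ?_
      (MvPowerSeries.finSuccEquiv F n).symm.injective
    exact Function.LeftInverse.injective (MvPowerSeries.substAlgHom_shearVar_neg (-1 : F) hN)
  · rw [← finSuccEquiv_shearVar]
    have h1 : (MvPowerSeries.finSuccEquiv F n).symm
      (MvPowerSeries.finSuccEquiv F n (MvPowerSeries.shearVar F 1 N k)) =
        MvPowerSeries.shearVar F 1 N k := AlgEquiv.symm_apply_apply _ _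
    have h2 : MvPowerSeries.substAlgHom (MvPowerSeries.hasSubst_shearVar (-1 : F) hN)
        (MvPowerSeries.shearVar F 1 N k) = MvPowerSeries.X k :=
      (congrFun (MvPowerSeries.coe_substAlgHom _) _).trans
        (MvPowerSeries.subst_shearVar_neg 1 hN k)
    exact (congrArg (MvPowerSeries.substAlgHom
      (MvPowerSeries.hasSubst_shearVar (-1 : F) hN)) h1).trans h2

theorem intEval_elim_comp {R B κ ι : Type*} [CommRing R] (b : B → R) (i : κ → B) (z : ι → R)
    (P : MvPolynomial (κ ⊕ ι) ℤ) : intEval (Sum.elim b z) (MvPolynomial.rename (Sum.map i id) P) =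
      intEval (Sum.elim (fun k => b (i k)) z) P := by
  rw [intEval, MvPolynomial.coe_eval₂Hom, MvPolynomial.eval₂_rename, Sum.elim_comp_map]
  rfl

open Polynomial in
theorem intEval_eq_zero_of_presentation_of_injective {R S T B κ ι : Type*} [CommRing R] [IsDomain R]
    [CommRing S] [CommRing T] [IsDomain T] (b : B → R) (i : κ → B) (θ : R)
    (f : (MvPolynomial B ℤ)[X])
    (hf : ∀ H : (MvPolynomial B ℤ)[X], H.eval₂ (intEval b) θ = 0 → f ∣ H)
    (g : MvPolynomial B ℤ) (hg : intEval b g ≠ 0)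
    (z : ι → R) (G : ι → (MvPolynomial B ℤ)[X])
    (hG : ∀ j, intEval b g * z j = (G j).eval₂ (intEval b) θ)
    (b' : B → S) (θ' : S) (hf' : f.eval₂ (intEval b') θ' = 0)
    (hg' : intEval b' g ≠ 0) (z' : ι → S)
    (hG' : ∀ j, intEval b' g * z' j = (G j).eval₂ (intEval b') θ')
    (τ : S →+* T) (hτ : Function.Injective τ)
    (P : MvPolynomial (κ ⊕ ι) ℤ) (hP : intEval (Sum.elim (fun k => b (i k)) z) P = 0) :
    intEval (Sum.elim (fun k => τ (b' (i k))) fun j => τ (z' j)) P = 0 := by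
  rw [← intEval_elim_comp b] at hP
  rw [← intEval_elim_comp (fun β => τ (b' β)) i]
  refine intEval_eq_zero_of_presentation b θ f hf g hg z G hG _ (τ θ') ?_ ?_ _ ?_ _ hP
  · rw [← map_eval₂_intEval, hf', map_zero]
  · rw [← map_intEval]
    exact (map_ne_zero_iff _ hτ).2 hg'
  · intro j
    rw [← map_eval₂_intEval, ← hG', map_mul, map_intEval]

theorem MvPowerSeries.charZero (σ K : Type*) [Field K] [CharZero K] :
    CharZero (MvPowerSeries σ K) :=
  charZero_of_injective_ringHom (f := MvPowerSeries.C (σ := σ) (R := K))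
    (RingHom.injective _)

theorem HasReductions.succ {n : ℕ} (hn : HasReductions n) : HasReductions (n + 1) := by
  intro K _ _ ι _ z
  have hdom (L : Type) [Field L] (m : ℕ) : IsDomain (MvPowerSeries (Fin m) L) :=
    NoZeroDivisors.to_isDomain _
  have := hdom K (n + 1)
  have := MvPowerSeries.charZero (Fin (n + 1)) K
  obtain ⟨B, _, b, i, hi, θ, f, g, G, hf, hf', hdvd, hg, hz⟩ := exists_presentation
    (MvPowerSeries.X : Fin (n + 1) → MvPowerSeries (Fin (n + 1)) K)
    (algebraicIndependent_of_injective_intEval (MvPowerSeries.injective_intEval_X K (n + 1))) z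
  obtain ⟨N, hN, σ, hD, hσ⟩ := exists_shear (mul_ne_zero hg (pow_ne_zero 2 hf'))
  obtain ⟨p, hp, F, _, hF, b', θ', z', hf₁, hg₁, hz₁, hb₁⟩ := hn.exists_solution
    (fun β => σ (b β)) (σ θ) f g G (fun j => σ (z j)) (by rw [← map_eval₂_intEval, hf, map_zero])
    (fun j => by rw [← map_eval₂_intEval, ← hz, map_mul, map_intEval])
    (by rwa [← map_eval₂_intEval, ← map_intEval, ← map_pow, ← map_mul])
    i (shearPolynomial N) (fun k => by rw [hi, hσ])
  obtain ⟨τ, hτinj, hτ⟩ := exists_unshear F hN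
  have := hdom F (n + 1)
  refine ⟨p, hp, F, inferInstance, hF, fun j => τ (z' j), fun P hP => ?_⟩
  have key := intEval_eq_zero_of_presentation_of_injective b i θ f hdvd g hg z G hz b' θ' hf₁ hg₁
    z' hz₁ τ hτinj P
  rw [funext hi, funext fun k => (congrArg τ (hb₁ k)).trans (hτ k)] at key
  exact key hP

theorem hasReductions (n : ℕ) : HasReductions n := by
  induction n with
  | zero => exact hasReductions_zero
  | succ n ih => exact ih.succ

end Induction

section Exactness

open TensorProduct

section Contraction

theorem LinearMap.exists_contraction {κ U V W : Type*} [Field κ] [AddCommGroup U] [AddCommGroup V]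
    [AddCommGroup W] [Module κ U] [Module κ V] [Module κ W] (a : U →ₗ[κ] V) (b : V →ₗ[κ] W)
    (h : Function.Exact a b) :
    ∃ (s : V →ₗ[κ] U) (r : W →ₗ[κ] V), a ∘ₗ s + r ∘ₗ b = LinearMap.id := by
  obtain ⟨r, hr⟩ := b.rangeRestrict.exists_rightInverse_of_surjective b.range_rangeRestrict
  obtain ⟨π, hπ⟩ := (LinearMap.range b).subtype.exists_leftInverse_of_injective
    (LinearMap.range b).ker_subtype
  obtain ⟨s, hs⟩ := a.rangeRestrict.exists_rightInverse_of_surjective a.range_rangeRestrict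
  have hmem (v : V) : v - r (b.rangeRestrict v) ∈ LinearMap.range a := by
    rw [← h.linearMap_ker_eq, LinearMap.mem_ker, map_sub, sub_eq_zero]
    exact (congrArg Subtype.val (LinearMap.congr_fun hr (b.rangeRestrict v))).symm
  let e : V →ₗ[κ] LinearMap.range a :=
    (LinearMap.id - r ∘ₗ b.rangeRestrict).codRestrict _ hmem
  refine ⟨s ∘ₗ e, r ∘ₗ π, LinearMap.ext fun v => ?_⟩
  have h1 : a (s (e v)) = e v := congrArg Subtype.val (LinearMap.congr_fun hs (e v))
  have h2 : π (b v) = b.rangeRestrict v := LinearMap.congr_fun hπ (b.rangeRestrict v)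
  simp only [LinearMap.add_apply, LinearMap.comp_apply, h1, h2, LinearMap.id_apply]
  simp [e]

variable {A : Type*} [CommRing A] {κ : Type*} [Field κ] [Algebra A κ]

theorem exists_smul_eq_one_tmul {U : Type*} [AddCommGroup U] [Module A U]
    (hκ : ∀ c : κ, ∃ t a : A, algebraMap A κ t ≠ 0 ∧ algebraMap A κ t * c = algebraMap A κ a)
    (y : κ ⊗[A] U) : ∃ (t : A) (y' : U), algebraMap A κ t ≠ 0 ∧ t • y = 1 ⊗ₜ y' := by
  induction y with
  | zero => exact ⟨1, 0, by simp, by simp⟩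
  | tmul c u =>
    obtain ⟨t, a, ht, h⟩ := hκ c
    refine ⟨t, a • u, ht, ?_⟩
    rw [TensorProduct.smul_tmul', Algebra.smul_def, h, ← TensorProduct.smul_tmul,
      Algebra.smul_def, mul_one]
  | add y z hy hz =>
    obtain ⟨t, y', ht, hy⟩ := hy
    obtain ⟨s, z', hs, hz⟩ := hz
    refine ⟨t * s, s • y' + t • z', by simp [ht, hs], ?_⟩
    rw [smul_add, TensorProduct.tmul_add, TensorProduct.tmul_smul, TensorProduct.tmul_smul, ← hy,
      ← hz, smul_smul, smul_smul, mul_comm]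

theorem exists_baseChange_eq_smul {U V : Type*} [AddCommGroup U] [Module A U] [AddCommGroup V]
    [Module A V] [Module.Finite A V] [Module.Free A V]
    (hκ : ∀ c : κ, ∃ t a : A, algebraMap A κ t ≠ 0 ∧ algebraMap A κ t * c = algebraMap A κ a)
    (h : κ ⊗[A] V →ₗ[κ] κ ⊗[A] U) :
    ∃ (t : A) (h' : V →ₗ[A] U), algebraMap A κ t ≠ 0 ∧
      h'.baseChange κ = algebraMap A κ t • h := by
  classical
  let e := Module.Free.chooseBasis A V
  choose t y ht hy using fun i => exists_smul_eq_one_tmul hκ (h (1 ⊗ₜ e i))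
  refine ⟨∏ i, t i, e.constr A fun i => (∏ j ∈ Finset.univ.erase i, t j) • y i, ?_, ?_⟩
  · rw [map_prod]
    exact Finset.prod_ne_zero_iff.2 fun i _ => ht i
  · refine (e.baseChange κ).ext fun i => ?_
    rw [Module.Basis.baseChange_apply, LinearMap.baseChange_tmul, Module.Basis.constr_basis,
      TensorProduct.tmul_smul, ← hy, smul_smul, Finset.prod_erase_mul _ _ (Finset.mem_univ i),
      LinearMap.smul_apply, algebraMap_smul]

theorem exists_smul_mem_range_of_exact {U V W : Type*} [AddCommGroup U] [Module A U]
    [AddCommGroup V] [Module A V] [AddCommGroup W] [Module A W]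
    [Module.Finite A V] [Module.Free A V] [Module.Finite A W] [Module.Free A W]
    (hκ : ∀ c : κ, ∃ t a : A, algebraMap A κ t ≠ 0 ∧ algebraMap A κ t * c = algebraMap A κ a)
    (a : U →ₗ[A] V) (b : V →ₗ[A] W) (hab : b ∘ₗ a = 0)
    (hex : Function.Exact (a.lTensor κ) (b.lTensor κ)) :
    ∃ t : A, algebraMap A κ t ≠ 0 ∧ ∀ (M : Type) [AddCommGroup M] [Module A M] (z : M ⊗[A] V),
      b.lTensor M z = 0 → ∃ y, a.lTensor M y = t • z := by
  obtain ⟨s, r, hsr⟩ := LinearMap.exists_contraction (a.baseChange κ) (b.baseChange κ) hex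
  obtain ⟨t₁, s', ht₁, hs'⟩ := exists_baseChange_eq_smul hκ s
  obtain ⟨t₂, r', ht₂, hr'⟩ := exists_baseChange_eq_smul hκ r
  let u : V →ₗ[A] V := t₂ • (a ∘ₗ s') + t₁ • (r' ∘ₗ b)
  have hu : u.baseChange κ = algebraMap A κ (t₁ * t₂) • LinearMap.id := by
    rw [LinearMap.baseChange_add, LinearMap.baseChange_smul, LinearMap.baseChange_smul,
      LinearMap.baseChange_comp, LinearMap.baseChange_comp, hs', hr', ← hsr, smul_add]
    congr 1
    · rw [LinearMap.comp_smul, map_mul, mul_comm, mul_smul, algebraMap_smul κ t₂]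
    · rw [LinearMap.smul_comp, map_mul, mul_smul, algebraMap_smul κ t₁]
  have hdet : algebraMap A κ (u.charpoly.coeff 0) ≠ 0 := by
    intro h0
    have h1 := LinearMap.det_eq_sign_charpoly_coeff (u.baseChange κ)
    rw [LinearMap.charpoly_baseChange, Polynomial.coeff_map, h0, mul_zero, hu, LinearMap.det_smul,
      LinearMap.det_id, mul_one, map_mul] at h1
    exact pow_ne_zero _ (mul_ne_zero ht₁ ht₂) h1
  refine ⟨u.charpoly.coeff 0, hdet, fun M _ _ z hz => ?_⟩
  let N := LinearMap.range (a.lTensor M)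
  let w : Module.End A (M ⊗[A] V) := Module.End.lTensorAlgHom A V M u
  have hab' : b.lTensor M ∘ₗ a.lTensor M = 0 := by
    rw [← LinearMap.lTensor_comp, hab, LinearMap.lTensor_zero]
  have hw (v : M ⊗[A] V) (hv : b.lTensor M v = 0) : w v ∈ N := by
    have : w v = t₂ • a.lTensor M (s'.lTensor M v) + t₁ • r'.lTensor M (b.lTensor M v) := by
      change u.lTensor M v = _
      simp [u, LinearMap.lTensor_add, LinearMap.lTensor_smul, LinearMap.lTensor_comp]
    rw [this, hv, map_zero, smul_zero, add_zero]
    exact N.smul_mem _ ⟨_, rfl⟩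
  have hN (v : M ⊗[A] V) (hv : v ∈ N) : w v ∈ N := by
    obtain ⟨y, rfl⟩ := hv
    exact hw _ (LinearMap.congr_fun hab' y)
  have hpow (k : ℕ) : (w ^ (k + 1)) z ∈ N := by
    induction k with
    | zero => simpa using hw z hz
    | succ k ih => rw [pow_succ']; exact hN _ ih
  have hCH : Polynomial.aeval w u.charpoly = 0 := by
    rw [Polynomial.aeval_algHom_apply, LinearMap.aeval_self_charpoly, map_zero]
  have h1 := LinearMap.congr_fun hCH z
  rw [Polynomial.aeval_eq_sum_range, Finset.sum_range_succ', pow_zero] at h1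
  have h2 : u.charpoly.coeff 0 • z =
      -∑ k ∈ Finset.range u.charpoly.natDegree, u.charpoly.coeff (k + 1) • (w ^ (k + 1)) z := by
    rw [eq_neg_iff_add_eq_zero, add_comm]
    simpa [LinearMap.sum_apply] using h1
  rw [h2]
  exact N.neg_mem (N.sum_mem fun k _ => N.smul_mem _ (hpow k))

end Contraction

end Exactness

section RegularPowers

open TensorProduct RingTheory.Sequence Pointwise

section Acyclicity

/-- Every sequence of powers of the members of `xs` is weakly regular on `M`. -/
def HasRegularPowers {A : Type*} [CommRing A] (M : Type*) [AddCommGroup M] [Module A M]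
    (xs : List A) : Prop :=
  ∀ rs, List.Forall₂ (fun x r => ∃ N : ℕ, r = x ^ N) xs rs → IsWeaklyRegular M rs

theorem List.forall₂_exists_pow_self {A : Type*} [CommRing A] (xs : List A) :
    List.Forall₂ (fun x r => ∃ N : ℕ, r = x ^ N) xs xs :=
  List.forall₂_same.2 fun x _ => ⟨1, (pow_one x).symm⟩

theorem HasRegularPowers.isSMulRegular {A M : Type*} [CommRing A] [AddCommGroup M] [Module A M]
    {x : A} {xs : List A} (h : HasRegularPowers M (x :: xs)) (N : ℕ) : IsSMulRegular M (x ^ N) :=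
  ((isWeaklyRegular_cons_iff _ _ _).1
    (h (x ^ N :: xs) (.cons ⟨N, rfl⟩ xs.forall₂_exists_pow_self))).1

theorem HasRegularPowers.quotSMulTop {A M : Type*} [CommRing A] [AddCommGroup M] [Module A M]
    {x : A} {xs : List A} (h : HasRegularPowers M (x :: xs)) (N : ℕ) :
    HasRegularPowers (QuotSMulTop (x ^ N) M) xs := fun rs hrs =>
  ((isWeaklyRegular_cons_iff _ _ _).1 (h (x ^ N :: rs) (.cons ⟨N, rfl⟩ hrs))).2

theorem exists_eq_smul_of_lTensor_mkQ_eq_zero {A M P : Type*} [CommRing A] [AddCommGroup M]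
    [Module A M] [AddCommGroup P] [Module A P] (r : A) (w : M ⊗[A] P)
    (hw : (Submodule.mkQ (r • ⊤ : Submodule A M)).rTensor P w = 0) : ∃ v, w = r • v := by
  have hex : Function.Exact (LinearMap.lsmul A M r) (Submodule.mkQ (r • ⊤ : Submodule A M)) := by
    rw [LinearMap.exact_iff, Submodule.ker_mkQ]
    ext m
    simp [Submodule.mem_smul_pointwise_iff_exists]
  have := rTensor_exact P hex (Submodule.mkQ_surjective _)
  obtain ⟨v, hv⟩ := (this w).1 hw
  refine ⟨v, hv.symm.trans ?_⟩
  rw [show LinearMap.lsmul A M r = r • LinearMap.id from rfl, LinearMap.rTensor_smul,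
    LinearMap.rTensor_id]
  rfl

variable {A : Type} [CommRing A] [IsLocalRing A] {P : ℕ → Type} [∀ i, AddCommGroup (P i)]
  [∀ i, Module A (P i)] (d : ∀ i, P (i + 1) →ₗ[A] P i)

theorem exact_lTensor_of_hasRegularPowers [∀ i, Module.Flat A (P i)]
    (hd : ∀ i, d i ∘ₗ d (i + 1) = 0) (n : ℕ)
    (hbig : ∀ j ≥ n, ∀ (M : Type) [AddCommGroup M] [Module A M] (z : M ⊗[A] P (j + 1)),
      (d j).lTensor M z = 0 → ∃ y, (d (j + 1)).lTensor M y = z)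
    (htors : ∀ j, ∃ t : ℕ, ∀ a ∈ IsLocalRing.maximalIdeal A ^ t,
      ∀ (M : Type) [AddCommGroup M] [Module A M] (z : M ⊗[A] P (j + 1)),
      (d j).lTensor M z = 0 → ∃ y, (d (j + 1)).lTensor M y = a • z)
    (xs : List A) (hxs : ∀ x ∈ xs, x ∈ IsLocalRing.maximalIdeal A)
    (M : Type) [AddCommGroup M] [Module A M] (hM : HasRegularPowers M xs)
    (j : ℕ) (hj : n ≤ j + xs.length) (z : M ⊗[A] P (j + 1)) (hz : (d j).lTensor M z = 0) :
    ∃ y, (d (j + 1)).lTensor M y = z := by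
  induction xs generalizing M j with
  | nil => exact hbig j hj M z hz
  | cons x xs ih =>
    obtain ⟨t, ht⟩ := htors j
    obtain ⟨w, hw⟩ := ht (x ^ t) (Ideal.pow_mem_pow (hxs x (by simp)) t) M z hz
    let π := Submodule.mkQ (x ^ t • ⊤ : Submodule A M)
    have hcomm (i : ℕ) (v : M ⊗[A] P (i + 1)) :
        (d i).lTensor _ (π.rTensor _ v) = π.rTensor _ ((d i).lTensor M v) := by
      rw [← LinearMap.comp_apply, ← LinearMap.comp_apply, LinearMap.lTensor_comp_rTensor,
        LinearMap.rTensor_comp_lTensor]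
    have hπ {i : ℕ} (v : M ⊗[A] P i) : π.rTensor (P i) (x ^ t • v) = 0 := by
      induction v with
      | zero => simp
      | tmul m p =>
        rw [TensorProduct.smul_tmul', LinearMap.rTensor_tmul]
        have : π (x ^ t • m) = 0 := (Submodule.Quotient.mk_eq_zero _).2
          (Submodule.smul_mem_pointwise_smul _ _ _ Submodule.mem_top)
        rw [this, TensorProduct.zero_tmul]
      | add u v hu hv => rw [smul_add, map_add, hu, hv, add_zero]
    obtain ⟨u', hu'⟩ := ih (fun y hy => hxs y (by simp [hy])) (QuotSMulTop (x ^ t) M)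
      (hM.quotSMulTop t) (j + 1) (by simp at hj; omega) (π.rTensor _ w)
      (by rw [hcomm, hw, hπ])
    obtain ⟨u, rfl⟩ := LinearMap.rTensor_surjective _ (Submodule.mkQ_surjective _) u'
    rw [hcomm, ← sub_eq_zero, ← map_sub] at hu'
    obtain ⟨v, hv⟩ := exists_eq_smul_of_lTensor_mkQ_eq_zero _ _ hu'
    refine ⟨-v, ?_⟩
    have hdd : (d (j + 1)).lTensor M ((d (j + 1 + 1)).lTensor M u) = 0 := by
      rw [← LinearMap.comp_apply, ← LinearMap.lTensor_comp, hd, LinearMap.lTensor_zero]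
      rfl
    have hreg : IsSMulRegular (M ⊗[A] P (j + 1)) (x ^ t) :=
      (hM.isSMulRegular t).rTensor (P (j + 1))
    apply hreg
    change x ^ t • _ = x ^ t • z
    rw [← hw, map_neg, smul_neg, ← map_smul, ← hv, map_sub, hdd, zero_sub, neg_neg]

end Acyclicity

end RegularPowers

section ColonConditions

namespace MvPowerSeries

theorem mem_span_X_pow_of_coeff {σ F : Type*} [CommRing F] (N : σ → ℕ) (J : Finset σ)
    (f : MvPowerSeries σ F)
    (hf : ∀ d : σ →₀ ℕ, (∀ j ∈ J, d j < N j) → coeff d f = 0) :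
    f ∈ Ideal.span ((fun j => (X j : MvPowerSeries σ F) ^ N j) '' (J : Set σ)) := by
  classical
  induction J using Finset.induction_on generalizing f with
  | empty =>
    have : f = 0 := by
      ext d
      simpa using hf d (by simp)
    rw [this]
    exact zero_mem _
  | insert a J ha ih =>
    let f₁ : MvPowerSeries σ F := fun d => if d a < N a then coeff d f else 0
    have hf₁ : ∀ d, coeff d f₁ = if d a < N a then coeff d f else 0 := fun d => rfl
    have h1 : f₁ ∈ Ideal.span ((fun j => (X j : MvPowerSeries σ F) ^ N j) '' (J : Set σ)) := by
      refine ih f₁ fun d hd => ?_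
      rw [hf₁]
      split_ifs with h
      · refine hf d fun j hj => ?_
        rcases Finset.mem_insert.1 hj with rfl | hj
        exacts [h, hd j hj]
      · rfl
    have h2 : (X a : MvPowerSeries σ F) ^ N a ∣ f - f₁ := by
      rw [X_pow_dvd_iff]
      intro d hd
      simp [hf₁, hd]
    rw [← sub_add_cancel f f₁]
    refine add_mem ?_ (Ideal.span_mono (Set.image_mono (by simp)) h1)
    obtain ⟨g, hg⟩ := h2
    rw [hg]
    exact Ideal.mul_mem_right _ _ (Ideal.subset_span ⟨a, by simp, rfl⟩)

theorem coeff_eq_zero_of_mem_span_X_pow {σ F : Type*} [CommRing F] (N : σ → ℕ) (J : Set σ)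
    {f : MvPowerSeries σ F}
    (hf : f ∈ Ideal.span ((fun j => (X j : MvPowerSeries σ F) ^ N j) '' J))
    (d : σ →₀ ℕ) (hd : ∀ j ∈ J, d j < N j) : coeff d f = 0 := by
  induction hf using Submodule.span_induction generalizing d with
  | mem x hx =>
    obtain ⟨j, hj, rfl⟩ := hx
    exact X_pow_dvd_iff.1 (dvd_refl _) d (hd j hj)
  | zero => simp
  | add x y _ _ hx hy => rw [map_add, hx d hd, hy d hd, add_zero]
  | smul a x _ hx =>
    classical
    rw [smul_eq_mul, coeff_mul]
    refine Finset.sum_eq_zero fun e he => ?_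
    rw [hx e.2 fun j hj => lt_of_le_of_lt ?_ (hd j hj), mul_zero]
    rw [← Finset.HasAntidiagonal.mem_antidiagonal.1 he]
    exact Nat.le_add_left _ _

theorem mem_span_X_pow_of_mul_mem {n : ℕ} {F : Type*} [CommRing F] (N : Fin n → ℕ) (i : Fin n)
    {f : MvPowerSeries (Fin n) F}
    (hf : (X i : MvPowerSeries (Fin n) F) ^ N i * f ∈
      Ideal.span ((fun j => (X j : MvPowerSeries (Fin n) F) ^ N j) '' Set.Iio i)) :
    f ∈ Ideal.span ((fun j => (X j : MvPowerSeries (Fin n) F) ^ N j) '' Set.Iio i) := by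
  rw [← Finset.coe_Iio]
  refine mem_span_X_pow_of_coeff N _ f fun d hd => ?_
  have h := coeff_eq_zero_of_mem_span_X_pow N _ hf (Finsupp.single i (N i) + d) fun j hj => ?_
  · rwa [X_pow_eq, coeff_add_monomial_mul, one_mul] at h
  · have hne : j ≠ i := ne_of_lt hj
    simpa [Finsupp.single_apply, hne.symm] using hd j (by simpa using hj)

end MvPowerSeries

theorem Module.exists_linearIndependent_smul_mem_span (S V : Type*) [CommRing S] [IsDomain S]
    [AddCommGroup V] [Module S V] [Module.Finite S V] :
    ∃ (B : Set V) (c : S), LinearIndepOn S id B ∧ c ≠ 0 ∧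
      ∀ v : V, c • v ∈ Submodule.span S B := by
  classical
  obtain ⟨T, hT⟩ := Module.Finite.fg_top (R := S) (M := V)
  obtain ⟨I, hI, hmax⟩ := exists_maximal_linearIndepOn S (fun t : T => (t : V))
  have key : ∀ t : T, ∃ a : S, a ≠ 0 ∧ a • (t : V) ∈ Submodule.span S ((fun t : T => (t : V)) '' I) := by
    intro t
    by_cases ht : t ∈ I
    · exact ⟨1, one_ne_zero, by rw [one_smul]; exact Submodule.subset_span ⟨t, ht, rfl⟩⟩
    · exact hmax t ht
  choose a ha0 ha using key
  refine ⟨_, ∏ t, a t, hI.id_image, Finset.prod_ne_zero_iff.2 fun t _ => ha0 t, fun v => ?_⟩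
  have hv : v ∈ Submodule.span S (T : Set V) := hT ▸ Submodule.mem_top
  induction hv using Submodule.span_induction with
  | mem x hx =>
    rw [← Finset.prod_erase_mul _ _ (Finset.mem_univ (⟨x, hx⟩ : T)), mul_smul]
    exact Submodule.smul_mem _ _ (ha ⟨x, hx⟩)
  | zero => rw [smul_zero]; exact zero_mem _
  | add x y _ _ hx hy => rw [smul_add]; exact add_mem hx hy
  | smul b x _ hx => rw [smul_comm]; exact Submodule.smul_mem _ _ hx

/-- A finite module over a domain satisfies the colon conditions of the ring up to a fixed nonzero
multiplier. -/
theorem Module.exists_smul_mem_of_colon (S V : Type*) [CommRing S] [IsDomain S]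
    [AddCommGroup V] [Module S V] [Module.Finite S V] :
    ∃ c : S, c ≠ 0 ∧ ∀ (J : Ideal S) (r : S), (∀ f, r * f ∈ J → f ∈ J) →
      ∀ v : V, r • v ∈ J • (⊤ : Submodule S V) → c • v ∈ J • (⊤ : Submodule S V) := by
  obtain ⟨B, c, hB, hc, hmem⟩ := Module.exists_linearIndependent_smul_mem_span S V
  refine ⟨c, hc, fun J r hr v hv => ?_⟩
  have hB' : LinearIndependent S ((↑) : B → V) := hB
  have hmem' : ∀ v : V, c • v ∈ Submodule.span S (Set.range ((↑) : B → V)) := by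
    simpa using hmem
  let b := Module.Basis.span hB'
  let μ : V →ₗ[S] Submodule.span S (Set.range ((↑) : B → V)) :=
    (LinearMap.lsmul S V c).codRestrict _ hmem'
  have h1 : ∀ k, b.coord k (μ v) ∈ J := by
    intro k
    refine hr _ ?_
    rw [← smul_eq_mul, ← map_smul, ← map_smul]
    have h2 : (b.coord k ∘ₗ μ) (r • v) ∈ (J • (⊤ : Submodule S V)).map (b.coord k ∘ₗ μ) :=
      Submodule.mem_map_of_mem hv
    rw [Submodule.map_smul''] at h2
    have h3 : J • (⊤ : Submodule S V).map (b.coord k ∘ₗ μ) ≤ J :=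
      Submodule.smul_le.2 fun x hx y _ => J.mul_mem_right y hx
    exact h3 h2
  have h3 : μ v ∈ J • (⊤ : Submodule S (Submodule.span S (Set.range ((↑) : B → V)))) := by
    rw [← b.linearCombination_repr (μ v), Finsupp.linearCombination_apply]
    exact Submodule.sum_mem _ fun k _ => Submodule.smul_mem_smul (h1 k) trivial
  have h4 : (μ v : V) ∈ (J • (⊤ : Submodule S (Submodule.span S (Set.range ((↑) : B → V))))).map
      (Submodule.subtype _) := ⟨_, h3, rfl⟩
  rw [Submodule.map_smul''] at h4
  have h5 := smul_mono_right J (le_top (a := (⊤ : Submodule S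
    (Submodule.span S (Set.range ((↑) : B → V)))).map (Submodule.subtype _)))
  exact h5 h4

end ColonConditions

section FiniteCovers

theorem exists_ringHom_comp_algebraMap_eq_of_isDomain {R A Ω : Type*} [CommRing R] [IsDomain R]
    [CommRing A] [IsDomain A] [Field Ω] [IsAlgClosed Ω] [Algebra R A] [Algebra.IsIntegral R A]
    (φ : R →+* Ω) (hφ : Function.Injective φ) (h : Function.Injective (algebraMap R A)) :
    ∃ ψ : A →+* Ω, ψ.comp (algebraMap R A) = φ := by
  let : Algebra R Ω := φ.toAlgebra
  have : FaithfulSMul R Ω := (faithfulSMul_iff_algebraMap_injective _ _).2 hφ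
  have : FaithfulSMul R A := (faithfulSMul_iff_algebraMap_injective _ _).2 h
  let ψ : A →ₐ[R] Ω := IsAlgClosed.lift
  exact ⟨ψ, ψ.comp_algebraMap⟩

theorem exists_ringHom_comp_algebraMap_eq {R A Ω : Type*} [CommRing R] [CommRing A] [Field Ω]
    [IsAlgClosed Ω] [Algebra R A] [Algebra.IsIntegral R A] (φ : R →+* Ω)
    (h : RingHom.ker (algebraMap R A) ≤ RingHom.ker φ) :
    ∃ ψ : A →+* Ω, ψ.comp (algebraMap R A) = φ := by
  have hprime : (RingHom.ker φ).IsPrime := RingHom.ker_isPrime φ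
  obtain ⟨Q, -, hQ, hQφ⟩ := Ideal.exists_ideal_over_prime_of_isIntegral (RingHom.ker φ) (⊥ : Ideal A) h
  let P := Q.comap (algebraMap R A)
  have hP : P = RingHom.ker φ := hQφ
  have hinj : Function.Injective (Ideal.Quotient.lift P φ fun a ha => by rwa [hP] at ha) := by
    rw [injective_iff_map_eq_zero]
    intro a ha
    obtain ⟨a, rfl⟩ := Ideal.Quotient.mk_surjective a
    rw [Ideal.Quotient.eq_zero_iff_mem, hP]
    exact ha
  obtain ⟨ψ, hψ⟩ := exists_ringHom_comp_algebraMap_eq_of_isDomain (R := R ⧸ P) (A := A ⧸ Q)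
    _ hinj Ideal.algebraMap_quotient_injective
  refine ⟨ψ.comp (Ideal.Quotient.mk Q), ?_⟩
  ext r
  exact RingHom.congr_fun hψ (Ideal.Quotient.mk P r)

open MvPowerSeries in
theorem exists_finite_subalgebra_almost_regular {n p : ℕ} {F Ω : Type*} [Field F] [CharP F p]
    (hp : p.Prime) [Field Ω] [Algebra (MvPowerSeries (Fin n) F) Ω]
    (hΩ : Function.Injective (algebraMap (MvPowerSeries (Fin n) F) Ω)) (T : Set Ω) (hT : T.Finite)
    (hTi : ∀ t ∈ T, IsIntegral (MvPowerSeries (Fin n) F) t) (e : ℕ) :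
    ∃ (V : Subalgebra (MvPowerSeries (Fin n) F) Ω) (c : V) (k : ℕ), T ⊆ V ∧ c ≠ 0 ∧
      (∀ (N : Fin n → ℕ) (i : Fin n) (v : V),
        algebraMap (MvPowerSeries (Fin n) F) V (X i) ^ N i * v ∈
          Ideal.span ((fun j => algebraMap (MvPowerSeries (Fin n) F) V (X j) ^ N j) '' Set.Iio i) →
        c * v ∈ Ideal.span ((fun j => algebraMap (MvPowerSeries (Fin n) F) V (X j) ^ N j) '' Set.Iio i)) ∧
      c ^ e ∉ Ideal.span (Set.range fun i => algebraMap (MvPowerSeries (Fin n) F) V (X i) ^ p ^ k) := by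
  let V := Algebra.adjoin (MvPowerSeries (Fin n) F) T
  have hfin : Module.Finite (MvPowerSeries (Fin n) F) V := .of_fg (fg_adjoin_of_finite hT hTi)
  have hdom : IsDomain (MvPowerSeries (Fin n) F) := NoZeroDivisors.to_isDomain _
  have hnoeth : IsNoetherianRing V := IsNoetherianRing.of_finite (MvPowerSeries (Fin n) F) V
  have hV : Function.Injective (algebraMap (MvPowerSeries (Fin n) F) V) := fun a b hab =>
    hΩ (congrArg Subtype.val hab)
  obtain ⟨c, hc, hcol⟩ := Module.exists_smul_mem_of_colon (MvPowerSeries (Fin n) F) V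
  have hmap : ∀ J : Ideal (MvPowerSeries (Fin n) F), ∀ v : V, v ∈ J • (⊤ : Submodule _ V) ↔
      v ∈ J.map (algebraMap (MvPowerSeries (Fin n) F) V) := fun J v => by
    rw [Ideal.smul_top_eq_map]; rfl
  have hprop : (Ideal.span (Set.range (X : Fin n → MvPowerSeries (Fin n) F))).map
      (algebraMap (MvPowerSeries (Fin n) F) V) ≠ ⊤ := by
    have h_int : (algebraMap (MvPowerSeries (Fin n) F) V).IsIntegral :=
      algebraMap_isIntegral_iff.2 inferInstance
    rw [Ne, Ideal.map_eq_top_iff _ hV h_int, ← maximalIdeal_eq_span_range_X]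
    exact (IsLocalRing.maximalIdeal.isMaximal _).ne_top
  have hc' : algebraMap (MvPowerSeries (Fin n) F) V c ^ e ≠ 0 := pow_ne_zero _ ((map_ne_zero_iff _ hV).2 hc)
  have hkrull : ∃ k : ℕ, algebraMap (MvPowerSeries (Fin n) F) V c ^ e ∉ ((Ideal.span (Set.range
      (X : Fin n → MvPowerSeries (Fin n) F))).map (algebraMap (MvPowerSeries (Fin n) F) V)) ^ k := by
    by_contra! hcon
    apply hc'
    rw [← Ideal.mem_bot, ← Ideal.iInf_pow_eq_bot_of_isDomain _ hprop]
    exact (Submodule.mem_iInf _).2 hcon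
  obtain ⟨k, hk⟩ := hkrull
  refine ⟨V, algebraMap (MvPowerSeries (Fin n) F) V c, k, Algebra.subset_adjoin, (map_ne_zero_iff _ hV).2 hc, ?_, ?_⟩
  · intro N i v hv
    have himg : Ideal.span ((fun j => algebraMap (MvPowerSeries (Fin n) F) V (X j) ^ N j) '' Set.Iio i) =
        (Ideal.span ((fun j => (X j : MvPowerSeries (Fin n) F) ^ N j) '' Set.Iio i)).map
          (algebraMap (MvPowerSeries (Fin n) F) V) := by
      rw [Ideal.map_span, Set.image_image]
      simp only [map_pow]
    rw [himg, ← hmap, ← Algebra.smul_def]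
    refine hcol _ (X i ^ N i) (fun f hf => mem_span_X_pow_of_mul_mem N i hf) v ?_
    rw [hmap, ← himg, Algebra.smul_def, map_pow]
    exact hv
  · intro hmem
    apply hk
    refine Ideal.pow_le_pow_right (Nat.lt_pow_self hp.one_lt).le (n := p ^ k) ?_
    refine (Ideal.span_le.2 ?_) hmem
    rintro _ ⟨i, rfl⟩
    exact Ideal.pow_mem_pow (Ideal.mem_map_of_mem _ (Ideal.subset_span (Set.mem_range_self i))) _

end FiniteCovers

section Specializations

theorem exists_ringHom_integralClosure {R C S Ω : Type*} [CommRing R] [CommRing C] [CommRing S]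
    [Field Ω] [IsAlgClosed Ω] [Algebra R C] [Algebra S Ω] (φ : R →+* S)
    (hker : ∀ r, algebraMap R C r = 0 → φ r = 0) :
    ∃ ψ : integralClosure R C →+* Ω,
      (∀ r, ψ (algebraMap R _ r) = algebraMap S Ω (φ r)) ∧ ∀ a, IsIntegral S (ψ a) := by
  obtain ⟨ψ, hψ⟩ := exists_ringHom_comp_algebraMap_eq (A := integralClosure R C)
    ((algebraMap S Ω).comp φ) fun r hr => by
      have h : algebraMap R C r = 0 := congrArg Subtype.val (RingHom.mem_ker.1 hr)
      rw [RingHom.mem_ker, RingHom.comp_apply, hker r h, map_zero]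
  refine ⟨ψ, RingHom.congr_fun hψ, fun a => ?_⟩
  obtain ⟨f, hf, hfa⟩ := Algebra.IsIntegral.isIntegral (R := R) a
  refine ⟨f.map φ, hf.map φ, ?_⟩
  rw [Polynomial.eval₂_map, ← hψ, ← Polynomial.hom_eval₂, hfa, map_zero]

theorem isIntegral_of_coeff_mem_range {R₀ R C : Type*} [CommRing R₀] [CommRing R] [CommRing C]
    [Algebra R C] [Algebra R₀ C] (θ : R₀ →+* R)
    (hθ : ∀ r, algebraMap R₀ C r = algebraMap R C (θ r)) {a : C} {f : Polynomial R} (hf : f.Monic)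
    (hfa : f.eval₂ (algebraMap R C) a = 0) (hcoeff : ∀ i ≤ f.natDegree, f.coeff i ∈ θ.range) :
    IsIntegral R₀ a := by
  have hlift : f ∈ Polynomial.lifts θ := by
    rw [Polynomial.lifts_iff_coeff_lifts]
    intro i
    by_cases hi : i ≤ f.natDegree
    · exact hcoeff i hi
    · exact ⟨0, by rw [map_zero, Polynomial.coeff_eq_zero_of_natDegree_lt (not_le.1 hi)]⟩
  obtain ⟨g, hgf, -, hg⟩ := Polynomial.lifts_and_natDegree_eq_and_monic hlift hf
  refine ⟨g, hg, ?_⟩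
  have h : algebraMap R₀ C = (algebraMap R C).comp θ := RingHom.ext hθ
  rw [h, ← Polynomial.eval₂_map, hgf, hfa]

theorem injective_algebraMap_algebraicClosure_fractionRing (S : Type*) [CommRing S] [IsDomain S] :
    Function.Injective (algebraMap S (AlgebraicClosure (FractionRing S))) := by
  rw [IsScalarTower.algebraMap_eq S (FractionRing S)]
  exact (algebraMap (FractionRing S) _).injective.comp (IsFractionRing.injective S _)

open MvPowerSeries in
theorem exists_almost_regular_approximation {n : ℕ} {K C : Type} [Field K] [CharZero K] [CommRing C]
    [Algebra (MvPowerSeries (Fin n) K) C] [Algebra.IsIntegral (MvPowerSeries (Fin n) K) C]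
    (hinj : Function.Injective (algebraMap (MvPowerSeries (Fin n) K) C)) (s : Finset C) (e : ℕ) :
    ∃ (V : Type) (_ : CommRing V) (_ : IsDomain V) (g : C → V) (c : V), c ≠ 0 ∧ g 0 = 0 ∧ g 1 = 1 ∧
      (∀ a ∈ s, ∀ b ∈ s, g (a + b) = g a + g b ∧ g (a * b) = g a * g b) ∧
      (∀ (N : Fin n → ℕ) (i : Fin n) (v : V),
        g (algebraMap (MvPowerSeries (Fin n) K) C (X i)) ^ N i * v ∈
          Ideal.span ((fun j => g (algebraMap (MvPowerSeries (Fin n) K) C (X j)) ^ N j) '' Set.Iio i) →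
        c * v ∈ Ideal.span
          ((fun j => g (algebraMap (MvPowerSeries (Fin n) K) C (X j)) ^ N j) '' Set.Iio i)) ∧
      c ^ e ∉ Ideal.span (Set.range fun i => g (algebraMap (MvPowerSeries (Fin n) K) C (X i))) := by
  classical
  choose f hf hfa using fun a : C =>
    Algebra.IsIntegral.isIntegral (R := MvPowerSeries (Fin n) K) a
  let ι : Type := Σ a : s, Fin ((f a).natDegree + 1)
  let z : ι → MvPowerSeries (Fin n) K := fun k => (f k.1).coeff k.2
  obtain ⟨p, hp, F, _, _, w, hw⟩ := hasReductions n K ι z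
  let : Algebra (MvPolynomial (Fin n ⊕ ι) ℤ) C :=
    ((algebraMap (MvPowerSeries (Fin n) K) C).comp (intEval (Sum.elim X z))).toAlgebra
  have halg : ∀ r, algebraMap (MvPolynomial (Fin n ⊕ ι) ℤ) C r =
      algebraMap (MvPowerSeries (Fin n) K) C (intEval (Sum.elim X z) r) := fun r => rfl
  have hsint : ∀ a ∈ s, IsIntegral (MvPolynomial (Fin n ⊕ ι) ℤ) a := fun a ha =>
    isIntegral_of_coeff_mem_range (intEval (Sum.elim X z)) halg (hf a) (hfa a) fun i hi =>
      ⟨MvPolynomial.X (Sum.inr ⟨⟨a, ha⟩, ⟨i, Nat.lt_succ_of_le hi⟩⟩), by simp [z]⟩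
  have hdom : IsDomain (MvPowerSeries (Fin n) F) := NoZeroDivisors.to_isDomain _
  obtain ⟨ψ, hψ, hψint⟩ := exists_ringHom_integralClosure (C := C)
    (Ω := AlgebraicClosure (FractionRing (MvPowerSeries (Fin n) F)))
    (intEval (Sum.elim X w) : MvPolynomial (Fin n ⊕ ι) ℤ →+* _) fun r hr => by
      refine hw r (hinj ?_)
      rw [map_zero]
      exact hr
  have hΩ : Function.Injective (algebraMap (MvPowerSeries (Fin n) F)
      (AlgebraicClosure (FractionRing (MvPowerSeries (Fin n) F)))) :=
    injective_algebraMap_algebraicClosure_fractionRing _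
  let T : Set (AlgebraicClosure (FractionRing (MvPowerSeries (Fin n) F))) :=
    Set.range fun a : s => ψ ⟨a, hsint a a.2⟩
  obtain ⟨V, c, k, hTV, hc, hreg, hce⟩ := exists_finite_subalgebra_almost_regular hp hΩ T
    (Set.finite_range _) (by rintro _ ⟨a, rfl⟩; exact hψint _) e
  let h : C → Prop := fun a => ∃ ha : a ∈ integralClosure (MvPolynomial (Fin n ⊕ ι) ℤ) C, ψ ⟨a, ha⟩ ∈ V
  let g : C → V := fun a => if H : h a then ⟨ψ ⟨a, H.1⟩, H.2⟩ ^ p ^ k else 0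
  have hg : ∀ a (ha : a ∈ integralClosure (MvPolynomial (Fin n ⊕ ι) ℤ) C) (hV : ψ ⟨a, ha⟩ ∈ V),
      g a = ⟨ψ ⟨a, ha⟩, hV⟩ ^ p ^ k := fun a ha hV => dif_pos ⟨ha, hV⟩
  have hgs : ∀ a (ha : a ∈ s), ψ ⟨a, hsint a ha⟩ ∈ V := fun a ha => hTV ⟨⟨a, ha⟩, rfl⟩
  have hgX : ∀ i, g (algebraMap (MvPowerSeries (Fin n) K) C (X i)) =
      algebraMap (MvPowerSeries (Fin n) F) V (X i) ^ p ^ k := by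
    intro i
    have h1 : algebraMap (MvPowerSeries (Fin n) K) C (X i) =
        algebraMap (MvPolynomial (Fin n ⊕ ι) ℤ) C (MvPolynomial.X (Sum.inl i)) := by
      rw [halg]; simp
    have h2 := hψ (MvPolynomial.X (Sum.inl i))
    have h3 : intEval (Sum.elim X w) (MvPolynomial.X (Sum.inl i)) = (X i : MvPowerSeries (Fin n) F) := by
      simp
    rw [h3] at h2
    rw [h1, hg _ (Subalgebra.algebraMap_mem _ _) (by
      have := V.algebraMap_mem (X i)
      rw [← h2] at this
      exact this)]
    congr 1
    exact Subtype.ext h2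
  have hFact : Fact p.Prime := ⟨hp⟩
  have hchar : CharP V p := charP_of_injective_ringHom
    (((algebraMap (MvPowerSeries (Fin n) F) V).comp MvPowerSeries.C).injective) p
  refine ⟨V, inferInstance, inferInstance, g, c, hc, ?_, ?_, ?_, ?_, ?_⟩
  · have h0 : ψ ⟨0, zero_mem _⟩ = 0 := map_zero ψ
    rw [hg 0 (zero_mem _) (h0 ▸ zero_mem _)]
    exact Subtype.ext (by simp [h0, hp.ne_zero])
  · have h0 : ψ ⟨1, one_mem _⟩ = 1 := map_one ψ
    rw [hg 1 (one_mem _) (h0 ▸ one_mem _)]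
    exact Subtype.ext (by simp [h0])
  · intro a ha b hb
    have h1 : ψ ⟨a + b, add_mem (hsint a ha) (hsint b hb)⟩ =
      ψ ⟨a, hsint a ha⟩ + ψ ⟨b, hsint b hb⟩ := map_add ψ ⟨a, hsint a ha⟩ ⟨b, hsint b hb⟩
    have h2 : ψ ⟨a * b, mul_mem (hsint a ha) (hsint b hb)⟩ =
      ψ ⟨a, hsint a ha⟩ * ψ ⟨b, hsint b hb⟩ := map_mul ψ ⟨a, hsint a ha⟩ ⟨b, hsint b hb⟩
    rw [hg (a + b) _ (h1 ▸ add_mem (hgs a ha) (hgs b hb)), hg (a * b) _ (h2 ▸ mul_mem (hgs a ha) (hgs b hb)),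
      hg a _ (hgs a ha), hg b _ (hgs b hb), ← add_pow_char_pow, ← mul_pow]
    exact ⟨congrArg (· ^ p ^ k) (Subtype.ext h1), congrArg (· ^ p ^ k) (Subtype.ext h2)⟩
  · intro N i v hv
    simp only [hgX, ← pow_mul] at hv ⊢
    exact hreg (fun j => p ^ k * N j) i v hv
  · simpa only [hgX] using hce

end Specializations

section Limits

open Filter

/-- The ideal of families vanishing eventually along a filter. -/
def Filter.eventuallyZero {I : Type*} (l : Filter I) (V : I → Type*) [∀ s, CommRing (V s)] :
    Ideal (∀ s, V s) where
  carrier := {v | ∀ᶠ s in l, v s = 0}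
  zero_mem' := Eventually.of_forall fun _ => rfl
  add_mem' := fun {a b} ha hb => by
    filter_upwards [ha, hb] with s h1 h2
    rw [Pi.add_apply, h1, h2, add_zero]
  smul_mem' := fun a {b} hb => by
    filter_upwards [hb] with s h
    rw [smul_eq_mul, Pi.mul_apply, h, mul_zero]

theorem Filter.mem_eventuallyZero {I : Type*} {l : Filter I} {V : I → Type*}
    [∀ s, CommRing (V s)] {v : ∀ s, V s} : v ∈ l.eventuallyZero V ↔ ∀ᶠ s in l, v s = 0 :=
  Iff.rfl

theorem Filter.mk_mem_span_image_iff {I ι : Type*} {l : Filter I} {V : I → Type*}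
    [∀ s, CommRing (V s)] (v : ∀ s, V s) (u : ι → ∀ s, V s) (J : Finset ι) :
    Ideal.Quotient.mk (l.eventuallyZero V) v ∈
      Ideal.span ((fun j => Ideal.Quotient.mk (l.eventuallyZero V) (u j)) '' (J : Set ι)) ↔
    ∀ᶠ s in l, v s ∈ Ideal.span ((fun j => u j s) '' (J : Set ι)) := by
  classical
  constructor
  · intro h
    obtain ⟨a, ha⟩ := (Submodule.mem_span_image_finset_iff_exists_fun' _).1 h
    choose b hb using fun j => Ideal.Quotient.mk_surjective (I := l.eventuallyZero V) (a j)
    have h1 : (∑ j ∈ J, b j * u j) - v ∈ l.eventuallyZero V := by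
      rw [← Ideal.Quotient.eq, ← ha, map_sum]
      simp [hb]
    filter_upwards [h1] with s hs
    rw [Pi.sub_apply, sub_eq_zero] at hs
    rw [← hs, Finset.sum_apply]
    exact Ideal.sum_mem _ fun j hj =>
      Ideal.mul_mem_left _ _ (Ideal.subset_span ⟨j, hj, rfl⟩)
  · intro h
    have h1 : ∀ s, ∃ a : ι → V s, v s ∈ Ideal.span ((fun j => u j s) '' (J : Set ι)) →
        ∑ j ∈ J, a j * u j s = v s := by
      intro s
      by_cases hs : v s ∈ Ideal.span ((fun j => u j s) '' (J : Set ι))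
      · obtain ⟨a, ha⟩ := (Submodule.mem_span_image_finset_iff_exists_fun' _).1 hs
        exact ⟨a, fun _ => by simpa using ha⟩
      · exact ⟨0, fun h => absurd h hs⟩
    choose a ha using h1
    have h2 : Ideal.Quotient.mk (l.eventuallyZero V) v =
        Ideal.Quotient.mk (l.eventuallyZero V) (∑ j ∈ J, (fun s => a s j) * u j) := by
      rw [Ideal.Quotient.eq, mem_eventuallyZero]
      filter_upwards [h] with s hs
      rw [Pi.sub_apply, sub_eq_zero, Finset.sum_apply, ← ha s hs]
      rfl
    rw [h2, map_sum]
    refine Ideal.sum_mem _ fun j hj => ?_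
    rw [map_mul]
    exact Ideal.mul_mem_left _ _ (Ideal.subset_span ⟨j, hj, rfl⟩)

theorem exists_algebra_regular_of_approximations {n : ℕ} {C : Type} [CommRing C] [Infinite C]
    (x : Fin n → C)
    (happ : ∀ (s : Finset C) (e : ℕ), ∃ (V : Type) (_ : CommRing V) (g : C → V) (c : V),
      g 0 = 0 ∧ g 1 = 1 ∧
      (∀ a ∈ s, ∀ b ∈ s, g (a + b) = g a + g b ∧ g (a * b) = g a * g b) ∧
      (∀ (N : Fin n → ℕ) (i : Fin n) (v : V),
        g (x i) ^ N i * v ∈ Ideal.span ((fun j => g (x j) ^ N j) '' Set.Iio i) →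
        c * v ∈ Ideal.span ((fun j => g (x j) ^ N j) '' Set.Iio i)) ∧
      c ^ e ∉ Ideal.span (Set.range fun i => g (x i))) :
    ∃ (M : Type) (_ : CommRing M) (_ : Algebra C M),
      (∀ (N : Fin n → ℕ) (i : Fin n) (m : M),
        algebraMap C M (x i) ^ N i * m ∈
          Ideal.span ((fun j => algebraMap C M (x j) ^ N j) '' Set.Iio i) →
        m ∈ Ideal.span ((fun j => algebraMap C M (x j) ^ N j) '' Set.Iio i)) ∧
      Ideal.span (Set.range fun i => algebraMap C M (x i)) ≠ ⊤ := by
  classical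
  choose V _ g c hg0 hg1 hgs hreg hce using fun s : Finset C => happ s s.card
  let π := Ideal.Quotient.mk ((atTop : Filter (Finset C)).eventuallyZero V)
  have hπ : ∀ {u v : ∀ s, V s}, (∀ᶠ s in atTop, u s = v s) → π u = π v := fun {u v} h => by
    refine (Ideal.Quotient.eq (I := (atTop : Filter (Finset C)).eventuallyZero V)).2 ?_
    filter_upwards [h] with s hs
    rw [Pi.sub_apply, hs, sub_self]
  have hmem : ∀ a : C, ∀ᶠ s : Finset C in atTop, a ∈ s := fun a => by
    filter_upwards [eventually_ge_atTop {a}] with s hs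
    exact hs (Finset.mem_singleton_self a)
  let θ : C →+* (∀ s, V s) ⧸ (atTop : Filter (Finset C)).eventuallyZero V :=
    { toFun := fun a => π fun s => g s a
      map_one' := by
        rw [← map_one π]
        exact hπ (Eventually.of_forall fun s => hg1 s)
      map_zero' := by
        rw [← map_zero π]
        exact hπ (Eventually.of_forall fun s => hg0 s)
      map_add' := fun a b => by
        rw [← map_add π]
        refine hπ ?_
        filter_upwards [hmem a, hmem b] with s ha hb
        exact (hgs s a ha b hb).1
      map_mul' := fun a b => by
        rw [← map_mul π]
        refine hπ ?_
        filter_upwards [hmem a, hmem b] with s ha hb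
        exact (hgs s a ha b hb).2 }
  have hθ : ∀ a, θ a = π fun s => g s a := fun a => rfl
  clear_value θ
  let D := (∀ s, V s) ⧸ (atTop : Filter (Finset C)).eventuallyZero V
  let M := Localization.Away (π c)
  let : Algebra C M := ((algebraMap D M).comp θ).toAlgebra
  have halg : ∀ a, algebraMap C M a = algebraMap D M (θ a) := fun a => rfl
  refine ⟨M, inferInstance, inferInstance, ?_, ?_⟩
  · intro N i m hm
    have hspan : Ideal.span ((fun j => algebraMap C M (x j) ^ N j) '' Set.Iio i) =
        (Ideal.span ((fun j => π fun s => g s (x j) ^ N j) '' (Finset.Iio i : Set (Fin n)))).map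
          (algebraMap D M) := by
      rw [Ideal.map_span, Set.image_image, Finset.coe_Iio]
      congr 1
      refine Set.image_congr fun j _ => ?_
      rw [halg, hθ, ← map_pow, ← map_pow]
      rfl
    rw [hspan] at hm ⊢
    obtain ⟨⟨d, ⟨_, k, rfl⟩⟩, hd⟩ := IsLocalization.surj (Submonoid.powers (π c)) m
    have hunit : IsUnit (algebraMap D M (π c ^ k)) :=
      IsLocalization.map_units M (⟨_, k, rfl⟩ : Submonoid.powers (π c))
    rw [← Ideal.mul_unit_mem_iff_mem _ hunit] at hm ⊢
    simp only at hd
    rw [mul_assoc, hd] at hm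
    rw [hd]
    obtain ⟨d, rfl⟩ := Ideal.Quotient.mk_surjective d
    rw [halg, hθ, ← map_pow, ← map_mul, IsLocalization.algebraMap_mem_map_algebraMap_iff
      (Submonoid.powers (π c))] at hm
    obtain ⟨_, ⟨l, rfl⟩, hm⟩ := hm
    rw [IsLocalization.algebraMap_mem_map_algebraMap_iff (Submonoid.powers (π c))]
    refine ⟨_, ⟨l + 1, rfl⟩, ?_⟩
    have hm' : π (c ^ l * ((fun s => g s (x i) ^ N i) * d)) ∈
      Ideal.span ((fun j => π fun s => g s (x j) ^ N j) '' (Finset.Iio i : Set (Fin n))) := hm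
    rw [Filter.mk_mem_span_image_iff] at hm'
    have goal : π (c ^ (l + 1) * d) ∈
      Ideal.span ((fun j => π fun s => g s (x j) ^ N j) '' (Finset.Iio i : Set (Fin n))) := by
      rw [Filter.mk_mem_span_image_iff]
      filter_upwards [hm'] with s hs
      rw [Finset.coe_Iio] at hs ⊢
      have := hreg s N i (c s ^ l * d s) (by
        convert hs using 1
        simp only [Pi.mul_apply, Pi.pow_apply]
        ring)
      convert this using 1
      simp only [Pi.mul_apply, Pi.pow_apply]
      ring
    exact goal
  · intro htop
    have hspan : Ideal.span (Set.range fun i => algebraMap C M (x i)) =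
        (Ideal.span ((fun j => π fun s => g s (x j)) ''
          ((Finset.univ : Finset (Fin n)) : Set (Fin n)))).map (algebraMap D M) := by
      rw [Ideal.map_span, Set.image_image, Finset.coe_univ, Set.image_univ]
      simp only [halg, hθ]
    rw [hspan, Ideal.eq_top_iff_one, ← map_one (algebraMap D M),
      IsLocalization.algebraMap_mem_map_algebraMap_iff (Submonoid.powers (π c))] at htop
    obtain ⟨_, ⟨l, rfl⟩, hm⟩ := htop
    have hm' : π (c ^ l) ∈ Ideal.span ((fun j => π fun s => g s (x j)) ''
          ((Finset.univ : Finset (Fin n)) : Set (Fin n))) := by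
      simpa using hm
    rw [Filter.mk_mem_span_image_iff] at hm'
    obtain ⟨t, ht⟩ := Infinite.exists_subset_card_eq C l
    obtain ⟨s, hs, hts⟩ := (hm'.and (eventually_ge_atTop t)).exists
    apply hce s
    have hle : l ≤ s.card := ht ▸ Finset.card_le_card hts
    obtain ⟨r, hr⟩ := Nat.exists_eq_add_of_le hle
    rw [hr, pow_add]
    refine Ideal.mul_mem_right _ _ ?_
    simpa using hs

end Limits

section BigCohenMacaulay

open RingTheory.Sequence

theorem Ideal.ofList_take_ofFn {A : Type*} [CommRing A] {n : ℕ} (y : Fin n → A) (i : Fin n) :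
    Ideal.ofList ((List.ofFn y).take i) = Ideal.span (y '' Set.Iio i) := by
  unfold Ideal.ofList
  congr 1
  ext r
  simp only [Set.mem_ofPred_eq, List.mem_take_iff_getElem, List.length_ofFn, List.getElem_ofFn,
    Set.mem_image, Set.mem_Iio]
  constructor
  · rintro ⟨j, hj, rfl⟩
    exact ⟨⟨j, by omega⟩, Fin.lt_def.2 (lt_of_lt_of_le hj (min_le_left _ _)), rfl⟩
  · rintro ⟨j, hj, rfl⟩
    exact ⟨j, lt_min (Fin.lt_def.1 hj) j.2, rfl⟩

theorem hasRegularPowers_ofFn {A M : Type*} [CommRing A] [CommRing M] [Algebra A M] {n : ℕ}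
    (a : Fin n → A)
    (h : ∀ (N : Fin n → ℕ) (i : Fin n) (m : M),
        algebraMap A M (a i) ^ N i * m ∈
          Ideal.span ((fun j => algebraMap A M (a j) ^ N j) '' Set.Iio i) →
        m ∈ Ideal.span ((fun j => algebraMap A M (a j) ^ N j) '' Set.Iio i)) :
    HasRegularPowers M (List.ofFn a) := by
  intro rs hrs
  obtain ⟨hlen, hget⟩ := List.forall₂_iff_get.1 hrs
  have hlen' : rs.length = n := by simpa using hlen.symm
  choose N hN using fun i : Fin n => hget i (by simp) (hlen'.symm ▸ i.2)
  have hrs' : rs = List.ofFn fun i => a i ^ N i := by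
    refine List.ext_getElem (by simpa using hlen') fun k h1 h2 => ?_
    simpa using hN ⟨k, hlen' ▸ h1⟩
  subst hrs'
  rw [isWeaklyRegular_iff_Fin]
  intro k
  obtain ⟨i, hi⟩ : ∃ i : Fin n, (i : ℕ) = k := ⟨⟨k, k.2.trans_eq hlen'⟩, rfl⟩
  have hki : (List.ofFn fun i => a i ^ N i)[k] = a i ^ N i := by
    simp [← hi]
  have hspan : ∀ m : M, m ∈ (Ideal.ofList ((List.ofFn fun i => a i ^ N i).take k) • ⊤ :
      Submodule A M) ↔ m ∈ Ideal.span ((fun j => algebraMap A M (a j) ^ N j) '' Set.Iio i) := by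
    intro m
    rw [← hi, Ideal.ofList_take_ofFn, Ideal.smul_top_eq_map, Submodule.restrictScalars_mem,
      Ideal.map_span, Set.image_image]
    simp only [map_pow]
  rw [hki, isSMulRegular_quotient_iff_mem_of_smul_mem]
  intro m hm
  rw [hspan] at hm ⊢
  refine h N i m ?_
  rwa [Algebra.smul_def, map_pow] at hm

open MvPowerSeries in
/-- Existence of big Cohen–Macaulay modules in equal characteristic zero: a system of elements which
becomes a system of variables of a power series ring over which some `A`-algebra is integral and
faithful acts as a regular sequence on some module it does not generate. -/
theorem exists_module_hasRegularPowers {n : ℕ} {A K C : Type} [CommRing A] [Field K] [CharZero K]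
    [CommRing C] [Algebra (MvPowerSeries (Fin n) K) C]
    [Algebra.IsIntegral (MvPowerSeries (Fin n) K) C]
    (hinj : Function.Injective (algebraMap (MvPowerSeries (Fin n) K) C)) (τ : A →+* C)
    (a : Fin n → A) (ha : ∀ i, τ (a i) = algebraMap (MvPowerSeries (Fin n) K) C (X i)) :
    ∃ (M : Type) (_ : AddCommGroup M) (_ : Module A M), HasRegularPowers M (List.ofFn a) ∧
      Ideal.span (Set.range a) • (⊤ : Submodule A M) ≠ ⊤ := by
  have : Infinite C := .of_injective _
    (hinj.comp ((MvPowerSeries.C_injective (σ := Fin n) (R := K)).comp Nat.cast_injective))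
  obtain ⟨M, _, _, hreg, htop⟩ := exists_algebra_regular_of_approximations
    (fun i => algebraMap (MvPowerSeries (Fin n) K) C (X i)) fun s e => by
      obtain ⟨V, _, -, g, c, -, h⟩ := exists_almost_regular_approximation hinj s e
      exact ⟨V, _, g, c, h⟩
  let : Algebra A M := ((algebraMap C M).comp τ).toAlgebra
  have halg : ∀ i, algebraMap A M (a i) =
      algebraMap C M (algebraMap (MvPowerSeries (Fin n) K) C (X i)) := fun i =>
    congrArg (algebraMap C M) (ha i)
  refine ⟨M, inferInstance, inferInstance, hasRegularPowers_ofFn a ?_, fun h => htop ?_⟩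
  · simpa only [halg] using hreg
  · rw [Ideal.eq_top_iff_one]
    have h1 : (1 : M) ∈ Ideal.span (Set.range a) • (⊤ : Submodule A M) := by rw [h]; trivial
    rw [Ideal.smul_top_eq_map, Submodule.restrictScalars_mem, Ideal.map_span, ← Set.range_comp] at h1
    simpa only [Function.comp_def, halg] using h1

end BigCohenMacaulay

section Parameters

open IsLocalRing

theorem IsLocalRing.exists_pow_maximalIdeal_le_span {B : Type*} [CommRing B] [IsLocalRing B]
    [IsNoetherianRing B] {m : ℕ} (h : ringKrullDim B ≤ m) :
    ∃ a : Fin m → B, (∀ i, a i ∈ maximalIdeal B) ∧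
      ∃ t, maximalIdeal B ^ t ≤ Ideal.span (Set.range a) := by
  obtain ⟨s, hs, hcard⟩ := (maximalIdeal B).exists_finset_card_eq_height_of_isNoetherianRing
  have hle : s.card ≤ m := by
    rw [← maximalIdeal_height_eq_ringKrullDim, ← hcard] at h
    exact_mod_cast h
  have hsm : ∀ x ∈ s, x ∈ maximalIdeal B := fun x hx => hs.1.2 (Ideal.subset_span hx)
  let a : Fin m → B := fun i => if h : i.1 < s.card then s.equivFin.symm ⟨i.1, h⟩ else 0
  refine ⟨a, fun i => ?_, ?_⟩
  · by_cases h : i.1 < s.card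
    · simpa [a, h] using hsm _ (s.equivFin.symm ⟨i.1, h⟩).2
    · simp [a, h]
  · have hspan : Ideal.span (s : Set B) ≤ Ideal.span (Set.range a) := by
      rw [Ideal.span_le]
      intro x hx
      refine Ideal.subset_span ⟨⟨s.equivFin ⟨x, hx⟩, lt_of_lt_of_le (Fin.is_lt _) hle⟩, ?_⟩
      simp [a]
    have hrad : maximalIdeal B ≤ (Ideal.span (s : Set B)).radical := by
      rw [Ideal.radical_eq_sInf]
      refine le_sInf fun P ⟨hP, hPp⟩ => ?_
      exact hs.2 ⟨hPp, hP⟩ (le_maximalIdeal hPp.ne_top)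
    obtain ⟨t, ht⟩ := Ideal.exists_pow_le_of_le_radical_of_fg hrad
      (IsNoetherian.noetherian (maximalIdeal B))
    exact ⟨t, ht.trans hspan⟩

theorem IsLocalRing.ringKrullDim_le_of_pow_maximalIdeal_le_span {B : Type*} [CommRing B]
    [IsLocalRing B] [IsNoetherianRing B] {m : ℕ} (a : Fin m → B) (ha : ∀ i, a i ∈ maximalIdeal B)
    {t : ℕ} (ht : maximalIdeal B ^ t ≤ Ideal.span (Set.range a)) : ringKrullDim B ≤ m := by
  have hmin : maximalIdeal B ∈ (Ideal.span (Set.range a)).minimalPrimes := by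
    refine ⟨⟨inferInstance, ?_⟩, fun P ⟨hP, hle⟩ _ => ?_⟩
    · rw [Ideal.span_le]
      rintro _ ⟨i, rfl⟩
      exact ha i
    · exact hP.le_of_pow_le (ht.trans hle)
  have h := Ideal.height_le_card_of_mem_minimalPrimes_span (Set.finite_range a) hmin
  have hm : (Set.range a).ncard ≤ m := by
    rw [← Set.image_univ]
    simpa using Set.ncard_image_le (f := a) (s := Set.univ)
  rw [← maximalIdeal_height_eq_ringKrullDim]
  exact_mod_cast h.trans (by exact_mod_cast hm)

end Parameters

section Completion

open IsLocalRing

theorem Submodule.pi_mem_smul_top {R : Type*} [CommRing R] (I : Ideal R) {r : ℕ} {x : Fin r → R} :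
    x ∈ I • (⊤ : Submodule R (Fin r → R)) ↔ ∀ i, x i ∈ I := by
  constructor
  · intro h i
    have := Submodule.mem_map_of_mem (f := LinearMap.proj (R := R) (φ := fun _ : Fin r => R) i) h
    rw [Submodule.map_smul''] at this
    have h2 := (smul_mono_right I (le_top (a := Submodule.map (LinearMap.proj i) ⊤))) this
    simpa using h2
  · intro h
    rw [pi_eq_sum_univ x]
    exact Submodule.sum_mem _ fun i _ => Submodule.smul_mem_smul (h i) trivial

theorem IsPrecomplete.pi {R : Type*} [CommRing R] (I : Ideal R) [IsPrecomplete I R] (r : ℕ) :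
    IsPrecomplete I (Fin r → R) := by
  refine ⟨fun f hf => ?_⟩
  have h : ∀ i, ∃ L : R, ∀ n, f n i ≡ L [SMOD (I ^ n • ⊤ : Submodule R R)] := fun i =>
    IsPrecomplete.prec' (I := I) (fun n => f n i) fun {m n} hmn => by
      have := hf hmn
      rw [SModEq.sub_mem, Submodule.pi_mem_smul_top] at this
      rw [SModEq.sub_mem]
      simpa using this i
  choose L hL using h
  refine ⟨L, fun n => ?_⟩
  rw [SModEq.sub_mem, Submodule.pi_mem_smul_top]
  intro i
  have := hL i n
  rw [SModEq.sub_mem] at this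
  simpa using this

theorem exists_fg_sup_pow_eq_top {R S : Type*} [CommRing R] [CommRing S] [Algebra R S]
    (J : Ideal S) (hJ : J.FG) (hres : ∀ s : S, ∃ c : R, s - algebraMap R S c ∈ J) (t : ℕ) :
    ∃ F : Finset S, ∀ s : S, ∃ y ∈ Submodule.span R (F : Set S), s - y ∈ J ^ t := by
  induction t with
  | zero => exact ⟨∅, fun s => ⟨0, zero_mem _, by simp⟩⟩
  | succ t ih =>
    classical
    obtain ⟨F, hF⟩ := ih
    obtain ⟨G, hG⟩ := Ideal.FG.pow (n := t) hJ
    have key : ∀ s ∈ J ^ t, ∃ y ∈ Submodule.span R (G : Set S), s - y ∈ J ^ (t + 1) := by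
      have hGJ : Submodule.span R (G : Set S) ≤ (J ^ t).restrictScalars R := by
        rw [Submodule.span_le]
        intro x hx
        change x ∈ J ^ t
        rw [← hG]; exact Submodule.subset_span hx
      intro s hs
      rw [← hG] at hs
      induction hs using Submodule.span_induction with
      | mem x hx => exact ⟨x, Submodule.subset_span hx, by simp⟩
      | zero => exact ⟨0, zero_mem _, by simp⟩
      | add x x' _ _ h h' =>
        obtain ⟨y, hy, hxy⟩ := h
        obtain ⟨y', hy', hxy'⟩ := h'
        exact ⟨y + y', add_mem hy hy', by
          rw [add_sub_add_comm]; exact add_mem hxy hxy'⟩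
      | smul s x _ h =>
        obtain ⟨y, hy, hxy⟩ := h
        obtain ⟨c, hc⟩ := hres s
        refine ⟨c • y, Submodule.smul_mem _ _ hy, ?_⟩
        have : s • x - c • y = s * (x - y) + (s - algebraMap R S c) * y := by
          rw [smul_eq_mul, Algebra.smul_def]; ring
        rw [this]
        refine add_mem (Ideal.mul_mem_left _ _ hxy) ?_
        rw [pow_succ']
        exact Ideal.mul_mem_mul hc (hGJ hy)
    refine ⟨F ∪ G, fun s => ?_⟩
    obtain ⟨y, hy, hsy⟩ := hF s
    obtain ⟨z, hz, hyz⟩ := key _ hsy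
    refine ⟨y + z, add_mem (Submodule.span_mono (by simp) hy) (Submodule.span_mono (by simp) hz), ?_⟩
    rwa [← sub_sub]

theorem Module.Finite.of_isAdicComplete {R S : Type*} [CommRing R] [CommRing S] [Algebra R S]
    (I : Ideal R) [IsPrecomplete I R] (J : Ideal S) [IsHausdorff J S] (hJ : J.FG)
    (hres : ∀ s : S, ∃ c : R, s - algebraMap R S c ∈ J) (hI : I.map (algebraMap R S) ≤ J)
    {t : ℕ} (ht : J ^ t ≤ I.map (algebraMap R S)) : Module.Finite R S := by
  obtain ⟨F, hF⟩ := exists_fg_sup_pow_eq_top (R := R) J hJ hres t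
  have hhaus : IsHausdorff I S := by
    refine ⟨fun x hx => IsHausdorff.haus ‹IsHausdorff J S› x fun n => ?_⟩
    have := hx n
    rw [SModEq.zero] at this ⊢
    rw [smul_eq_mul, Ideal.mul_top]
    have h2 : (I ^ n • ⊤ : Submodule R S) ≤ (J ^ n).restrictScalars R := by
      rw [Submodule.smul_le]
      intro r hr s _
      rw [Algebra.smul_def]
      refine Ideal.mul_mem_right _ _ (Ideal.pow_right_mono hI n ?_)
      rw [← Ideal.map_pow]
      exact Ideal.mem_map_of_mem _ hr
    exact h2 this
  have := IsPrecomplete.pi I F.card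
  let f : (Fin F.card → R) →ₗ[R] S := Fintype.linearCombination R fun i => (F.equivFin.symm i : S)
  have hf : Function.Surjective (Submodule.mkQ (I • ⊤) ∘ₗ f) := by
    intro z
    obtain ⟨s, rfl⟩ := Submodule.mkQ_surjective _ z
    obtain ⟨y, hy, hsy⟩ := hF s
    have hr : LinearMap.range f = Submodule.span R (F : Set S) := by
      rw [Fintype.range_linearCombination]
      congr 1
      ext x
      constructor
      · rintro ⟨i, rfl⟩; exact (F.equivFin.symm i).2
      · intro hx; exact ⟨F.equivFin ⟨x, hx⟩, by simp⟩
    rw [← hr] at hy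
    obtain ⟨w, rfl⟩ := hy
    refine ⟨w, ?_⟩
    rw [LinearMap.comp_apply, Submodule.mkQ_apply, Submodule.mkQ_apply, Submodule.Quotient.eq,
      ← neg_mem_iff, neg_sub]
    have h1 := ht hsy
    have h2 : I • (⊤ : Submodule R S) = (I.map (algebraMap R S)).restrictScalars R :=
      Ideal.smul_top_eq_map I
    rw [h2]
    exact h1
  exact Module.Finite.of_surjective f (surjective_of_mkQ_comp_surjective hf)

theorem AdicCompletion.factorPow_evalₐ {R : Type*} [CommRing R] (I : Ideal R) {m n : ℕ}
    (h : m ≤ n) (x : AdicCompletion I R) :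
    Ideal.Quotient.factorPow I h (evalₐ I n x) = evalₐ I m x := by
  induction x using AdicCompletion.induction_on with
  | _ b =>
    rw [evalₐ_mk, evalₐ_mk]
    change Ideal.Quotient.mk _ _ = _
    have := b.2 h
    rw [SModEq.sub_mem, smul_eq_mul, Ideal.mul_top] at this
    exact (Ideal.Quotient.eq.2 this).symm

theorem MvPowerSeries.exists_ringHom {K S : Type*} [Field K] [CommRing S] {n : ℕ} (J : Ideal S)
    [IsAdicComplete J S] (g : K →+* S) (a : Fin n → S) (ha : ∀ i, a i ∈ J) :
    ∃ φ : MvPowerSeries (Fin n) K →+* S, (∀ i, φ (X i) = a i) ∧ ∀ c, φ (C c) = g c := by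
  let I := MvPolynomial.idealOfVars (Fin n) K
  let e : MvPolynomial (Fin n) K →+* S := MvPolynomial.eval₂Hom g a
  have hI : I ≤ J.comap e := by
    simp only [I, MvPolynomial.idealOfVars]
    rw [Ideal.span_le]
    rintro _ ⟨i, rfl⟩
    simpa [e] using ha i
  have hIm : ∀ m, I ^ m ≤ (J ^ m).comap e := fun m =>
    (Ideal.pow_right_mono hI m).trans (Ideal.le_comap_pow _ _)
  let f : ∀ m, MvPowerSeries (Fin n) K →+* S ⧸ J ^ m := fun m =>
    ((Ideal.quotientMap (J ^ m) e (hIm m)).comp (AdicCompletion.evalₐ I m).toRingHom).comp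
      (toAdicCompletionAlgEquiv (Fin n) K).toRingEquiv.toRingHom
  have hf : ∀ {m k : ℕ} (hle : m ≤ k), (Ideal.Quotient.factorPow J hle).comp (f k) = f m := by
    intro m k hle
    ext x
    obtain ⟨y, hy⟩ := Ideal.Quotient.mk_surjective
      (AdicCompletion.evalₐ I k (toAdicCompletionAlgEquiv (Fin n) K x))
    have h2 : Ideal.Quotient.mk (I ^ m) y =
        AdicCompletion.evalₐ I m (toAdicCompletionAlgEquiv (Fin n) K x) := by
      rw [← AdicCompletion.factorPow_evalₐ I hle, ← hy]
      rfl
    simp only [f, RingHom.comp_apply]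
    change Ideal.Quotient.factorPow J hle (Ideal.quotientMap (J ^ k) e (hIm k)
      (AdicCompletion.evalₐ I k (toAdicCompletionAlgEquiv (Fin n) K x))) =
      Ideal.quotientMap (J ^ m) e (hIm m)
      (AdicCompletion.evalₐ I m (toAdicCompletionAlgEquiv (Fin n) K x))
    rw [← hy, ← h2]
    rfl
  let φ := IsAdicComplete.liftRingHom J f hf
  have hφ : ∀ p : MvPolynomial (Fin n) K, φ (p : MvPowerSeries (Fin n) K) = e p := by
    intro p
    rw [← sub_eq_zero]
    refine IsHausdorff.haus (IsAdicComplete.toIsHausdorff (I := J) (M := S)) _ fun m => ?_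
    rw [SModEq.zero, smul_eq_mul, Ideal.mul_top, ← Ideal.Quotient.eq]
    rw [IsAdicComplete.mk_liftRingHom]
    change Ideal.quotientMap (J ^ m) e (hIm m)
      (AdicCompletion.evalₐ I m (toAdicCompletion (Fin n) K p)) = _
    rw [toAdicCompletion_coe, AdicCompletion.evalₐ_of]
    rfl
  refine ⟨φ, fun i => ?_, fun c => ?_⟩
  · rw [← MvPolynomial.coe_X, hφ]; simp [e]
  · rw [← MvPolynomial.coe_C, hφ]; simp [e]

end Completion

section FiniteCoverOfCompletion

open IsLocalRing

theorem exists_pow_maximalIdeal_le_span_of_completion {A : Type*} [CommRing A] [IsLocalRing A]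
    [IsNoetherianRing A] {m T : ℕ} (y : Fin m → AdicCompletion (maximalIdeal A) A)
    (hy : ∀ i, y i ∈ maximalIdeal (AdicCompletion (maximalIdeal A) A))
    (hT : maximalIdeal (AdicCompletion (maximalIdeal A) A) ^ T ≤ Ideal.span (Set.range y)) :
    ∃ b : Fin m → A, (∀ i, b i ∈ maximalIdeal A) ∧ maximalIdeal A ^ T ≤ Ideal.span (Set.range b) := by
  let ε := AdicCompletion.evalₐ (maximalIdeal A) (T + 1)
  have hε : ∀ x : A, ε (algebraMap A _ x) = Ideal.Quotient.mk (maximalIdeal A ^ (T + 1)) x :=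
    fun x => ε.commutes x
  choose b hb using fun i => Ideal.Quotient.mk_surjective (ε (y i))
  have hεm : (maximalIdeal A).map (algebraMap A (AdicCompletion (maximalIdeal A) A)) ≤
      ((maximalIdeal A).map (Ideal.Quotient.mk (maximalIdeal A ^ (T + 1)))).comap ε := by
    rw [Ideal.map_le_iff_le_comap]
    intro x hx
    rw [Ideal.mem_comap, Ideal.mem_comap, hε]
    exact Ideal.mem_map_of_mem _ hx
  refine ⟨b, fun i => ?_, ?_⟩
  · have h1 := hy i
    rw [AdicCompletion.maximalIdeal_eq_map] at h1
    have h2 := hεm h1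
    rw [Ideal.mem_comap, ← hb] at h2
    rw [Ideal.mem_quotient_iff_mem (Ideal.pow_le_self (Nat.succ_ne_zero T))] at h2
    exact h2
  · refine Submodule.le_of_le_smul_of_le_jacobson_bot (I := maximalIdeal A)
      (IsNoetherian.noetherian _) (maximalIdeal_le_jacobson _) ?_
    intro x hx
    have h1 : algebraMap A (AdicCompletion (maximalIdeal A) A) x ∈ Ideal.span (Set.range y) := by
      apply hT
      rw [AdicCompletion.maximalIdeal_eq_map, ← Ideal.map_pow]
      exact Ideal.mem_map_of_mem _ hx
    have h2 := Ideal.mem_map_of_mem ε h1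
    rw [hε, Ideal.map_span, ← Set.range_comp,
      show ε ∘ y = Ideal.Quotient.mk (maximalIdeal A ^ (T + 1)) ∘ b from funext fun i => (hb i).symm,
      Set.range_comp, ← Ideal.map_span, Ideal.mem_quotient_iff_mem_sup] at h2
    rwa [smul_eq_mul, ← pow_succ']

theorem MvPowerSeries.exists_pow_maximalIdeal_le_span_sup {K : Type*} [Field K] {n : ℕ}
    {f : MvPowerSeries (Fin n) K} (hf : f ≠ 0) (hu : ¬ IsUnit f) :
    ∃ m < n, ∃ y : Fin m → MvPowerSeries (Fin n) K, (∀ i, y i ∈ maximalIdeal _) ∧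
      ∃ t, maximalIdeal (MvPowerSeries (Fin n) K) ^ t ≤
        Ideal.span (Set.range y) ⊔ Ideal.span {f} := by
  have hdim : ringKrullDim (MvPowerSeries (Fin n) K) ≤ n := by
    refine ringKrullDim_le_of_pow_maximalIdeal_le_span X (fun i => ?_) (t := 1) ?_
    · rw [maximalIdeal_eq_span_range_X]; exact Ideal.subset_span ⟨i, rfl⟩
    · rw [pow_one, maximalIdeal_eq_span_range_X]
  have hle := (ringKrullDim_quotient_succ_le_of_nonZeroDivisor
    (mem_nonZeroDivisors_of_ne_zero hf)).trans hdim
  have hnt : Nontrivial (MvPowerSeries (Fin n) K ⧸ Ideal.span {f}) :=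
    Ideal.Quotient.nontrivial_iff.2 (by rwa [Ne, Ideal.span_singleton_eq_top])
  have hloc : IsLocalRing (MvPowerSeries (Fin n) K ⧸ Ideal.span {f}) :=
    IsLocalRing.of_surjective' (Ideal.Quotient.mk _) Ideal.Quotient.mk_surjective
  have h0 := ringKrullDim_nonneg_of_nontrivial (R := MvPowerSeries (Fin n) K ⧸ Ideal.span {f})
  obtain ⟨m, rfl⟩ : ∃ m, n = m + 1 := by
    refine Nat.exists_eq_succ_of_ne_zero ?_
    rintro rfl
    have h1 := (add_le_add_left h0 1).trans hle
    exact absurd h1 (by simp)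
  have hm : ringKrullDim (MvPowerSeries (Fin (m + 1)) K ⧸ Ideal.span {f}) ≤ m := by
    push_cast at hle
    exact ENat.WithBot.add_le_add_one_right_iff.1 hle
  obtain ⟨y, hy, t, ht⟩ := exists_pow_maximalIdeal_le_span hm
  choose z hz using fun i => Ideal.Quotient.mk_surjective (y i)
  refine ⟨m, Nat.lt_succ_self m, z, fun i hi => hy i ?_, t, fun x hx => ?_⟩
  · rw [← hz]; exact hi.map _
  · rw [← Ideal.mem_quotient_iff_mem_sup, Ideal.map_span, ← Set.range_comp,
      show (Ideal.Quotient.mk (Ideal.span {f})) ∘ z = y from funext hz]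
    apply ht
    have h1 := Ideal.mem_map_of_mem (Ideal.Quotient.mk (Ideal.span {f})) hx
    rw [Ideal.map_pow] at h1
    refine Ideal.pow_right_mono ?_ t h1
    rw [Ideal.map_le_iff_le_comap]
    intro w hw
    rw [Ideal.mem_comap]
    exact fun hwu => hw ((IsLocalHom.of_surjective (Ideal.Quotient.mk (Ideal.span {f}))
      Ideal.Quotient.mk_surjective).map_nonunit _ hwu)

theorem Algebra.FormallySmooth.of_charZero (k L : Type*) [Field k] [Field L] [Algebra k L]
    [CharZero k] : Algebra.FormallySmooth k L := by
  obtain ⟨s, hs⟩ := exists_isTranscendenceBasis k L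
  have := hs.isAlgebraic_field
  have : CharZero L := charZero_of_injective_algebraMap (algebraMap k L).injective
  exact .of_algebraicIndependent_of_isSeparable hs.1

theorem exists_coefficient_field (k A : Type*) [Field k] [CharZero k] [CommRing A] [IsLocalRing A]
    [IsNoetherianRing A] [Algebra k A] :
    ∃ g : ResidueField A →+* AdicCompletion (maximalIdeal A) A,
      ∀ s, ∃ c, s - g c ∈ maximalIdeal (AdicCompletion (maximalIdeal A) A) := by
  have := Algebra.FormallySmooth.of_charZero k (ResidueField A)
  obtain ⟨g, hg⟩ := Algebra.FormallySmooth.exists_adicCompletionEvalOneₐ_comp_eq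
    (R := k) (A := ResidueField A) (S := A) (I := maximalIdeal A)
    (AlgHom.id k (ResidueField A))
  refine ⟨g, fun s => ⟨AdicCompletion.evalOneₐ (maximalIdeal A) s, ?_⟩⟩
  have h : AdicCompletion.evalOneₐ (maximalIdeal A)
      (s - g (AdicCompletion.evalOneₐ (maximalIdeal A) s)) = 0 := by
    rw [map_sub, sub_eq_zero]
    exact (DFunLike.congr_fun hg (AdicCompletion.evalOneₐ (maximalIdeal A) s)).symm
  intro hu
  exact not_isUnit_zero (h ▸ hu.map (AdicCompletion.evalOneₐ (maximalIdeal A)))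

theorem exists_finite_cover_of_completion {n : ℕ} (k : Type*) {A : Type} [Field k] [CharZero k]
    [CommRing A] [IsLocalRing A] [IsNoetherianRing A] [Algebra k A] (hdim : ringKrullDim A = n) :
    ∃ (K : Type) (_ : Field K) (_ : CharZero K) (C : Type) (_ : CommRing C)
      (_ : Algebra (MvPowerSeries (Fin n) K) C) (τ : A →+* C) (a : Fin n → A),
      Algebra.IsIntegral (MvPowerSeries (Fin n) K) C ∧
      Function.Injective (algebraMap (MvPowerSeries (Fin n) K) C) ∧
      (∀ i, τ (a i) = algebraMap (MvPowerSeries (Fin n) K) C (MvPowerSeries.X i)) ∧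
      (∀ i, a i ∈ maximalIdeal A) ∧ ∃ t, maximalIdeal A ^ t ≤ Ideal.span (Set.range a) := by
  obtain ⟨a, ha, t, ht⟩ := exists_pow_maximalIdeal_le_span hdim.le
  obtain ⟨g, hg⟩ := exists_coefficient_field k A
  have hchar : CharZero (ResidueField A) :=
    charZero_of_injective_algebraMap (algebraMap k (ResidueField A)).injective
  have haJ : ∀ i, algebraMap A (AdicCompletion (maximalIdeal A) A) (a i) ∈
      maximalIdeal (AdicCompletion (maximalIdeal A) A) := fun i => by
    rw [AdicCompletion.maximalIdeal_eq_map]; exact Ideal.mem_map_of_mem _ (ha i)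
  obtain ⟨φ, hφX, hφC⟩ := MvPowerSeries.exists_ringHom _ g _ haJ
  have hφm : (maximalIdeal (MvPowerSeries (Fin n) (ResidueField A))).map φ =
      (Ideal.span (Set.range a)).map (algebraMap A (AdicCompletion (maximalIdeal A) A)) := by
    rw [MvPowerSeries.maximalIdeal_eq_span_range_X, Ideal.map_span, Ideal.map_span,
      ← Set.range_comp, ← Set.range_comp]
    congr 2
    exact funext hφX
  have hφJ : (maximalIdeal (MvPowerSeries (Fin n) (ResidueField A))).map φ ≤
      maximalIdeal (AdicCompletion (maximalIdeal A) A) := by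
    rw [hφm, AdicCompletion.maximalIdeal_eq_map]
    refine Ideal.map_mono ?_
    rw [Ideal.span_le]
    rintro _ ⟨i, rfl⟩
    exact ha i
  have hJφ : maximalIdeal (AdicCompletion (maximalIdeal A) A) ^ t ≤
      (maximalIdeal (MvPowerSeries (Fin n) (ResidueField A))).map φ := by
    rw [hφm, AdicCompletion.maximalIdeal_eq_map, ← Ideal.map_pow]
    exact Ideal.map_mono ht
  let alg : Algebra (MvPowerSeries (Fin n) (ResidueField A))
    (AdicCompletion (maximalIdeal A) A) := φ.toAlgebra
  refine ⟨ResidueField A, inferInstance, hchar, AdicCompletion (maximalIdeal A) A, inferInstance,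
    alg, algebraMap A _, a, ?_, ?_, fun i => (hφX i).symm, ha, t, ht⟩
  · have hfin : Module.Finite (MvPowerSeries (Fin n) (ResidueField A))
        (AdicCompletion (maximalIdeal A) A) := by
      refine Module.Finite.of_isAdicComplete (maximalIdeal _) (maximalIdeal _) ?_ ?_ hφJ hJφ
      · rw [AdicCompletion.maximalIdeal_eq_map]
        exact Ideal.FG.map (IsNoetherian.noetherian (maximalIdeal A)) _
      · intro s
        obtain ⟨c, hc⟩ := hg s
        exact ⟨MvPowerSeries.C c, by rw [← hφC] at hc; exact hc⟩
    exact Algebra.IsIntegral.of_finite _ _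
  · change Function.Injective φ
    rw [injective_iff_map_eq_zero]
    intro f hf
    by_contra hf0
    obtain ⟨m, hm, y, hy, t', ht'⟩ := MvPowerSeries.exists_pow_maximalIdeal_le_span_sup hf0
      fun hu => not_isUnit_zero (hf ▸ hu.map φ)
    have h1 : maximalIdeal (AdicCompletion (maximalIdeal A) A) ^ (t * t') ≤
        Ideal.span (Set.range (φ ∘ y)) := by
      rw [pow_mul]
      refine (Ideal.pow_right_mono hJφ t').trans ?_
      rw [← Ideal.map_pow]
      refine (Ideal.map_mono ht').trans ?_
      rw [Ideal.map_sup, Ideal.map_span, Ideal.map_span, ← Set.range_comp, Set.image_singleton, hf]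
      simp
    obtain ⟨b, hb, hbT⟩ := exists_pow_maximalIdeal_le_span_of_completion (φ ∘ y)
      (fun i => hφJ (Ideal.mem_map_of_mem _ (hy i))) h1
    have h2 := ringKrullDim_le_of_pow_maximalIdeal_le_span b hb hbT
    rw [hdim] at h2
    exact absurd hm (by exact_mod_cast not_lt.2 h2)

end FiniteCoverOfCompletion

section Descent

open TensorProduct RingTheory.Sequence IsLocalRing

section Tor

theorem lTensor_injective_of_presentation {A M P₂ P₁ P₀ N Q L : Type*} [CommRing A]
    [AddCommGroup M] [Module A M] [AddCommGroup P₂] [Module A P₂] [AddCommGroup P₁] [Module A P₁]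
    [AddCommGroup P₀] [Module A P₀] [Module.Projective A P₀] [AddCommGroup N] [Module A N]
    [AddCommGroup Q] [Module A Q] [AddCommGroup L] [Module A L]
    (d₁ : P₂ →ₗ[A] P₁) (d₀ : P₁ →ₗ[A] P₀) (π : P₀ →ₗ[A] L) (hd : d₀ ∘ₗ d₁ = 0)
    (hM : ∀ z : M ⊗[A] P₁, d₀.lTensor M z = 0 → ∃ y, d₁.lTensor M y = z)
    (hπ : Function.Exact d₀ π) (i : N →ₗ[A] Q) (ε : Q →ₗ[A] L) (hi : Function.Injective i)
    (hiε : Function.Exact i ε) (hε : Function.Surjective ε) (hπs : Function.Surjective π) :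
    Function.Injective (i.lTensor M) := by
  obtain ⟨φ, hφ⟩ := Module.projective_lifting_property ε π hε
  have hφ' (p : P₀) : ε (φ p) = π p := LinearMap.congr_fun hφ p
  have hmem (p : P₁) : φ (d₀ p) ∈ LinearMap.range i := by
    refine (hiε _).1 ?_
    rw [hφ', hπ.apply_apply_eq_zero]
  let e := LinearEquiv.ofInjective i hi
  let ψ : P₁ →ₗ[A] N := e.symm.toLinearMap ∘ₗ (φ ∘ₗ d₀).codRestrict _ hmem
  have hψ (p : P₁) : i (ψ p) = φ (d₀ p) :=
    congrArg Subtype.val (e.apply_symm_apply ((φ ∘ₗ d₀).codRestrict _ hmem p))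
  have hψd : ψ ∘ₗ d₁ = 0 := by
    refine LinearMap.ext fun p => hi ?_
    rw [LinearMap.comp_apply, hψ, show d₀ (d₁ p) = 0 from LinearMap.congr_fun hd p]
    simp
  let f : P₁ →ₗ[A] P₀ × N := d₀.prod (-ψ)
  let g : P₀ × N →ₗ[A] Q := φ.coprod i
  have hg : Function.Surjective g := by
    intro q
    obtain ⟨p, hp⟩ := hπs (ε q)
    obtain ⟨m, hm⟩ := (hiε (q - φ p)).1 (by rw [map_sub, hφ', hp, sub_self])
    exact ⟨(p, m), by simp [g, hm]⟩
  have hfg : Function.Exact f g := by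
    rintro ⟨p, m⟩
    constructor
    · intro h
      have h' : φ p + i m = 0 := h
      have hp : π p = 0 := by
        rw [← hφ', eq_neg_of_add_eq_zero_left h', map_neg, hiε.apply_apply_eq_zero, neg_zero]
      obtain ⟨r, rfl⟩ := (hπ p).1 hp
      refine ⟨r, Prod.ext rfl (hi ?_)⟩
      change i (-ψ r) = i m
      rw [map_neg, hψ, ← eq_neg_of_add_eq_zero_right h']
    · rintro ⟨r, hr⟩
      obtain ⟨rfl, rfl⟩ := Prod.ext_iff.1 hr
      change φ (d₀ r) + i (-ψ r) = 0
      rw [map_neg, hψ, add_neg_cancel]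
  rw [← LinearMap.ker_eq_bot, LinearMap.ker_eq_bot']
  intro τ hτ
  have h0 : g.lTensor M ((LinearMap.inr A P₀ N).lTensor M τ) = 0 := by
    rw [← LinearMap.comp_apply, ← LinearMap.lTensor_comp, LinearMap.coprod_inr, hτ]
  obtain ⟨y, hy⟩ := (lTensor_exact M hfg hg _).1 h0
  have h1 := congrArg ((LinearMap.fst A P₀ N).lTensor M) hy
  have h2 := congrArg ((LinearMap.snd A P₀ N).lTensor M) hy
  rw [← LinearMap.comp_apply, ← LinearMap.comp_apply, ← LinearMap.lTensor_comp,
    ← LinearMap.lTensor_comp] at h1 h2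
  rw [LinearMap.fst_prod, LinearMap.fst_comp_inr, LinearMap.lTensor_zero] at h1
  rw [LinearMap.snd_prod, LinearMap.snd_comp_inr, LinearMap.lTensor_id, LinearMap.id_apply,
    LinearMap.lTensor_neg] at h2
  obtain ⟨w, rfl⟩ := hM y h1
  rw [← h2, LinearMap.neg_apply, ← LinearMap.comp_apply, ← LinearMap.lTensor_comp, hψd]
  simp

variable {A : Type} [CommRing A] [IsLocalRing A]

theorem exists_exact_of_smul_mem_range {N Q : Type*} [AddCommGroup N] [Module A N]
    [AddCommGroup Q] [Module A Q] (i : N →ₗ[A] Q) (b : Q) (hb : b ∉ LinearMap.range i)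
    (hmb : ∀ c ∈ maximalIdeal A, c • b ∈ LinearMap.range i)
    (htop : LinearMap.range i ⊔ Submodule.span A {b} = ⊤) :
    ∃ ε : Q →ₗ[A] A ⧸ maximalIdeal A, Function.Exact i ε ∧ Function.Surjective ε ∧ ε b = 1 := by
  let f : A →ₗ[A] Q ⧸ LinearMap.range i := LinearMap.toSpanSingleton A _ (Submodule.Quotient.mk b)
  have hker : maximalIdeal A = LinearMap.ker f := by
    refine le_antisymm (fun c hc => (Submodule.Quotient.mk_eq_zero _).2 (hmb c hc)) ?_
    refine IsLocalRing.le_maximalIdeal fun h => hb ((Submodule.Quotient.mk_eq_zero _).1 ?_)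
    have : (1 : A) ∈ LinearMap.ker f := by rw [h]; trivial
    simpa [f] using this
  have hsurj : Function.Surjective f := by
    intro q
    obtain ⟨q, rfl⟩ := Submodule.Quotient.mk_surjective _ q
    have hq : q ∈ LinearMap.range i ⊔ Submodule.span A {b} := by rw [htop]; trivial
    obtain ⟨y, hy, z, hz, rfl⟩ := Submodule.mem_sup.1 hq
    obtain ⟨c, rfl⟩ := Submodule.mem_span_singleton.1 hz
    refine ⟨c, ?_⟩
    rw [Submodule.Quotient.mk_add, (Submodule.Quotient.mk_eq_zero _).2 hy, zero_add]
    rfl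
  let e : (A ⧸ maximalIdeal A) ≃ₗ[A] Q ⧸ LinearMap.range i :=
    (Submodule.quotEquivOfEq _ _ hker).trans (f.quotKerEquivOfSurjective hsurj)
  refine ⟨e.symm.toLinearMap ∘ₗ (LinearMap.range i).mkQ, ?_, ?_, ?_⟩
  · rw [LinearMap.exact_iff, LinearEquiv.ker_comp, Submodule.ker_mkQ]
  · exact e.symm.surjective.comp (Submodule.mkQ_surjective _)
  · refine (e.symm_apply_eq).2 ?_
    change _ = f 1
    simp [f]

theorem exists_mul_notMem_and_forall_mul_mem {J : Ideal A} {t : ℕ} (ht : maximalIdeal A ^ t ≤ J)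
    {a : A} (ha : a ∉ J) : ∃ c, c * a ∉ J ∧ ∀ m ∈ maximalIdeal A, m * (c * a) ∈ J := by
  classical
  have hex : ∃ r, ∀ c ∈ maximalIdeal A ^ r, c * a ∈ J :=
    ⟨t, fun c hc => J.mul_mem_right _ (ht hc)⟩
  obtain ⟨r, hr⟩ : ∃ r, Nat.find hex = r + 1 := by
    refine Nat.exists_eq_succ_of_ne_zero fun h => ha ?_
    have := Nat.find_spec hex
    rw [h] at this
    simpa using this 1 (by simp)
  have := Nat.find_min hex (m := r) (by omega)
  push Not at this
  obtain ⟨c, hc, hca⟩ := this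
  refine ⟨c, hca, fun m hm => ?_⟩
  rw [← mul_assoc]
  have hs := Nat.find_spec hex
  rw [hr] at hs
  exact hs _ (by rw [pow_succ']; exact Ideal.mul_mem_mul hm hc)

theorem exists_exact_inclusion_sup_span {J : Ideal A} {b : A} (hb : b ∉ J)
    (hmb : ∀ m ∈ maximalIdeal A, m * b ∈ J) :
    ∃ ε : ↥(J ⊔ Ideal.span {b}) →ₗ[A] A ⧸ maximalIdeal A,
      Function.Exact (Submodule.inclusion (le_sup_left : J ≤ J ⊔ Ideal.span {b})) ε ∧
        Function.Surjective ε ∧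
        ε ⟨b, Ideal.mem_sup_right (Ideal.mem_span_singleton_self b)⟩ = 1 := by
  apply exists_exact_of_smul_mem_range
  · rintro ⟨y, hy⟩
    have h : (y : A) = b := congrArg Subtype.val hy
    exact hb (h ▸ y.2)
  · exact fun c hc => ⟨⟨c * b, hmb c hc⟩, rfl⟩
  · rw [eq_top_iff]
    rintro ⟨q, hq⟩ -
    obtain ⟨y, hy, z, hz, rfl⟩ := Submodule.mem_sup.1 hq
    obtain ⟨c, rfl⟩ := Submodule.mem_span_singleton.1 hz
    exact Submodule.mem_sup.2 ⟨⟨y, _⟩, ⟨⟨y, hy⟩, rfl⟩, c • ⟨b, _⟩,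
      Submodule.smul_mem _ _ (Submodule.mem_span_singleton_self _), rfl⟩

variable [IsNoetherianRing A] (M : Type) [AddCommGroup M] [Module A M]

theorem lTensor_subtype_injective
    (hT : ∀ (N Q : Type) [AddCommGroup N] [Module A N] [AddCommGroup Q] [Module A Q]
      (i : N →ₗ[A] Q) (ε : Q →ₗ[A] A ⧸ maximalIdeal A), Function.Injective i →
      Function.Exact i ε → Function.Surjective ε → Function.Injective (i.lTensor M))
    {t : ℕ} (J : Ideal A) (hJ : maximalIdeal A ^ t ≤ J) :
    Function.Injective (J.subtype.lTensor M) := by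
  induction J using WellFoundedGT.induction with
  | ind J ih =>
    by_cases h1 : (1 : A) ∈ J
    · obtain rfl := (Ideal.eq_top_iff_one J).2 h1
      exact (LinearEquiv.lTensor M Submodule.topEquiv).injective
    · obtain ⟨c, hc, hm⟩ := exists_mul_notMem_and_forall_mul_mem hJ h1
      obtain ⟨ε, h1, h2, -⟩ := exists_exact_inclusion_sup_span hc hm
      have hlt : J < J ⊔ Ideal.span {c * 1} := lt_of_le_not_ge le_sup_left fun h =>
        hc (h (Ideal.mem_sup_right (Ideal.mem_span_singleton_self _)))
      have h3 := hT _ _ _ ε (Submodule.inclusion_injective _) h1 h2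
      have h4 := ih _ hlt (hJ.trans le_sup_left)
      have := h4.comp h3
      rw [← LinearMap.coe_comp, ← LinearMap.lTensor_comp, Submodule.subtype_comp_inclusion] at this
      exact this

theorem mem_of_forall_smul_mem
    (hT : ∀ (N Q : Type) [AddCommGroup N] [Module A N] [AddCommGroup Q] [Module A Q]
      (i : N →ₗ[A] Q) (ε : Q →ₗ[A] A ⧸ maximalIdeal A), Function.Injective i →
      Function.Exact i ε → Function.Surjective ε → Function.Injective (i.lTensor M))
    (hM : maximalIdeal A • (⊤ : Submodule A M) ≠ ⊤) {t : ℕ}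
    (J : Ideal A) (hJ : maximalIdeal A ^ t ≤ J) (a : A)
    (ha : ∀ m : M, a • m ∈ J • (⊤ : Submodule A M)) : a ∈ J := by
  by_contra haJ
  obtain ⟨c, hc, hm⟩ := exists_mul_notMem_and_forall_mul_mem hJ haJ
  obtain ⟨ε, h1, h2, h3⟩ := exists_exact_inclusion_sup_span hc hm
  have hinj := lTensor_subtype_injective M hT (J ⊔ Ideal.span {c * a}) (hJ.trans le_sup_left)
  have hrange (y : M) (hy : y ∈ J • (⊤ : Submodule A M)) :
      ∃ σ : M ⊗[A] J, J.subtype.lTensor M σ = y ⊗ₜ 1 := by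
    refine Submodule.smul_induction_on hy (fun r hr m _ => ⟨m ⊗ₜ ⟨r, hr⟩, ?_⟩) ?_
    · rw [LinearMap.lTensor_tmul, TensorProduct.smul_tmul]
      simp
    · rintro x y ⟨σ, hσ⟩ ⟨τ, hτ⟩
      exact ⟨σ + τ, by rw [map_add, hσ, hτ, TensorProduct.add_tmul]⟩
  refine hM (eq_top_iff.2 fun m _ => ?_)
  obtain ⟨σ, hσ⟩ := hrange ((c * a) • m) (by rw [mul_smul]; exact Submodule.smul_mem _ _ (ha m))
  have key : (Submodule.inclusion (le_sup_left : J ≤ J ⊔ Ideal.span {c * a})).lTensor M σ =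
      m ⊗ₜ ⟨c * a, Ideal.mem_sup_right (Ideal.mem_span_singleton_self _)⟩ := by
    apply hinj
    rw [← LinearMap.comp_apply, ← LinearMap.lTensor_comp, Submodule.subtype_comp_inclusion]
    refine hσ.trans ?_
    rw [LinearMap.lTensor_tmul, TensorProduct.smul_tmul]
    simp
  have h4 := congrArg (ε.lTensor M) key
  rw [LinearMap.lTensor_tmul, h3, ← LinearMap.comp_apply, ← LinearMap.lTensor_comp,
    h1.linearMap_comp_eq_zero, LinearMap.lTensor_zero, LinearMap.zero_apply] at h4
  have h5 := congrArg (TensorProduct.tensorQuotEquivQuotSMul M (maximalIdeal A)) h4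
  rw [map_zero, ← map_one (Ideal.Quotient.mk (maximalIdeal A)),
    TensorProduct.tensorQuotEquivQuotSMul_tmul_mk, one_smul] at h5
  exact (Submodule.Quotient.mk_eq_zero _).1 h5.symm

theorem isWeaklyRegular_self_of_isWeaklyRegular
    (hT : ∀ (N Q : Type) [AddCommGroup N] [Module A N] [AddCommGroup Q] [Module A Q]
      (i : N →ₗ[A] Q) (ε : Q →ₗ[A] A ⧸ maximalIdeal A), Function.Injective i →
      Function.Exact i ε → Function.Surjective ε → Function.Injective (i.lTensor M))
    (hM : maximalIdeal A • (⊤ : Submodule A M) ≠ ⊤)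
    {rs : List A} (hrs : IsWeaklyRegular M rs) : IsWeaklyRegular A rs := by
  refine ⟨fun i hi => ?_⟩
  have h := (isSMulRegular_quotient_iff_mem_of_smul_mem _ _).1 (hrs.regular_mod_prev i hi)
  refine (isSMulRegular_quotient_iff_mem_of_smul_mem _ _).2 fun a ha => ?_
  rw [smul_eq_mul, Ideal.mul_top] at ha ⊢
  set I := Ideal.ofList (rs.take i)
  have ha' (t : ℕ) : a ∈ I ⊔ maximalIdeal A ^ t := by
    refine mem_of_forall_smul_mem M hT hM _ le_sup_right a fun m => ?_
    refine Submodule.smul_mono_left le_sup_left (h _ ?_)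
    rw [smul_smul]
    exact Submodule.smul_mem_smul ha trivial
  by_cases hI : I = ⊤
  · rw [hI]; trivial
  have hK := Ideal.iInf_pow_smul_eq_bot_of_isLocalRing (M := A ⧸ I) (maximalIdeal A)
    (Ideal.IsPrime.ne_top inferInstance)
  rw [← Ideal.Quotient.eq_zero_iff_mem, ← Submodule.mem_bot A, ← hK, Submodule.mem_iInf]
  intro t
  obtain ⟨y, hy, z, hz, rfl⟩ := Submodule.mem_sup.1 (ha' t)
  rw [map_add, Ideal.Quotient.eq_zero_iff_mem.2 hy, zero_add, ← mul_one z, map_mul]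
  exact Submodule.smul_mem_smul hz (trivial : (1 : A ⧸ I) ∈ ⊤)

end Tor

end Descent

section FreeModules

open CategoryTheory IsLocalRing TensorProduct

universe u
theorem Module.free_of_hasProjectiveDimensionLT {A : Type u} [CommRing A] [IsLocalRing A]
    [IsNoetherianRing A] {s : A} (hs : s ≠ 0) (hsm : ∀ x ∈ maximalIdeal A, x * s = 0) (d : ℕ)
    (M : ModuleCat.{u} A) [Module.Finite A M] [h : HasProjectiveDimensionLT M d] :
    Module.Free A M := by
  induction d generalizing M with
  | zero =>
    have := ModuleCat.isZero_iff_subsingleton.mp ((hasProjectiveDimensionLT_zero_iff_isZero M).mp h)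
    infer_instance
  | succ d ih =>
    obtain _ | d := d
    · have := (IsProjective.iff_projective M).mpr (projective_iff_hasProjectiveDimensionLT_one.mpr h)
      exact Module.free_of_flat_of_isLocalRing
    obtain ⟨P, _, _, _, _, f, hf⟩ := Module.exists_finite_presentation A M
    have hS := LinearMap.shortExact_shortComplexKer hf
    have hK := (hS.hasProjectiveDimensionLT_X₃_iff d
      (ModuleCat.projective_of_categoryTheory_projective _)).mp h
    have : Module.Free A (LinearMap.ker f) := ih (ModuleCat.of A (LinearMap.ker f))
    let φ : ResidueField A →ₗ[A] A := Submodule.liftQ (maximalIdeal A)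
      (LinearMap.toSpanSingleton A A s) fun x hx => by simpa using hsm x hx
    have hφ : Function.Injective φ := by
      rw [← LinearMap.ker_eq_bot]
      apply Submodule.ker_liftQ_eq_bot
      intro x hx
      by_contra hx'
      rw [mem_maximalIdeal, mem_nonunits_iff, not_not] at hx'
      exact hs (by simpa [hx'.mul_right_eq_zero] using hx)
    refine Module.free_of_lTensor_residueField_injective (LinearMap.ker f).subtype f hf
      f.exact_subtype_ker_map ?_
    have h₁ : Function.Injective
        (φ.rTensor P ∘ₗ (LinearMap.ker f).subtype.lTensor (ResidueField A)) := by
      rw [LinearMap.rTensor_comp_lTensor, ← LinearMap.lTensor_comp_rTensor, LinearMap.coe_comp]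
      exact (Module.Flat.lTensor_preserves_injective_linearMap _
        (Submodule.injective_subtype _)).comp
        (Module.Flat.rTensor_preserves_injective_linearMap _ hφ)
    rw [LinearMap.coe_comp] at h₁
    exact h₁.of_comp

end FreeModules

section ChangeOfRings

open CategoryTheory IsLocalRing TensorProduct

universe u
theorem IsLocalRing.exists_mem_nonZeroDivisors_notMem_sq {A : Type u} [CommRing A] [IsLocalRing A]
    [IsNoetherianRing A] (h : ∀ s : A, (∀ x ∈ maximalIdeal A, x * s = 0) → s = 0) :
    ∃ x ∈ maximalIdeal A, x ∉ maximalIdeal A ^ 2 ∧ x ∈ nonZeroDivisors A := by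
  classical
  by_contra! hx
  have hfin := associatedPrimes.finite A A
  have hsub : (maximalIdeal A : Set A) ⊆
      ⋃ p ∈ ((insert (maximalIdeal A ^ 2) hfin.toFinset : Finset (Ideal A)) : Set (Ideal A)),
        (p : Set A) := by
    intro x hxm
    by_cases hx2 : x ∈ maximalIdeal A ^ 2
    · exact Set.mem_biUnion (by simp) hx2
    · have : x ∈ ⋃ p ∈ associatedPrimes A A, (p : Set A) := by
        rw [biUnion_associatedPrimes_eq_compl_nonZeroDivisors]
        exact hx x hxm hx2
      obtain ⟨p, hp, hxp⟩ := Set.mem_iUnion₂.mp this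
      exact Set.mem_biUnion (by simp [hp]) hxp
  obtain ⟨p, hp, hle⟩ := (Ideal.subset_union_prime (f := id) (maximalIdeal A ^ 2)
    (maximalIdeal A ^ 2) (fun p hp hne _ => by
      have : p ∈ associatedPrimes A A := by simpa [hne] using hp
      exact this.isPrime)).mp hsub
  rcases Finset.mem_insert.mp hp with rfl | hp
  · have hbot : maximalIdeal A = ⊥ := Submodule.eq_bot_of_le_smul_of_le_jacobson_bot
      (maximalIdeal A) (maximalIdeal A) (IsNoetherian.noetherian _)
      (by simpa [pow_two] using hle) (maximalIdeal_le_jacobson ⊥)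
    exact one_ne_zero (h 1 fun x hx => by simpa [hbot] using hx)
  · rw [Set.Finite.mem_toFinset] at hp
    obtain ⟨hp', s, hs⟩ := isAssociatedPrime_iff.mp hp
    have hs0 := h s fun x hx => by
      have := hle hx
      rwa [id, hs, Submodule.mem_colon_singleton, Submodule.mem_bot, smul_eq_mul] at this
    exact hp'.ne_top (by rw [hs, hs0]; simp)

theorem lTensor_quotient_subtype_ker_injective {A : Type*} [CommRing A] {P M : Type*}
    [AddCommGroup P] [Module A P] [AddCommGroup M] [Module A M] {x : A} (hx : IsSMulRegular M x)
    (f : P →ₗ[A] M) :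
    Function.Injective ((LinearMap.ker f).subtype.lTensor (A ⧸ Ideal.span {x})) := by
  rw [injective_iff_map_eq_zero]
  intro z hz
  obtain ⟨v, rfl⟩ := TensorProduct.mk_surjective A (LinearMap.ker f) (A ⧸ Ideal.span {x})
    Ideal.Quotient.mk_surjective z
  have h := congrArg (TensorProduct.quotTensorEquivQuotSMul P (Ideal.span {x})) hz
  rw [TensorProduct.mk_apply, LinearMap.lTensor_tmul, map_zero,
    ← map_one (Ideal.Quotient.mk (Ideal.span {x})), TensorProduct.quotTensorEquivQuotSMul_mk_tmul,
    one_smul, Submodule.Quotient.mk_eq_zero, Submodule.ideal_span_singleton_smul] at h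
  obtain ⟨p, -, hp⟩ := (Submodule.mem_smul_pointwise_iff_exists _ _ _).mp h
  have hpK : p ∈ LinearMap.ker f := by
    refine hx.right_eq_zero_of_smul ?_
    rw [← map_smul, hp]
    exact v.2
  have hv : v = x • ⟨p, hpK⟩ := Subtype.ext hp.symm
  have hx0 : x • (1 : A ⧸ Ideal.span {x}) = 0 := by
    rw [Algebra.smul_def, mul_one]
    exact Ideal.Quotient.eq_zero_iff_mem.mpr (Ideal.mem_span_singleton_self x)
  rw [TensorProduct.mk_apply, hv, ← TensorProduct.smul_tmul, hx0, TensorProduct.zero_tmul]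

theorem exists_shortExact_quotient {A : Type u} [CommRing A] {P M : Type u}
    [AddCommGroup P] [Module A P] [AddCommGroup M] [Module A M] {x : A} (hx : IsSMulRegular M x)
    (f : P →ₗ[A] M) (hf : Function.Surjective f) :
    ∃ S : ShortComplex (ModuleCat.{u} (A ⧸ Ideal.span {x})), S.ShortExact ∧
      S.X₁ = ModuleCat.of _ ((A ⧸ Ideal.span {x}) ⊗[A] LinearMap.ker f) ∧
      S.X₂ = ModuleCat.of _ ((A ⧸ Ideal.span {x}) ⊗[A] P) ∧
      S.X₃ = ModuleCat.of _ ((A ⧸ Ideal.span {x}) ⊗[A] M) := by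
  have hex := lTensor_exact (A ⧸ Ideal.span {x}) f.exact_subtype_ker_map hf
  refine ⟨ShortComplex.mk
    (ModuleCat.ofHom ((LinearMap.ker f).subtype.baseChange (A ⧸ Ideal.span {x})))
    (ModuleCat.ofHom (f.baseChange (A ⧸ Ideal.span {x}))) ?_,
    { exact := ?_, mono_f := ?_, epi_g := ?_ }, rfl, rfl, rfl⟩
  · rw [← ModuleCat.ofHom_comp, ← LinearMap.baseChange_comp, f.comp_ker_subtype,
      LinearMap.baseChange_zero, ModuleCat.ofHom_zero]
  · exact (ShortComplex.ShortExact.moduleCat_exact_iff_function_exact _).mpr hex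
  · exact (ModuleCat.mono_iff_injective _).mpr (lTensor_quotient_subtype_ker_injective hx f)
  · exact (ModuleCat.epi_iff_surjective _).mpr (LinearMap.lTensor_surjective _ hf)

theorem ModuleCat.hasProjectiveDimensionLT_quotient {A : Type u} [CommRing A] {x : A}
    (hxA : x ∈ nonZeroDivisors A) (d : ℕ) (M : ModuleCat.{u} A) (hx : IsSMulRegular M x)
    [h : HasProjectiveDimensionLT M d] :
    HasProjectiveDimensionLT
      (ModuleCat.of (A ⧸ Ideal.span {x}) ((A ⧸ Ideal.span {x}) ⊗[A] M)) d := by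
  induction d generalizing M with
  | zero =>
    have := ModuleCat.isZero_iff_subsingleton.mp
      ((hasProjectiveDimensionLT_zero_iff_isZero M).mp h)
    rw [hasProjectiveDimensionLT_zero_iff_isZero, ModuleCat.isZero_iff_subsingleton]
    exact inferInstanceAs (Subsingleton ((A ⧸ Ideal.span {x}) ⊗[A] M))
  | succ d ih =>
    obtain _ | d := d
    · have := (IsProjective.iff_projective M).mpr (projective_iff_hasProjectiveDimensionLT_one.mpr h)
      rw [zero_add, ← projective_iff_hasProjectiveDimensionLT_one]
      exact (IsProjective.iff_projective _).mp inferInstance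
    have hf := Finsupp.linearCombination_id_surjective A M
    generalize Finsupp.linearCombination A (id : M → M) = f at hf
    have hS := LinearMap.shortExact_shortComplexKer hf
    have hK := (hS.hasProjectiveDimensionLT_X₃_iff d
      (ModuleCat.projective_of_categoryTheory_projective _)).mp h
    have hKB := ih (ModuleCat.of A (LinearMap.ker f)) <|
      (Module.Flat.isSMulRegular_of_nonZeroDivisors hxA).submodule _ _
    obtain ⟨S, hSe, h₁, h₂, h₃⟩ := exists_shortExact_quotient hx f hf
    rw [← h₃, hSe.hasProjectiveDimensionLT_X₃_iff d (h₂ ▸ ModuleCat.projective_of_categoryTheory_projective _), h₁]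
    exact hKB

end ChangeOfRings

section FiniteProjectiveDimension

open CategoryTheory IsLocalRing TensorProduct

universe u

theorem exists_retraction_residueField_quotient {A : Type u} [CommRing A] [IsLocalRing A]
    [IsNoetherianRing A] {x : A} (hx : x ∈ maximalIdeal A) (hx2 : x ∉ maximalIdeal A ^ 2)
    [IsLocalRing (A ⧸ Ideal.span {x})] :
    ∃ (i : ResidueField (A ⧸ Ideal.span {x}) →ₗ[A ⧸ Ideal.span {x}]
        (A ⧸ Ideal.span {x}) ⊗[A] maximalIdeal A)
      (r : (A ⧸ Ideal.span {x}) ⊗[A] maximalIdeal A →ₗ[A ⧸ Ideal.span {x}]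
        ResidueField (A ⧸ Ideal.span {x})), r ∘ₗ i = LinearMap.id := by
  have hmax : ∀ a ∈ maximalIdeal A,
      algebraMap A (ResidueField (A ⧸ Ideal.span {x})) a = 0 := by
    intro a ha
    rw [IsScalarTower.algebraMap_apply A (A ⧸ Ideal.span {x})]
    refine (residue_eq_zero_iff _).mpr ?_
    have := IsLocalHom.of_surjective (algebraMap A (A ⧸ Ideal.span {x})) Ideal.Quotient.mk_surjective
    exact map_nonunit _ a ha
  let i : ResidueField (A ⧸ Ideal.span {x}) →ₗ[A ⧸ Ideal.span {x}]
      (A ⧸ Ideal.span {x}) ⊗[A] maximalIdeal A :=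
    Submodule.liftQ (maximalIdeal (A ⧸ Ideal.span {x}))
      (LinearMap.toSpanSingleton _ _ ((1 : A ⧸ Ideal.span {x}) ⊗ₜ[A] (⟨x, hx⟩ : maximalIdeal A))) <| by
    intro b hb
    obtain ⟨a, rfl⟩ := Ideal.Quotient.mk_surjective b
    have ha : a ∈ maximalIdeal A := by
      by_contra h
      rw [mem_maximalIdeal, mem_nonunits_iff, not_not] at h
      exact hb (h.map _)
    rw [LinearMap.mem_ker, LinearMap.toSpanSingleton_apply, TensorProduct.smul_tmul', smul_eq_mul,
      mul_one]
    have h₁ : Ideal.Quotient.mk (Ideal.span {x}) a = a • (1 : A ⧸ Ideal.span {x}) := by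
      rw [Algebra.smul_def, mul_one]; rfl
    have h₂ : a • (⟨x, hx⟩ : maximalIdeal A) = x • ⟨a, ha⟩ := Subtype.ext (mul_comm a x)
    have h₃ : x • (1 : A ⧸ Ideal.span {x}) = 0 := by
      rw [Algebra.smul_def, mul_one]
      exact Ideal.Quotient.eq_zero_iff_mem.mpr (Ideal.mem_span_singleton_self x)
    rw [h₁, TensorProduct.smul_tmul, h₂, ← TensorProduct.smul_tmul, h₃, TensorProduct.zero_tmul]
  have hxc : (maximalIdeal A).toCotangent ⟨x, hx⟩ ≠ 0 := by
    rwa [Ne, Ideal.toCotangent_eq_zero]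
  obtain ⟨f, hf⟩ := Module.Projective.exists_dual_eq_one (ResidueField A)
    (V := CotangentSpace A) hxc
  let g : ResidueField A →ₗ[A] ResidueField (A ⧸ Ideal.span {x}) :=
    Submodule.liftQ (maximalIdeal A) (Algebra.linearMap A _) fun a ha => hmax a ha
  have hg : g 1 = 1 := by
    refine (Submodule.liftQ_apply (maximalIdeal A) (Algebra.linearMap A
      (ResidueField (A ⧸ Ideal.span {x}))) 1).trans ?_
    simp
  let r := LinearMap.liftBaseChange (A ⧸ Ideal.span {x})
    (g ∘ₗ f.restrictScalars A ∘ₗ (maximalIdeal A).toCotangent)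
  refine ⟨i, r, LinearMap.ext fun y => ?_⟩
  obtain ⟨b, rfl⟩ := residue_surjective y
  have hi : i (residue _ b) = b • ((1 : A ⧸ Ideal.span {x}) ⊗ₜ[A] (⟨x, hx⟩ : maximalIdeal A)) :=
    Submodule.liftQ_apply _ _ _
  rw [LinearMap.comp_apply, hi, map_smul, LinearMap.liftBaseChange_tmul]
  simp only [LinearMap.comp_apply, LinearMap.restrictScalars_apply, hf, hg, one_smul]
  simp [Algebra.smul_def]

theorem hasProjectiveDimensionLT_maximalIdeal {A : Type u} [CommRing A] [IsLocalRing A] {d : ℕ}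
    (h : HasProjectiveDimensionLT (ModuleCat.of A (ResidueField A)) d) :
    HasProjectiveDimensionLT (ModuleCat.of A (maximalIdeal A)) (d + 1) := by
  have := hasProjectiveDimensionLT_of_ge (ModuleCat.of A (ResidueField A)) d (d + 2) (by lia)
  have hker : LinearMap.ker (Algebra.linearMap A (ResidueField A)) = maximalIdeal A := by
    ext a
    exact residue_eq_zero_iff a
  have hS := LinearMap.shortExact_shortComplexKer (f := Algebra.linearMap A (ResidueField A))
    residue_surjective
  rw [← hker]
  exact (hS.hasProjectiveDimensionLT_X₃_iff d
    (ModuleCat.projective_of_categoryTheory_projective _)).mp this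

theorem maximalIdeal_eq_bot_of_hasProjectiveDimensionLT {A : Type u} [CommRing A] [IsLocalRing A]
    [IsNoetherianRing A] {d : ℕ}
    (h : HasProjectiveDimensionLT (ModuleCat.of A (ResidueField A)) d) {s : A} (hs : s ≠ 0)
    (hsm : ∀ x ∈ maximalIdeal A, x * s = 0) : maximalIdeal A = ⊥ := by
  have : Module.Free A (ResidueField A) :=
    Module.free_of_hasProjectiveDimensionLT hs hsm d (ModuleCat.of A (ResidueField A))
  rw [eq_bot_iff, ← Module.annihilator_eq_bot.mpr
    (inferInstance : FaithfulSMul A (ResidueField A))]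
  intro x hx
  rw [Module.mem_annihilator]
  intro y
  rw [Algebra.smul_def, ResidueField.algebraMap_eq, (residue_eq_zero_iff x).mpr hx, zero_mul]

theorem exists_span_eq_maximalIdeal_of_quotient {A : Type u} [CommRing A] [IsLocalRing A] {x : A}
    [IsLocalRing (A ⧸ Ideal.span {x})] (t : Finset (A ⧸ Ideal.span {x}))
    (ht : Ideal.span (t : Set (A ⧸ Ideal.span {x})) = maximalIdeal (A ⧸ Ideal.span {x})) :
    ∃ t' : Finset A, t'.card ≤ t.card + 1 ∧ Ideal.span (t' : Set A) = maximalIdeal A := by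
  classical
  have hsurj := Ideal.Quotient.mk_surjective (I := Ideal.span {x})
  have hloc := IsLocalHom.of_surjective _ hsurj
  refine ⟨insert x (t.image (Function.surjInv hsurj)),
    (Finset.card_insert_le _ _).trans (by gcongr; exact Finset.card_image_le), ?_⟩
  have hmap : Ideal.map (Ideal.Quotient.mk (Ideal.span {x}))
      (Ideal.span ((t.image (Function.surjInv hsurj) : Finset A) : Set A)) =
      maximalIdeal (A ⧸ Ideal.span {x}) := by
    rw [Ideal.map_span, ← ht, Finset.coe_image, ← Set.image_comp]
    congr 1
    rw [show _ ∘ Function.surjInv hsurj = id from funext (Function.surjInv_eq hsurj), Set.image_id]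
  have hcomap : Ideal.comap (Ideal.Quotient.mk (Ideal.span {x}))
      (maximalIdeal (A ⧸ Ideal.span {x})) = maximalIdeal A :=
    maximalIdeal_comap _
  rw [← hcomap, ← hmap, Ideal.comap_map_of_surjective' _ hsurj, Ideal.mk_ker,
    ← Ideal.span_union, Set.union_singleton, Finset.coe_insert]

theorem exists_card_le_span_eq_maximalIdeal (n : ℕ) {A : Type u} [CommRing A] [IsLocalRing A]
    [IsNoetherianRing A] (hdim : ringKrullDim A = n) {d : ℕ}
    (h : HasProjectiveDimensionLT (ModuleCat.of A (ResidueField A)) d) :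
    ∃ t : Finset A, t.card ≤ n ∧ Ideal.span (t : Set A) = maximalIdeal A := by
  induction n using Nat.strong_induction_on generalizing A d with
  | _ n ih =>
    by_cases hs : ∀ s : A, (∀ x ∈ maximalIdeal A, x * s = 0) → s = 0
    · obtain ⟨x, hx, hx2, hreg⟩ := IsLocalRing.exists_mem_nonZeroDivisors_notMem_sq hs
      have : Nontrivial (A ⧸ Ideal.span {x}) := Ideal.Quotient.nontrivial_iff.mpr
        (ne_top_of_le_ne_top (maximalIdeal.isMaximal A).ne_top
          ((Ideal.span_singleton_le_iff_mem _).mpr hx))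
      have : IsLocalRing (A ⧸ Ideal.span {x}) :=
        IsLocalRing.of_surjective' _ Ideal.Quotient.mk_surjective
      have hregA : IsSMulRegular A x := Module.Flat.isSMulRegular_of_nonZeroDivisors hreg
      have hsucc := ringKrullDim_quotient_span_singleton_succ_eq_ringKrullDim hregA hx
      obtain _ | n := n
      · have hbot : ringKrullDim (A ⧸ Ideal.span {x}) = ⊥ := by
          rw [← ENat.WithBot.add_one_le_zero_iff, hsucc, hdim, Nat.cast_zero]
        exact absurd hbot ringKrullDim_ne_bot
      have hdimB : ringKrullDim (A ⧸ Ideal.span {x}) = n := by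
        rw [hdim, Nat.cast_add, Nat.cast_one] at hsucc
        exact ENat.WithBot.add_one_cancel.mp hsucc
      have hm := hasProjectiveDimensionLT_maximalIdeal h
      have hmB := ModuleCat.hasProjectiveDimensionLT_quotient hreg (d + 1)
        (ModuleCat.of A (maximalIdeal A)) (hregA.submodule _ _)
      obtain ⟨i, r, hir⟩ := exists_retraction_residueField_quotient hx hx2
      let ρ : Retract (ModuleCat.of (A ⧸ Ideal.span {x}) (ResidueField (A ⧸ Ideal.span {x})))
          (ModuleCat.of (A ⧸ Ideal.span {x}) ((A ⧸ Ideal.span {x}) ⊗[A] maximalIdeal A)) :=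
        ⟨ModuleCat.ofHom i, ModuleCat.ofHom r, by
          rw [← ModuleCat.ofHom_comp, hir, ModuleCat.ofHom_id]⟩
      obtain ⟨t, htc, ht⟩ := ih n n.lt_succ_self hdimB (ρ.hasProjectiveDimensionLT (d + 1))
      obtain ⟨t', htc', ht'⟩ := exists_span_eq_maximalIdeal_of_quotient t ht
      exact ⟨t', by lia, ht'⟩
    · push Not at hs
      obtain ⟨s, hsm, hs⟩ := hs
      exact ⟨∅, by simp, by simp [maximalIdeal_eq_bot_of_hasProjectiveDimensionLT h hs hsm]⟩

end FiniteProjectiveDimension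

section Resolutions

open CategoryTheory IsLocalRing TensorProduct

universe u

theorem IsLocalRing.card_eq_of_span_eq_maximalIdeal {A : Type*} [CommRing A] [IsLocalRing A]
    [IsNoetherianRing A] {n : ℕ} (hdim : ringKrullDim A = n) {t : Finset A} (hcard : t.card ≤ n)
    (ht : Ideal.span (t : Set A) = maximalIdeal A) : t.card = n := by
  refine hcard.antisymm ?_
  have h₁ := ringKrullDim_le_spanFinrank_maximalIdeal A
  have h₂ : (maximalIdeal A).spanFinrank ≤ t.card := by
    rw [← ht, ← Set.ncard_coe_finset]
    exact Submodule.spanFinrank_span_le_ncard_of_finite t.finite_toSet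
  rw [hdim] at h₁
  exact (by exact_mod_cast h₁ : n ≤ _).trans h₂

theorem LinearMap.hasProjectiveDimensionLT_of_ker {A : Type u} [CommRing A] {P Q : Type u}
    [AddCommGroup P] [Module A P] [AddCommGroup Q] [Module A Q] [Module.Projective A P]
    {f : P →ₗ[A] Q} (hf : Function.Surjective f) {e : ℕ}
    (h : HasProjectiveDimensionLT (ModuleCat.of A (LinearMap.ker f)) (e + 1)) :
    HasProjectiveDimensionLT (ModuleCat.of A Q) (e + 2) :=
  ((LinearMap.shortExact_shortComplexKer hf).hasProjectiveDimensionLT_X₃_iff e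
    ((IsProjective.iff_projective _).mp ‹_›)).mpr h

theorem projective_range_of_exact_lTensor_residueField {A : Type*} [CommRing A] [IsLocalRing A]
    {U V W : Type*} [AddCommGroup U] [Module A U] [AddCommGroup V] [Module A V] [AddCommGroup W]
    [Module A W] [Module.Finite A V] [Module.Finite A W] [Module.Free A W]
    {a : U →ₗ[A] V} {b : V →ₗ[A] W} (hba : b ∘ₗ a = 0)
    (h : Function.Exact (a.lTensor (ResidueField A)) (b.lTensor (ResidueField A))) :
    Module.Projective A (LinearMap.range b) := by
  have hinj : Function.Injective ((LinearMap.range b).subtype.lTensor (ResidueField A)) := by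
    rw [injective_iff_map_eq_zero]
    intro z hz
    obtain ⟨v, rfl⟩ := LinearMap.lTensor_surjective (ResidueField A)
      (LinearMap.surjective_rangeRestrict b) z
    rw [← LinearMap.comp_apply, ← LinearMap.lTensor_comp] at hz
    obtain ⟨w, rfl⟩ := (h v).mp hz
    rw [← LinearMap.comp_apply, ← LinearMap.lTensor_comp,
      show b.rangeRestrict ∘ₗ a = 0 from
        LinearMap.ext fun u => Subtype.ext (LinearMap.congr_fun hba u),
      LinearMap.lTensor_zero, LinearMap.zero_apply]
  obtain ⟨l, hl⟩ := (split_injective_iff_lTensor_residueField_injective _).mpr hinj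
  exact Module.Projective.of_split _ l hl

theorem exists_hasProjectiveDimensionLT_of_exact {A : Type u} [CommRing A] [IsLocalRing A]
    {P : ℕ → Type u} [∀ i, AddCommGroup (P i)] [∀ i, Module A (P i)] [∀ i, Module.Finite A (P i)]
    [∀ i, Module.Free A (P i)] (d : ∀ i, P (i + 1) →ₗ[A] P i)
    (hd : ∀ i, Function.Exact (d (i + 1)) (d i)) {Q : Type u} [AddCommGroup Q] [Module A Q]
    (π : P 0 →ₗ[A] Q) (hπ : Function.Surjective π) (hdπ : Function.Exact (d 0) π) (n : ℕ)
    (hn : Function.Exact ((d (n + 1)).lTensor (ResidueField A))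
      ((d n).lTensor (ResidueField A))) :
    HasProjectiveDimensionLT (ModuleCat.of A Q) (n + 2) := by
  have key : ∀ j m, m + j = n →
      HasProjectiveDimensionLT (ModuleCat.of A (LinearMap.range (d m))) (j + 1) := by
    intro j
    induction j with
    | zero =>
      rintro m rfl
      rw [zero_add, ← projective_iff_hasProjectiveDimensionLT_one]
      exact (IsProjective.iff_projective _).mp
        (projective_range_of_exact_lTensor_residueField (hd m).linearMap_comp_eq_zero hn)
    | succ j ih =>
      intro m hm
      refine LinearMap.hasProjectiveDimensionLT_of_ker (LinearMap.surjective_rangeRestrict (d m)) ?_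
      rw [LinearMap.ker_rangeRestrict, (hd m).linearMap_ker_eq]
      exact ih (m + 1) (by lia)
  refine LinearMap.hasProjectiveDimensionLT_of_ker hπ ?_
  rw [hdπ.linearMap_ker_eq]
  exact key n 0 (zero_add n)

end Resolutions

section DerivedFibres

open TensorProduct IsLocalRing RingTheory.Sequence

section Fibres

variable {A : Type*} [CommRing A]

theorem exists_algebraMap_mul_eq_residueField_localization (p : Ideal A) [p.IsPrime]
    (c : ResidueField (Localization.AtPrime p)) :
    ∃ t a : A, algebraMap A (ResidueField (Localization.AtPrime p)) t ≠ 0 ∧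
      algebraMap A (ResidueField (Localization.AtPrime p)) t * c =
        algebraMap A (ResidueField (Localization.AtPrime p)) a := by
  obtain ⟨c, rfl⟩ := residue_surjective c
  obtain ⟨⟨a, t⟩, h⟩ := IsLocalization.surj p.primeCompl c
  have hunit := (IsLocalization.map_units (Localization.AtPrime p) t).map
    (residue (Localization.AtPrime p))
  refine ⟨t, a, hunit.ne_zero, ?_⟩
  rw [mul_comm]
  exact (map_mul (residue (Localization.AtPrime p)) c (algebraMap A _ t)).symm.trans
    (congrArg _ h)

theorem notMem_of_algebraMap_residueField_localization_ne_zero (p : Ideal A) [p.IsPrime] {t : A}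
    (ht : algebraMap A (ResidueField (Localization.AtPrime p)) t ≠ 0) : t ∉ p := by
  intro h
  apply ht
  rw [IsScalarTower.algebraMap_apply A (Localization.AtPrime p), ResidueField.algebraMap_eq,
    residue_eq_zero_iff]
  exact (IsLocalization.AtPrime.to_map_mem_maximal_iff (Localization.AtPrime p) p t).mpr h

variable [IsLocalRing A] {U V W : Type*} [AddCommGroup U] [Module A U]
  [AddCommGroup V] [Module A V] [AddCommGroup W] [Module A W] [Module.Finite A V]
  [Module.Free A V] [Module.Finite A W] [Module.Free A W] {a : U →ₗ[A] V} {b : V →ₗ[A] W}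

theorem exists_pow_maximalIdeal_smul_mem_range [IsNoetherianRing A] (hba : b ∘ₗ a = 0)
    (h : ∀ (p : Ideal A) [p.IsPrime], p ≠ maximalIdeal A →
      Function.Exact (a.lTensor (ResidueField (Localization.AtPrime p)))
        (b.lTensor (ResidueField (Localization.AtPrime p)))) :
    ∃ t : ℕ, ∀ x ∈ maximalIdeal A ^ t, ∀ (M : Type) [AddCommGroup M] [Module A M]
      (z : M ⊗[A] V), b.lTensor M z = 0 → ∃ y, a.lTensor M y = x • z := by
  let I : Ideal A :=
    { carrier := {x | ∀ (M : Type) [AddCommGroup M] [Module A M] (z : M ⊗[A] V),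
        b.lTensor M z = 0 → ∃ y, a.lTensor M y = x • z}
      zero_mem' := fun M _ _ z _ => ⟨0, by simp⟩
      add_mem' := fun {x x'} hx hx' M _ _ z hz => by
        obtain ⟨y, hy⟩ := hx M z hz
        obtain ⟨y', hy'⟩ := hx' M z hz
        exact ⟨y + y', by rw [map_add, hy, hy', add_smul]⟩
      smul_mem' := fun c x hx M _ _ z hz => by
        obtain ⟨y, hy⟩ := hx M z hz
        exact ⟨c • y, by rw [map_smul, hy, smul_smul, smul_eq_mul]⟩ }
  have hrad : maximalIdeal A ≤ I.radical := by
    rw [Ideal.radical_eq_sInf]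
    refine le_sInf fun p ⟨hIp, hp⟩ => ?_
    by_cases hpm : p = maximalIdeal A
    · exact hpm.ge
    · obtain ⟨t, ht, htI⟩ := exists_smul_mem_range_of_exact
        (exists_algebraMap_mul_eq_residueField_localization p) a b hba (h p hpm)
      exact absurd (hIp (show t ∈ I from fun M _ _ z hz => htI M z hz))
        (notMem_of_algebraMap_residueField_localization_ne_zero p ht)
  obtain ⟨t, ht⟩ := Ideal.exists_pow_le_of_le_radical_of_fg hrad (IsNoetherian.noetherian _)
  exact ⟨t, fun x hx M _ _ z hz => ht hx M z hz⟩

theorem exists_lTensor_eq_of_exact_lTensor_residueField (hba : b ∘ₗ a = 0)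
    (h : Function.Exact (a.lTensor (ResidueField A)) (b.lTensor (ResidueField A)))
    (M : Type) [AddCommGroup M] [Module A M] (z : M ⊗[A] V) (hz : b.lTensor M z = 0) :
    ∃ y, a.lTensor M y = z := by
  have hκ : ∀ c : ResidueField A, ∃ t a : A, algebraMap A (ResidueField A) t ≠ 0 ∧
      algebraMap A (ResidueField A) t * c = algebraMap A (ResidueField A) a := fun c => by
    obtain ⟨c, rfl⟩ := residue_surjective c
    exact ⟨1, c, by simp, by simp⟩
  obtain ⟨t, ht, H⟩ := exists_smul_mem_range_of_exact hκ a b hba h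
  obtain ⟨y, hy⟩ := H M z hz
  obtain ⟨u, rfl⟩ := (residue_ne_zero_iff_isUnit t).mp ht
  exact ⟨(↑u⁻¹ : A) • y, by rw [map_smul, hy, smul_smul, Units.inv_mul, one_smul]⟩

end Fibres

theorem maximalIdeal_smul_top_ne_top {A : Type*} [CommRing A] [IsLocalRing A] {M : Type*}
    [AddCommGroup M] [Module A M] {I : Ideal A} {t : ℕ} (ht : maximalIdeal A ^ t ≤ I)
    (hI : I • (⊤ : Submodule A M) ≠ ⊤) : maximalIdeal A • (⊤ : Submodule A M) ≠ ⊤ := by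
  intro h
  have hpow : ∀ s : ℕ, maximalIdeal A ^ s • (⊤ : Submodule A M) = ⊤ := by
    intro s
    induction s with
    | zero => simp
    | succ s ih => rw [pow_succ, Submodule.mul_smul, h, ih]
  exact hI (top_le_iff.mp ((hpow t).ge.trans (Submodule.smul_mono_left ht)))

theorem exact_and_exists_span_eq_maximalIdeal (k : Type*) {A : Type} [Field k] [CharZero k]
    [CommRing A] [IsLocalRing A] [IsNoetherianRing A] [Algebra k A] {n : ℕ}
    (hdim : ringKrullDim A = n) {P : ℕ → Type} [∀ i, AddCommGroup (P i)] [∀ i, Module A (P i)]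
    [∀ i, Module.Finite A (P i)] [∀ i, Module.Free A (P i)] (d : ∀ i, P (i + 1) →ₗ[A] P i)
    (hd : ∀ i, d i ∘ₗ d (i + 1) = 0)
    (hp : ∀ (p : Ideal A) [p.IsPrime], p ≠ maximalIdeal A → ∀ i,
      Function.Exact ((d (i + 1)).lTensor (ResidueField (Localization.AtPrime p)))
        ((d i).lTensor (ResidueField (Localization.AtPrime p))))
    (hk : ∀ i, n ≤ i → Function.Exact ((d (i + 1)).lTensor (ResidueField A))
      ((d i).lTensor (ResidueField A)))
    (π : P 0 →ₗ[A] ResidueField A) (hπ : Function.Surjective π) (hdπ : Function.Exact (d 0) π) :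
    (∀ i, Function.Exact (d (i + 1)) (d i)) ∧
      ∃ t : Finset A, t.card = n ∧ Ideal.span (t : Set A) = maximalIdeal A := by
  obtain ⟨K, _, _, C, _, _, τ, a, _, hinj, hτ, ham, t, ht⟩ :=
    exists_finite_cover_of_completion k hdim
  obtain ⟨M, _, _, hMreg, hM⟩ := exists_module_hasRegularPowers hinj τ a hτ
  have hmem : ∀ x ∈ List.ofFn a, x ∈ maximalIdeal A := by
    simpa [List.mem_ofFn] using ham
  have hacyclic := exact_lTensor_of_hasRegularPowers d hd n
    (fun j hj => exists_lTensor_eq_of_exact_lTensor_residueField (hd j) (hk j hj))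
    (fun j => exists_pow_maximalIdeal_smul_mem_range (hd j) fun p _ hpm => hp p hpm j)
    (List.ofFn a) hmem
  have hMm := maximalIdeal_smul_top_ne_top ht hM
  have hAreg : HasRegularPowers A (List.ofFn a) := fun rs hrs =>
    isWeaklyRegular_self_of_isWeaklyRegular M
      (fun N Q _ _ _ _ i ε hi hiε hε => lTensor_injective_of_presentation (d 1) (d 0) π (hd 0)
        (hacyclic M hMreg 0 (by simp)) hdπ i ε hi hiε hε hπ) hMm (hMreg rs hrs)
  have hexact : ∀ i, Function.Exact (d (i + 1)) (d i) := by
    intro i z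
    refine ⟨fun hz => ?_, ?_⟩
    · obtain ⟨y, hy⟩ := hacyclic A hAreg i (by simp) (1 ⊗ₜ z)
        (by rw [LinearMap.lTensor_tmul, hz, TensorProduct.tmul_zero])
      refine ⟨TensorProduct.lid A _ y, ?_⟩
      have hlid : d (i + 1) ∘ₗ (TensorProduct.lid A (P (i + 2))).toLinearMap =
          (TensorProduct.lid A (P (i + 1))).toLinearMap ∘ₗ (d (i + 1)).lTensor A := by
        ext
        simp
      refine (LinearMap.congr_fun hlid y).trans ?_
      rw [LinearMap.comp_apply, hy, LinearEquiv.coe_coe, TensorProduct.lid_tmul, one_smul]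
    · rintro ⟨y, rfl⟩
      exact LinearMap.congr_fun (hd i) y
  obtain ⟨s, hcard, hs⟩ := exists_card_le_span_eq_maximalIdeal n hdim
    (exists_hasProjectiveDimensionLT_of_exact d hexact π hπ hdπ n (hk n le_rfl))
  exact ⟨hexact, s, card_eq_of_span_eq_maximalIdeal hdim hcard hs, hs⟩

end DerivedFibres

open CategoryTheory CategoryTheory.Limits CategoryTheory.MonoidalCategory

section ChainComplex

universe u
theorem ChainComplex.isZero_homology_succ_iff {A : Type u} [CommRing A]
    (E : ChainComplex (ModuleCat.{u} A) ℕ) (i : ℕ) :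
    IsZero (E.homology (i + 1)) ↔
      Function.Exact (E.d (i + 2) (i + 1)).hom (E.d (i + 1) i).hom := by
  rw [← HomologicalComplex.exactAt_iff_isZero_homology,
    E.exactAt_iff' (i + 2) (i + 1) i (by simp) (by simp),
    ShortComplex.ShortExact.moduleCat_exact_iff_function_exact]
  rfl

theorem ChainComplex.isZero_homology_tensorRight_succ_iff {A : Type u} [CommRing A]
    (E : ChainComplex (ModuleCat.{u} A) ℕ) (N : Type u) [AddCommGroup N] [Module A N] (i : ℕ) :
    IsZero ((((tensorRight (ModuleCat.of A N)).mapHomologicalComplex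
        (ComplexShape.down ℕ)).obj E).homology (i + 1)) ↔
      Function.Exact ((E.d (i + 2) (i + 1)).hom.lTensor N) ((E.d (i + 1) i).hom.lTensor N) := by
  rw [ChainComplex.isZero_homology_succ_iff, ← LinearMap.rTensor_exact_iff_lTensor_exact]
  rfl

theorem ChainComplex.exists_surjective_exact_of_homology_zero_iso {A : Type u} [CommRing A]
    (E : ChainComplex (ModuleCat.{u} A) ℕ) {Q : Type u} [AddCommGroup Q] [Module A Q]
    (e : E.homology 0 ≅ ModuleCat.of A Q) :
    ∃ π : E.X 0 →ₗ[A] Q, Function.Surjective π ∧ Function.Exact (E.d 1 0).hom π := by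
  have hex : Function.Exact (E.d 1 0).hom (E.pOpcycles 0).hom :=
    (ShortComplex.ShortExact.moduleCat_exact_iff_function_exact _).mp
      (ShortComplex.exact_of_g_is_cokernel
        (ShortComplex.mk (E.d 1 0) (E.pOpcycles 0) (E.d_pOpcycles 1 0))
        (E.opcyclesIsCokernel 1 0 (by simp)))
  let φ := (E.isoHomologyι₀.symm ≪≫ e).toLinearEquiv
  refine ⟨φ.toLinearMap ∘ₗ (E.pOpcycles 0).hom, ?_, ?_⟩
  · exact φ.surjective.comp ((ModuleCat.epi_iff_surjective _).mp inferInstance)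
  · exact (φ.injective.comp_exact_iff_exact).mpr hex

end ChainComplex

/-- Let `A` be a Noetherian local `ℂ`-algebra of Krull dimension `n` with residue field
`k`, and `E` a non-negatively graded complex of finitely generated free modules such
that the homology of `E ⊗ κ(p)` vanishes in all degrees for every non-maximal prime
`p`, the homology of `E ⊗ k` vanishes outside degrees `0,…,n`, and `H_0(E) ≅ k`.
Then `A` is regular (its maximal ideal is generated by `n` elements) and
`H_i(E) = 0` for all `i ≠ 0`, with `H_0(E) ≅ k`. -/
theorem regular_of_derived_fibres_at_point
    (A : Type) [CommRing A] [IsLocalRing A] [IsNoetherianRing A] [Algebra ℂ A]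
    (n : ℕ) (hdim : ringKrullDim A = n)
    (E : ChainComplex (ModuleCat A) ℕ)
    (hfree : ∀ i, Module.Finite A (E.X i) ∧ Module.Free A (E.X i))
    (h1 : ∀ (p : Ideal A) (hp : p.IsPrime), p ≠ IsLocalRing.maximalIdeal A → ∀ i,
      IsZero ((((tensorRight (ModuleCat.of A
        (IsLocalRing.ResidueField (Localization.AtPrime p)))).mapHomologicalComplex
        (ComplexShape.down ℕ)).obj E).homology i))
    (h2 : ∀ i, n < i →
      IsZero ((((tensorRight (ModuleCat.of A
        (IsLocalRing.ResidueField A))).mapHomologicalComplex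
        (ComplexShape.down ℕ)).obj E).homology i))
    (h3 : Nonempty (E.homology 0 ≅ ModuleCat.of A (IsLocalRing.ResidueField A))) :
    (∃ t : Finset A, t.card = n ∧
      Ideal.span (t : Set A) = IsLocalRing.maximalIdeal A) ∧
    (∀ i, i ≠ 0 → IsZero (E.homology i)) ∧
    Nonempty (E.homology 0 ≅ ModuleCat.of A (IsLocalRing.ResidueField A)) := by
  have := fun i => (hfree i).1
  have := fun i => (hfree i).2
  obtain ⟨π, hπ, hdπ⟩ := E.exists_surjective_exact_of_homology_zero_iso h3.some
  obtain ⟨hexact, ht⟩ := exact_and_exists_span_eq_maximalIdeal ℂ hdim (P := fun i => E.X i)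
    (fun i => (E.d (i + 1) i).hom)
    (fun i => by rw [← ModuleCat.hom_comp, E.d_comp_d, ModuleCat.hom_zero])
    (fun p hp hpm i => (E.isZero_homology_tensorRight_succ_iff _ i).mp (h1 p hp hpm (i + 1)))
    (fun i hi => (E.isZero_homology_tensorRight_succ_iff _ i).mp (h2 (i + 1) (by lia)))
    π hπ hdπ
  refine ⟨ht, fun i hi => ?_, h3⟩
  obtain ⟨i, rfl⟩ := Nat.exists_eq_succ_of_ne_zero hi
  exact (E.isZero_homology_succ_iff i).mpr (hexact i)
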